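/- Let f be a topologically transitive homeomorphism of T² homotopic to the identity. (1) If ρ(f) has nonempty interior, then f is topologically mixing. (2) If moreover f has a lift f̂ with (0,0) ∈ int ρ(f̂), then f̂ is topologically mixing as a homeomorphism of ℝ². -/

import Mathlib

open Metric Filter Topology MeasureTheory Set ENNReal

noncomputable section

abbrev R2 : Type := ℝ × ℝ

abbrev Torus : Type := AddCircle (1 : ℝ) × AddCircle (1 : ℝ)

instance : Fact ((0:ℝ) < 1) := ⟨one_pos⟩

/-- The covering projection `ℝ² → T²`. -/
def proj : R2 → Torus := fun p => ((p.1 : AddCircle (1:ℝ)), (p.2 : AddCircle (1:ℝ)))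

/-- `F : ℝ² → ℝ²` is a lift of `f : T² → T²` (commutes with the projection and
with the integer translations). -/
def IsLiftFun (f : Torus → Torus) (F : R2 → R2) : Prop :=
  (∀ x : R2, proj (F x) = f (proj x)) ∧
  ∀ (x : R2) (v : ℤ × ℤ), F (x + ((v.1 : ℝ), (v.2 : ℝ))) = F x + ((v.1 : ℝ), (v.2 : ℝ))

/-- Iteration of a homeomorphism indexed by `ℤ`. -/
def iterZ {X : Type*} [TopologicalSpace X] (F : X ≃ₜ X) : ℤ → X → X
  | Int.ofNat n => (⇑F)^[n]
  | Int.negSucc n => (⇑F.symm)^[n+1]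

/-- The rotation set of a lift. -/
def rotSet (F : R2 ≃ₜ R2) : Set R2 :=
  {v | ∃ (z : ℕ → R2) (n : ℕ → ℕ), Tendsto n atTop atTop ∧
    Tendsto (fun k => ((n k : ℝ))⁻¹ • ((⇑F)^[n k] (z k) - z k)) atTop (nhds v)}

/-- A continuum: a nonempty compact connected set. -/
def IsContinuum {X : Type*} [TopologicalSpace X] (K : Set X) : Prop :=
  IsCompact K ∧ IsConnected K

/-- Dynamical diameter of a set under a homeomorphism of the plane. -/
def dynDiam (F : R2 ≃ₜ R2) (K : Set R2) : ℝ≥0∞ :=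
  ⨆ j : ℤ, EMetric.diam (iterZ F j '' K)

/-- Topological mixing. -/
def TopologicallyMixing {X : Type*} [TopologicalSpace X] (h : X → X) : Prop :=
  ∀ U V : Set X, IsOpen U → IsOpen V → U.Nonempty → V.Nonempty →
    ∃ n₀ : ℕ, ∀ n, n₀ ≤ n → ((h^[n]) '' U ∩ V).Nonempty

/-- Maximal cardinality of a `(±n, ε)`-separated subset of `K`. -/
def sepCount (g : Torus ≃ₜ Torus) (n : ℕ) (ε : ℝ) (K : Set Torus) : ℕ :=
  sSup {m : ℕ | ∃ Y : Finset Torus, ↑Y ⊆ K ∧ Y.card = m ∧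
    ∀ y ∈ Y, ∀ y' ∈ Y, y ≠ y' →
      ∃ i : ℤ, |i| ≤ (n : ℤ) ∧ ε < dist (iterZ g i y) (iterZ g i y')}

/-- The two-sided entropy `h_±(g, K)` carried by `K`. -/
def entropyPM (g : Torus ≃ₜ Torus) (K : Set Torus) : EReal :=
  ⨆ (ε : ℝ) (_ : 0 < ε),
    limsup (fun n : ℕ => ((Real.log (sepCount g n ε K) / n : ℝ) : EReal)) atTop

/-- Connected component of the `ε`-stable set of `z` containing `z`. -/
def stableComp (G : R2 ≃ₜ R2) (ε : ℝ) (z : R2) : Set R2 :=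
  connectedComponentIn {z' : R2 | ∀ j : ℕ, dist ((⇑G)^[j] z') ((⇑G)^[j] z) ≤ ε} z

/-- The stable set of `z`. -/
def stableSet (G : R2 ≃ₜ R2) (z : R2) : Set R2 := ⋃ ε > 0, stableComp G ε z

/-- Connected component of the `ε`-unstable set of `z` containing `z`. -/
def unstableComp (G : R2 ≃ₜ R2) (ε : ℝ) (z : R2) : Set R2 :=
  connectedComponentIn {z' : R2 | ∀ j : ℕ, dist ((⇑G.symm)^[j] z') ((⇑G.symm)^[j] z) ≤ ε} z

/-- The unstable set of `z`. -/
def unstableSet (G : R2 ≃ₜ R2) (z : R2) : Set R2 := ⋃ ε > 0, unstableComp G ε z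

/-- Two points are dynamically related if some dynamically bounded continuum contains both. -/
def dynRel (F : R2 ≃ₜ R2) (z z' : R2) : Prop :=
  ∃ K : Set R2, IsContinuum K ∧ z ∈ K ∧ z' ∈ K ∧ dynDiam F K ≠ ⊤

/-- The equivalence class of `z` under the dynamically-bounded relation. -/
def dynClass (F : R2 ≃ₜ R2) (z : R2) : Set R2 := {z' | dynRel F z z'}


def dt (e w : ℂ) : ℝ := e.re * w.re + e.im * w.im

theorem dt_add (e a b : ℂ) : dt e (a + b) = dt e a + dt e b := by simp [dt]; ring
theorem dt_sub (e a b : ℂ) : dt e (a - b) = dt e a - dt e b := by simp [dt]; ring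
theorem dt_neg (e a : ℂ) : dt e (-a) = - dt e a := by simp [dt]; ring
theorem dt_neg_left (e a : ℂ) : dt (-e) a = - dt e a := by simp [dt]; ring
theorem dt_real (e a : ℂ) (t : ℝ) : dt e (t * a) = t * dt e a := by simp [dt]; ring
theorem dt_nat (e a : ℂ) (t : ℕ) : dt e (t * a) = t * dt e a := by
  simpa using dt_real e a t
theorem dt_zero (e : ℂ) : dt e 0 = 0 := by simp [dt]

theorem abs_dt_le {e w : ℂ} (he : ‖e‖ = 1) : |dt e w| ≤ ‖w‖ := by
  have h1 : (dt e w)^2 ≤ ‖w‖^2 := by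
    have h2 : e.re^2 + e.im^2 = 1 := by
      have := Complex.sq_norm e
      rw [he, Complex.normSq_apply] at this; nlinarith
    rw [Complex.sq_norm, Complex.normSq_apply, dt]
    nlinarith [sq_nonneg (e.re * w.im - e.im * w.re)]
  exact abs_le_of_sq_le_sq h1 (norm_nonneg _)

theorem dt_le {e w : ℂ} (he : ‖e‖ = 1) : dt e w ≤ ‖w‖ := (le_abs_self _).trans (abs_dt_le he)
theorem neg_le_dt {e w : ℂ} (he : ‖e‖ = 1) : -‖w‖ ≤ dt e w := (abs_le.1 (abs_dt_le he)).1

theorem dt_mul_I (e v : ℂ) (he : ‖e‖ = 1) : dt e ((-Complex.I * e) * v) = v.im := by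
  have h2 : e.re^2 + e.im^2 = 1 := by
    have := Complex.sq_norm e
    rw [he, Complex.normSq_apply] at this; nlinarith
  simp [dt]; linear_combination v.im * h2

/-! ### logarithms -/

theorem eq_of_exp_eq {a b : ℂ} (h : Complex.exp a = Complex.exp b)
    (him : |a.im - b.im| < 2 * Real.pi) : a = b := by
  obtain ⟨n, hn⟩ := Complex.exp_eq_exp_iff_exists_int.1 h
  have : n = 0 := by
    have h1 : a.im = b.im + n * (2 * Real.pi) := by
      rw [hn]; simp
    rw [h1] at him
    have h2 : |(n:ℝ)| * (2 * Real.pi) < 1 * (2 * Real.pi) := by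
      rw [← abs_of_pos Real.two_pi_pos, ← abs_mul]
      simpa [abs_of_pos Real.pi_pos] using him
    have h3 := lt_of_mul_lt_mul_right h2 Real.two_pi_pos.le
    have : |n| < 1 := by exact_mod_cast h3
    exact Int.abs_lt_one_iff.1 this
  simpa [this] using hn

theorem log_div_of {v w : ℂ} (hv : v ≠ 0) (hw : w ≠ 0) (h : |w.arg - v.arg| < Real.pi) :
    Complex.log (w / v) = Complex.log w - Complex.log v := by
  have : w / v = Complex.exp (Complex.log w - Complex.log v) := by
    rw [Complex.exp_sub, Complex.exp_log hv, Complex.exp_log hw]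
  rw [this, Complex.log_exp] <;> simp only [Complex.sub_im, Complex.log_im]
  · exact (abs_lt.1 h).1
  · exact (abs_lt.1 h).2.le

theorem const_of_exp_one {X : Type*} [TopologicalSpace X] {s : Set X} (hs : IsPreconnected s)
    {D : X → ℂ} (hD : ContinuousOn D s) (h1 : ∀ x ∈ s, Complex.exp (D x) = 1) {x y : X}
    (hx : x ∈ s) (hy : y ∈ s) : D x = D y := by
  have hdisc : DiscreteTopology (AddSubgroup.zmultiples (2 * Real.pi * Complex.I)) :=
    NormedSpace.discreteTopology_zmultiples _
  refine hs.constant_of_mapsTo (T := (AddSubgroup.zmultiples (2 * Real.pi * Complex.I) : Set ℂ))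
    ⟨hdisc⟩ hD ?_ hx hy
  intro z hz
  obtain ⟨n, hn⟩ := Complex.exp_eq_one_iff.1 (h1 z hz)
  exact ⟨n, by simp [hn]⟩

theorem re_pos_of_near {w : ℂ} (h : ‖w - 1‖ ≤ 1/2) : 0 < w.re := by
  have := (Complex.abs_re_le_norm (w - 1)).trans h
  rw [Complex.sub_re, Complex.one_re, abs_le] at this
  linarith [this.1]

theorem abs_arg_lt {w : ℂ} (h : 0 < w.re) : |w.arg| < Real.pi / 2 :=
  Complex.abs_arg_lt_pi_div_two_iff.2 (Or.inl h)

/-- continuous logarithm on a nice space -/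
theorem exists_log {X : Type*} [TopologicalSpace X] [SimplyConnectedSpace X]
    [LocallyPathConnectedSpace X] {g : X → ℂ} (hg : Continuous g) (h0 : ∀ x, g x ≠ 0) :
    ∃ φ : X → ℂ, Continuous φ ∧ ∀ x, Complex.exp (φ x) = g x := by
  obtain ⟨x0⟩ : Nonempty X := inferInstance
  obtain ⟨φ, ⟨-, h⟩, -⟩ := Complex.isCoveringMapOn_exp.existsUnique_continuousMap_lifts
    (⟨g, hg⟩ : C(X, ℂ)) (a₀ := x0) (e₀ := Complex.log (g x0)) (by simpa using Complex.exp_log (h0 x0))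
    (fun x => by simpa using h0 x)
  exact ⟨φ, φ.continuous, fun x => congrFun h x⟩

theorem norm_div_sub_one {a b : ℂ} (hb : b ≠ 0) (h : ‖a - b‖ ≤ ‖b‖ / 2) : ‖a / b - 1‖ ≤ 1/2 := by
  have : a / b - 1 = (a - b) / b := by field_simp
  rw [this, norm_div, div_le_iff₀ (norm_pos_iff.2 hb)]; linarith

theorem exists_lift (F : ℂ ≃ₜ ℂ) (C0 : ℝ) (h1 : 1 ≤ C0) (hd : ∀ z, ‖F z - z‖ ≤ C0) :
    ∃ Φ : ℂ × ℂ → ℂ, Continuous Φ ∧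
      (∀ x ζ, Complex.exp (Φ (x, ζ)) = F (x + Complex.exp ζ) - F x) ∧
      ∀ x ζ, 4 * C0 ≤ ‖Complex.exp ζ‖ →
        Φ (x, ζ) = ζ + Complex.log ((F (x + Complex.exp ζ) - F x) / Complex.exp ζ) := by
  set g : ℂ × ℂ → ℂ := fun p => (F (p.1 + Complex.exp p.2) - F p.1) / Complex.exp p.2 with hg
  have hgc : Continuous g := by
    refine Continuous.div ?_ (by fun_prop) (fun p => Complex.exp_ne_zero _)
    have := F.continuous
    fun_prop
  have hg0 : ∀ p, g p ≠ 0 := by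
    intro p
    refine div_ne_zero (sub_ne_zero.2 fun h => ?_) (Complex.exp_ne_zero _)
    have := F.injective h
    simp at this
  obtain ⟨φ, hφ, hφe⟩ := exists_log hgc hg0
  set s : Set (ℂ × ℂ) := {p | Real.log (4 * C0) ≤ p.2.re} with hs
  have hsc : IsPreconnected s := by
    apply Convex.isPreconnected
    exact convex_halfSpace_ge (f := fun p : ℂ × ℂ => p.2.re)
      ⟨fun _ _ => by simp, fun _ _ => by simp⟩ _
  have hmem : ∀ p : ℂ × ℂ, 4 * C0 ≤ ‖Complex.exp p.2‖ → p ∈ s := by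
    intro p hp
    rw [Complex.norm_exp] at hp
    rw [hs, mem_ofPred_eq]
    exact (Real.log_le_iff_le_exp (by linarith)).2 hp
  have hre : ∀ p ∈ s, 0 < (g p).re := by
    intro p hp
    apply re_pos_of_near
    apply norm_div_sub_one (Complex.exp_ne_zero _)
    have h2 : 4 * C0 ≤ ‖Complex.exp p.2‖ := by
      rw [Complex.norm_exp]
      exact (Real.log_le_iff_le_exp (by linarith)).1 hp
    have h3 := hd (p.1 + Complex.exp p.2)
    have h4 := hd p.1
    have : F (p.1 + Complex.exp p.2) - F p.1 - Complex.exp p.2 =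
      (F (p.1 + Complex.exp p.2) - (p.1 + Complex.exp p.2)) - (F p.1 - p.1) := by ring
    rw [this]
    refine (norm_sub_le _ _).trans ?_
    linarith
  set p0 : ℂ × ℂ := (0, (Real.log (4 * C0) : ℂ)) with hp0
  have hp0s : p0 ∈ s := by rw [hs, mem_ofPred_eq, hp0]; simp only [Complex.ofReal_re]; exact le_rfl
  have hD : ContinuousOn (fun p => φ p - Complex.log (g p)) s := by
    refine hφ.continuousOn.sub ?_
    intro p hp
    exact (ContinuousAt.clog hgc.continuousAt (Or.inl (hre p hp))).continuousWithinAt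
  have hconst : ∀ p ∈ s, φ p - Complex.log (g p) = φ p0 - Complex.log (g p0) := by
    intro p hp
    refine const_of_exp_one hsc hD ?_ hp hp0s
    intro q _
    rw [Complex.exp_sub, hφe, Complex.exp_log (hg0 q), div_self (hg0 q)]
  refine ⟨fun p => p.2 + φ p - (φ p0 - Complex.log (g p0)), by fun_prop, ?_, ?_⟩
  · intro x ζ
    simp only [Complex.exp_sub, Complex.exp_add, hφe, Complex.exp_log (hg0 p0), div_self (hg0 p0),
      div_one]
    simp only [hg]
    field_simp [Complex.exp_ne_zero]
  · intro x ζ hζ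
    have := hconst (x, ζ) (hmem _ hζ)
    simp only
    rw [← this]
    simp only [hg]; ring

/-! ## Part 2 -/
/-- iterated lift of logarithms -/
def zt (F : ℂ ≃ₜ ℂ) (Φ : ℂ × ℂ → ℂ) (x ζ : ℂ) : ℕ → ℂ
  | 0 => ζ
  | j + 1 => Φ ((⇑F)^[j] x, zt F Φ x ζ j)

theorem exp_zt {F : ℂ ≃ₜ ℂ} {Φ : ℂ × ℂ → ℂ}
    (hΦ : ∀ x ζ, Complex.exp (Φ (x, ζ)) = F (x + Complex.exp ζ) - F x) (x ζ : ℂ) (j : ℕ) :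
    Complex.exp (zt F Φ x ζ j) = (⇑F)^[j] (x + Complex.exp ζ) - (⇑F)^[j] x := by
  induction j with
  | zero => simp [zt]
  | succ j ih =>
    rw [zt, hΦ, ih, Function.iterate_succ_apply', Function.iterate_succ_apply']
    rw [add_sub_cancel]

theorem continuous_zt {F : ℂ ≃ₜ ℂ} {Φ : ℂ × ℂ → ℂ} (hc : Continuous Φ) (j : ℕ) :
    Continuous fun p : ℂ × ℂ => zt F Φ p.1 p.2 j := by
  induction j with
  | zero => simpa [zt] using continuous_snd
  | succ j ih =>
    simp only [zt]
    have := F.continuous.iterate j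
    exact hc.comp ((this.comp continuous_fst).prodMk ih)

theorem zt_far {F : ℂ ≃ₜ ℂ} {Φ : ℂ × ℂ → ℂ} {C0 : ℝ}
    (hΦ : ∀ x ζ, Complex.exp (Φ (x, ζ)) = F (x + Complex.exp ζ) - F x)
    (hΦ' : ∀ x ζ, 4 * C0 ≤ ‖Complex.exp ζ‖ →
        Φ (x, ζ) = ζ + Complex.log ((F (x + Complex.exp ζ) - F x) / Complex.exp ζ))
    {x ζ y : ℂ} (hy : y = x + Complex.exp ζ) {j : ℕ}
    (hf : 4 * C0 ≤ ‖(⇑F)^[j] y - (⇑F)^[j] x‖) :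
    zt F Φ x ζ (j+1) = zt F Φ x ζ j + Complex.log (((⇑F)^[j+1] y - (⇑F)^[j+1] x) /
      ((⇑F)^[j] y - (⇑F)^[j] x)) := by
  subst hy
  rw [zt, hΦ', exp_zt hΦ]
  · rw [Function.iterate_succ_apply', Function.iterate_succ_apply']
    rw [add_sub_cancel]
  · rwa [exp_zt hΦ]

theorem step_le {F : ℂ ≃ₜ ℂ} {C0 : ℝ} (hd : ∀ z, ‖F z - z‖ ≤ C0) (x y : ℂ) (j : ℕ) :
    ‖((⇑F)^[j+1] y - (⇑F)^[j+1] x) - ((⇑F)^[j] y - (⇑F)^[j] x)‖ ≤ 2 * C0 := by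
  rw [Function.iterate_succ_apply', Function.iterate_succ_apply']
  have h1 := hd ((⇑F)^[j] y)
  have h2 := hd ((⇑F)^[j] x)
  have : F ((⇑F)^[j] y) - F ((⇑F)^[j] x) - ((⇑F)^[j] y - (⇑F)^[j] x) =
    (F ((⇑F)^[j] y) - (⇑F)^[j] y) - (F ((⇑F)^[j] x) - (⇑F)^[j] x) := by ring
  rw [this]
  exact (norm_sub_le _ _).trans (by linarith)

/-- a step that does not cross the negative axis -/
theorem log_step {v w : ℂ} {R : ℝ} (hR : 0 < R) (hv : |v.im| ≤ R → R < v.re)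
    (hw : |w.im| ≤ R → R < w.re) (hs : ‖w - v‖ ≤ R / 2) :
    Complex.log (w / v) = Complex.log w - Complex.log v := by
  have hv0 : v ≠ 0 := by
    rintro rfl
    have := hv (by simpa using hR.le)
    simp at this; linarith
  have hw0 : w ≠ 0 := by
    rintro rfl
    have := hw (by simpa using hR.le)
    simp at this; linarith
  apply log_div_of hv0 hw0
  have him := (Complex.abs_im_le_norm (w - v)).trans hs
  rw [Complex.sub_im] at him
  have hpi := Real.pi_pos
  by_cases h : 0 < v.re ∧ 0 < w.re
  · have h1 := abs_lt.1 (abs_arg_lt h.1)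
    have h2 := abs_lt.1 (abs_arg_lt h.2)
    rw [abs_lt]; constructor <;> linarith
  · have key : R / 2 < |v.im| ∧ R / 2 < |w.im| := by
      by_contra hcon
      apply h
      have h3 := abs_abs_sub_abs_le_abs_sub w.im v.im
      have h4 := abs_le.1 (h3.trans him)
      have h5 : |v.im| ≤ R ∧ |w.im| ≤ R := by
        rw [not_and_or, not_lt, not_lt] at hcon
        rcases hcon with hc | hc <;> constructor <;> linarith [h4.1, h4.2]
      exact ⟨hR.trans (hv h5.1), hR.trans (hw h5.2)⟩
    have him' := abs_le.1 him
    rcases lt_or_ge 0 v.im with hvi | hvi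
    · have hwi : 0 < w.im := by
        rw [abs_of_pos hvi] at key
        linarith [key.1, him'.1]
      have h1 : 0 ≤ v.arg := Complex.arg_nonneg_iff.2 hvi.le
      have h2 : 0 ≤ w.arg := Complex.arg_nonneg_iff.2 hwi.le
      have h3 : v.arg < Real.pi := Complex.arg_lt_pi_iff.2 (Or.inr hvi.ne')
      have h4 : w.arg < Real.pi := Complex.arg_lt_pi_iff.2 (Or.inr hwi.ne')
      rw [abs_lt]; constructor <;> linarith
    · have hvi' : v.im < 0 := by
        rcases hvi.lt_or_eq with h | h
        · exact h
        · rw [h] at key; simp at key; linarith [key.1]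
      have hwi : w.im < 0 := by
        rw [abs_of_neg hvi'] at key
        linarith [key.1, him'.2]
      have h1 := Complex.neg_pi_lt_arg v
      have h2 := Complex.neg_pi_lt_arg w
      have h3 : v.arg < 0 := Complex.arg_neg_iff.2 hvi'
      have h4 : w.arg < 0 := Complex.arg_neg_iff.2 hwi
      rw [abs_lt]; constructor <;> linarith

/-- telescoping along a far orbit staying on the good side -/
theorem zt_track {F : ℂ ≃ₜ ℂ} {Φ : ℂ × ℂ → ℂ} {C0 : ℝ} (hC : 1 ≤ C0) (hd : ∀ z, ‖F z - z‖ ≤ C0)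
    (hΦ : ∀ x ζ, Complex.exp (Φ (x, ζ)) = F (x + Complex.exp ζ) - F x)
    (hΦ' : ∀ x ζ, 4 * C0 ≤ ‖Complex.exp ζ‖ →
        Φ (x, ζ) = ζ + Complex.log ((F (x + Complex.exp ζ) - F x) / Complex.exp ζ))
    {x ζ y f : ℂ} (hf : ‖f‖ = 1) (hy : y = x + Complex.exp ζ) {N : ℕ}
    (hv : ∀ j ≤ N, |(((⇑F)^[j] y - (⇑F)^[j] x) / f).im| ≤ 4 * C0 →
      4 * C0 < (((⇑F)^[j] y - (⇑F)^[j] x) / f).re) :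
    ∀ j ≤ N, zt F Φ x ζ j = ζ + Complex.log (((⇑F)^[j] y - (⇑F)^[j] x) / f) -
      Complex.log ((y - x) / f) := by
  have hf0 : f ≠ 0 := by rintro rfl; simp at hf
  intro j
  induction j with
  | zero => intro _; simp [zt]
  | succ j ih =>
    intro hj
    have hfar : 4 * C0 ≤ ‖(⇑F)^[j] y - (⇑F)^[j] x‖ := by
      set v := ((⇑F)^[j] y - (⇑F)^[j] x) / f with hvd
      have : ‖(⇑F)^[j] y - (⇑F)^[j] x‖ = ‖v‖ := by rw [hvd, norm_div, hf, div_one]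
      rw [this]
      by_cases h : |v.im| ≤ 4 * C0
      · exact ((hv j (by omega) h).le.trans (le_abs_self _)).trans (Complex.abs_re_le_norm v)
      · exact (not_le.1 h).le.trans (Complex.abs_im_le_norm v)
    rw [zt_far hΦ hΦ' hy hfar, ih (by omega)]
    have h1 : ((⇑F)^[j+1] y - (⇑F)^[j+1] x) / ((⇑F)^[j] y - (⇑F)^[j] x) =
      (((⇑F)^[j+1] y - (⇑F)^[j+1] x) / f) / (((⇑F)^[j] y - (⇑F)^[j] x) / f) := by
      field_simp
    rw [h1, log_step (R := 4 * C0) (by linarith) (hv j (by omega)) (hv (j+1) hj)]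
    · ring
    · rw [← sub_div, norm_div, hf, div_one]
      exact (step_le hd x y j).trans (by linarith)

theorem log_neg_of_im_pos {v : ℂ} (h : 0 < v.im) :
    Complex.log (-v) = Complex.log v - Real.pi * Complex.I := by
  apply Complex.ext
  · simp [Complex.log_re]
  · simp [Complex.log_im, Complex.arg_neg_eq_arg_sub_pi_of_im_pos h]

theorem log_neg_of_im_neg {v : ℂ} (h : v.im < 0) :
    Complex.log (-v) = Complex.log v + Real.pi * Complex.I := by
  apply Complex.ext
  · simp [Complex.log_re]
  · simp [Complex.log_im, Complex.arg_neg_eq_arg_add_pi_of_im_neg h]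

theorem log_div_same_pos {v w : ℂ} (hv : 0 < v.im) (hw : 0 < w.im) :
    Complex.log (w / v) = Complex.log w - Complex.log v := by
  apply log_div_of (by rintro rfl; simp at hv) (by rintro rfl; simp at hw)
  have h1 : 0 ≤ v.arg := Complex.arg_nonneg_iff.2 hv.le
  have h2 : 0 ≤ w.arg := Complex.arg_nonneg_iff.2 hw.le
  have h3 : v.arg < Real.pi := Complex.arg_lt_pi_iff.2 (Or.inr hv.ne')
  have h4 : w.arg < Real.pi := Complex.arg_lt_pi_iff.2 (Or.inr hw.ne')
  rw [abs_lt]; constructor <;> linarith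

theorem log_div_same_neg {v w : ℂ} (hv : v.im < 0) (hw : w.im < 0) :
    Complex.log (w / v) = Complex.log w - Complex.log v := by
  apply log_div_of (by rintro rfl; simp at hv) (by rintro rfl; simp at hw)
  have h1 := Complex.neg_pi_lt_arg v
  have h2 := Complex.neg_pi_lt_arg w
  have h3 : v.arg < 0 := Complex.arg_neg_iff.2 hv
  have h4 : w.arg < 0 := Complex.arg_neg_iff.2 hw
  rw [abs_lt]; constructor <;> linarith

/-- The winding contradiction. -/
theorem wind (F : ℂ ≃ₜ ℂ) (C0 : ℝ) (hC : 1 ≤ C0) (hd : ∀ z, ‖F z - z‖ ≤ C0)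
    (p : ℝ → ℂ) (hp : Continuous p) (N : ℕ) (z z' f : ℂ) (hf : ‖f‖ = 1)
    (h0 : ∀ s, p s ≠ z ∧ ‖z' - z‖ ≤ ‖p s - z‖ / 2)
    (hN : ∀ s, ‖(⇑F)^[N] z' - (⇑F)^[N] z‖ ≤ ‖(⇑F)^[N] (p s) - (⇑F)^[N] z‖ / 2)
    (href : ∀ j ≤ N, ‖(⇑F)^[j] z' - (⇑F)^[j] z‖ ≤ ‖(⇑F)^[j] (p 0) - (⇑F)^[j] z‖ / 2 ∧
      4 * C0 ≤ ‖(⇑F)^[j] (p 0) - (⇑F)^[j] z‖ ∧ 4 * C0 ≤ ‖(⇑F)^[j] (p 0) - (⇑F)^[j] z'‖)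
    (hv : ∀ j ≤ N, |(((⇑F)^[j] (p 1) - (⇑F)^[j] z) / f).im| ≤ 4 * C0 →
      4 * C0 < (((⇑F)^[j] (p 1) - (⇑F)^[j] z) / f).re)
    (hv' : ∀ j ≤ N, |(((⇑F)^[j] (p 1) - (⇑F)^[j] z') / f).im| ≤ 4 * C0 →
      (((⇑F)^[j] (p 1) - (⇑F)^[j] z') / f).re < - (4 * C0))
    (i0 : 0 < ((p 1 - z) / f).im) (i0' : 0 < ((p 1 - z') / f).im)
    (iN : (((⇑F)^[N] (p 1) - (⇑F)^[N] z) / f).im < 0)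
    (iN' : (((⇑F)^[N] (p 1) - (⇑F)^[N] z') / f).im < 0) : False := by
  have hf0 : f ≠ 0 := by rintro rfl; simp at hf
  obtain ⟨Φ, hΦc, hΦ, hΦ'⟩ := exists_lift F C0 hC hd
  have hinj : ∀ (j : ℕ) {a b : ℂ}, a ≠ b → (⇑F)^[j] a - (⇑F)^[j] b ≠ 0 := fun j a b hab =>
    sub_ne_zero.2 fun h => hab (F.injective.iterate j h)
  have hpz : ∀ s, p s - z ≠ 0 := fun s => sub_ne_zero.2 (h0 s).1
  have hnear : ∀ (j : ℕ) (y : ℂ), y ≠ z →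
      ‖(⇑F)^[j] z' - (⇑F)^[j] z‖ ≤ ‖(⇑F)^[j] y - (⇑F)^[j] z‖ / 2 →
      0 < (((⇑F)^[j] y - (⇑F)^[j] z') / ((⇑F)^[j] y - (⇑F)^[j] z)).re := by
    intro j y hy h
    apply re_pos_of_near
    apply norm_div_sub_one (hinj j hy)
    have : (⇑F)^[j] y - (⇑F)^[j] z' - ((⇑F)^[j] y - (⇑F)^[j] z) =
      -((⇑F)^[j] z' - (⇑F)^[j] z) := by ring
    rwa [this, norm_neg]
  have hpz' : ∀ s, p s - z' ≠ 0 := by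
    intro s hs
    have := hnear 0 (p s) (h0 s).1 (by simpa using (h0 s).2)
    simp [hs] at this
  obtain ⟨ζ, hζc, hζ⟩ := exists_log (X := ℝ) (g := fun s => p s - z) (by fun_prop) hpz
  set ζ' : ℝ → ℂ := fun s => ζ s + Complex.log ((p s - z') / (p s - z)) with hζ'
  have hζ'c : Continuous ζ' := by
    refine hζc.add (Continuous.clog (Continuous.div (by fun_prop) (by fun_prop) hpz) fun s => ?_)
    left
    simpa using hnear 0 (p s) (h0 s).1 (by simpa using (h0 s).2)
  have hζ'e : ∀ s, Complex.exp (ζ' s) = p s - z' := by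
    intro s
    simp only [hζ']
    rw [Complex.exp_add, hζ, Complex.exp_log (div_ne_zero (hpz' s) (hpz s))]
    field_simp [hpz s]
  have hy : ∀ s, p s = z + Complex.exp (ζ s) := fun s => by rw [hζ]; ring
  have hy' : ∀ s, p s = z' + Complex.exp (ζ' s) := fun s => by rw [hζ'e]; ring
  set a : ℝ → ℕ → ℂ := fun s j => zt F Φ z (ζ s) j with ha
  set b : ℝ → ℕ → ℂ := fun s j => zt F Φ z' (ζ' s) j with hb
  set ϱ : ℝ → ℕ → ℂ := fun s j => ((⇑F)^[j] (p s) - (⇑F)^[j] z') / ((⇑F)^[j] (p s) - (⇑F)^[j] z)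
    with hϱ
  have hae : ∀ s j, Complex.exp (a s j) = (⇑F)^[j] (p s) - (⇑F)^[j] z := by
    intro s j; rw [ha]; simp only; rw [exp_zt hΦ, ← hy]
  have hbe : ∀ s j, Complex.exp (b s j) = (⇑F)^[j] (p s) - (⇑F)^[j] z' := by
    intro s j; rw [hb]; simp only; rw [exp_zt hΦ, ← hy']
  have hzz : ∀ s, p s ≠ z' := fun s => sub_ne_zero.1 (hpz' s)
  have hϱ0 : ∀ s j, ϱ s j ≠ 0 := fun s j => div_ne_zero (hinj j (hzz s)) (hinj j (h0 s).1)
  have hωe : ∀ s j, Complex.exp (b s j - a s j) = ϱ s j := by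
    intro s j; rw [Complex.exp_sub, hae, hbe]
  -- reference point
  have hrefl : ∀ j ≤ N, b 0 j - a 0 j = Complex.log (ϱ 0 j) := by
    intro j
    induction j with
    | zero => intro _; simp [ha, hb, hϱ, zt, hζ']
    | succ j ih =>
      intro hj
      obtain ⟨r1, r2, r3⟩ := href j (by omega)
      have r4 := (href (j+1) hj).1
      have e1 : a 0 (j+1) = a 0 j + _ := zt_far hΦ hΦ' (hy 0) r2
      have e2 : b 0 (j+1) = b 0 j + _ := zt_far hΦ hΦ' (hy' 0) r3
      have ih' := ih (by omega)
      apply eq_of_exp_eq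
      · rw [hωe, Complex.exp_log (hϱ0 _ _)]
      · have hh : b 0 (j+1) - a 0 (j+1) = Complex.log (ϱ 0 j) +
          Complex.log (((⇑F)^[j+1] (p 0) - (⇑F)^[j+1] z') / ((⇑F)^[j] (p 0) - (⇑F)^[j] z')) -
          Complex.log (((⇑F)^[j+1] (p 0) - (⇑F)^[j+1] z) / ((⇑F)^[j] (p 0) - (⇑F)^[j] z)) := by
          rw [← ih', e1, e2]; ring
        rw [hh]
        simp only [Complex.sub_im, Complex.add_im, Complex.log_im]
        have q1 := abs_lt.1 (abs_arg_lt (hnear j (p 0) (h0 0).1 r1))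
        have q2 := abs_lt.1 (abs_arg_lt (hnear (j+1) (p 0) (h0 0).1 r4))
        have q3 : |(((⇑F)^[j+1] (p 0) - (⇑F)^[j+1] z') / ((⇑F)^[j] (p 0) - (⇑F)^[j] z')).arg|
            < Real.pi / 2 := abs_arg_lt (re_pos_of_near (norm_div_sub_one (hinj j (hzz 0))
              ((step_le hd z' (p 0) j).trans (by linarith))))
        have q4 : |(((⇑F)^[j+1] (p 0) - (⇑F)^[j+1] z) / ((⇑F)^[j] (p 0) - (⇑F)^[j] z)).arg|
            < Real.pi / 2 := abs_arg_lt (re_pos_of_near (norm_div_sub_one (hinj j (h0 0).1)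
              ((step_le hd z (p 0) j).trans (by linarith))))
        rw [abs_lt] at q3 q4
        rw [abs_lt]
        simp only [hϱ]
        constructor <;> linarith [q1.1, q1.2, q2.1, q2.2, q3.1, q3.2, q4.1, q4.2]
  -- the moving point
  have t1 : a 1 N = _ := zt_track hC hd hΦ hΦ' hf (hy 1) hv N le_rfl
  have t2 : b 1 N = _ := zt_track hC hd hΦ hΦ' (f := -f) (by rwa [norm_neg]) (hy' 1) (by
    intro j hj h
    rw [div_neg] at h ⊢
    rw [Complex.neg_im, abs_neg] at h
    rw [Complex.neg_re]
    linarith [hv' j hj h]) N le_rfl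
  have hsum : b 1 N - a 1 N = Complex.log (ϱ 1 N) + 2 * Real.pi * Complex.I := by
    rw [t1, t2, div_neg, div_neg, log_neg_of_im_pos i0', log_neg_of_im_neg iN']
    have l0 : Complex.log ((p 1 - z') / (p 1 - z)) =
        Complex.log ((p 1 - z') / f) - Complex.log ((p 1 - z) / f) := by
      rw [← log_div_same_pos i0 i0']
      congr 1; field_simp
    have lN : Complex.log (ϱ 1 N) =
        Complex.log (((⇑F)^[N] (p 1) - (⇑F)^[N] z') / f) -
        Complex.log (((⇑F)^[N] (p 1) - (⇑F)^[N] z) / f) := by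
      rw [← log_div_same_neg iN iN']
      congr 1; simp only [hϱ]; field_simp
    rw [lN]
    simp only [hζ']
    rw [l0]; ring
  have hFN := F.continuous.iterate N
  have hac : Continuous fun s => a s N := by
    have := (continuous_zt (F := F) hΦc N).comp (continuous_const (y := z) |>.prodMk hζc)
    exact this
  have hbc : Continuous fun s => b s N := by
    have := (continuous_zt (F := F) hΦc N).comp (continuous_const (y := z') |>.prodMk hζ'c)
    exact this
  have hDc : Continuous fun s => (b s N - a s N) - Complex.log (ϱ s N) := by
    refine (hbc.sub hac).sub (Continuous.clog (Continuous.div ?_ ?_ ?_) fun s => ?_)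
    · exact (hFN.comp hp).sub continuous_const
    · exact (hFN.comp hp).sub continuous_const
    · exact fun s => hinj N (h0 s).1
    · left; exact hnear N (p s) (h0 s).1 (hN s)
  have := const_of_exp_one (s := (univ : Set ℝ)) isPreconnected_univ hDc.continuousOn
    (fun s _ => by
      rw [Complex.exp_sub, hωe, Complex.exp_log (hϱ0 _ _), div_self (hϱ0 _ _)])
    (mem_univ 0) (mem_univ 1)
  rw [hrefl N le_rfl, hsum, sub_self] at this
  have h3 : (2 * Real.pi * Complex.I : ℂ) = 0 := by
    linear_combination -this
  simp [Real.pi_ne_zero] at h3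

/-! ## Part 3 -/
/-- A finite system of exposed rotation vectors. -/
structure Sys (F : ℂ ≃ₜ ℂ) (ι : Type) where
  A : ι → ℂ
  e : ι → ℂ
  C0 : ℝ
  L : ℝ
  κ : ℝ
  hC0 : 1 ≤ C0
  disp : ∀ z, ‖F z - z‖ ≤ C0
  hA : ∀ a, ‖A a‖ ≤ C0
  he : ∀ a, ‖e a‖ = 1
  lat : ∀ (z : ℂ) (m n : ℤ), F (z + ⟨m, n⟩) = F z + ⟨m, n⟩
  hL : 1 ≤ L
  E1 : ∀ η : ℝ, 0 < η → ∃ N0 : ℕ, ∀ N ≥ N0, ∀ n ≤ N, ∀ (a : ι) (z : ℂ),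
    0 ≤ dt (e a) (n * A a - ((⇑F)^[n] z - z)) + η * N ∧
    ‖(n * A a - ((⇑F)^[n] z - z) : ℂ)‖ ^ 2 ≤
      L * N * (dt (e a) (n * A a - ((⇑F)^[n] z - z)) + η * N)
  E2 : ∀ (N : ℕ) (a : ι), ∃ z, N * dt (e a) (A a) ≤ dt (e a) ((⇑F)^[N] z - z)
  hκ : 0 < κ
  sep : ∀ a b, a ≠ b → κ ≤ dt (e b) (A b - A a)
  three : ∀ a : ι, ∃ b c : ι, a ≠ b ∧ a ≠ c ∧ b ≠ c

variable {F : ℂ ≃ₜ ℂ} {ι : Type}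

theorem Sys.lat_it (S : Sys F ι) (z : ℂ) (m n : ℤ) (j : ℕ) :
    (⇑F)^[j] (z + ⟨m, n⟩) = (⇑F)^[j] z + ⟨m, n⟩ := by
  induction j with
  | zero => rfl
  | succ j ih => rw [Function.iterate_succ_apply', Function.iterate_succ_apply', ih, S.lat]

theorem exists_lat (z t : ℂ) : ∃ m n : ℤ, ‖z + ⟨m, n⟩ - t‖ ≤ 1 := by
  refine ⟨round (t - z).re, round (t - z).im, ?_⟩
  have h1 := abs_sub_round (t - z).re
  have h2 := abs_sub_round (t - z).im
  refine (Complex.norm_le_abs_re_add_abs_im _).trans ?_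
  have e1 : (z + ⟨(round (t - z).re : ℝ), (round (t - z).im : ℝ)⟩ - t).re
    = -((t - z).re - round (t - z).re) := by simp; ring
  have e2 : (z + ⟨(round (t - z).re : ℝ), (round (t - z).im : ℝ)⟩ - t).im
    = -((t - z).im - round (t - z).im) := by simp; ring
  rw [e1, e2, abs_neg, abs_neg]; linarith

theorem Sys.disp_it (S : Sys F ι) (z : ℂ) (j : ℕ) : ‖(⇑F)^[j] z - z‖ ≤ j * S.C0 := by
  induction j with
  | zero => simp
  | succ j ih =>
    rw [Function.iterate_succ_apply']
    have := S.disp ((⇑F)^[j] z)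
    have h : F ((⇑F)^[j] z) - z = (F ((⇑F)^[j] z) - (⇑F)^[j] z) + ((⇑F)^[j] z - z) := by ring
    rw [h]
    refine (norm_add_le _ _).trans ?_
    push_cast; linarith

theorem Sys.disp_le (S : Sys F ι) (z : ℂ) {i j : ℕ} (h : i ≤ j) :
    ‖(⇑F)^[j] z - (⇑F)^[i] z‖ ≤ ((j : ℝ) - i) * S.C0 := by
  obtain ⟨k, rfl⟩ := Nat.exists_eq_add_of_le h
  rw [add_comm i k, Function.iterate_add_apply]
  refine (S.disp_it _ k).trans ?_
  push_cast; apply le_of_eq; ring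

/-- `E1` on a window. -/
def Sys.W1 (S : Sys F ι) (N : ℕ) (η : ℝ) : Prop :=
  ∀ n ≤ N, ∀ (a : ι) (z : ℂ),
    0 ≤ dt (S.e a) (n * S.A a - ((⇑F)^[n] z - z)) + η * N ∧
    ‖(n * S.A a - ((⇑F)^[n] z - z) : ℂ)‖ ^ 2 ≤
      S.L * N * (dt (S.e a) (n * S.A a - ((⇑F)^[n] z - z)) + η * N)

theorem Sys.W1.drop {S : Sys F ι} {N : ℕ} {η : ℝ} (h : S.W1 N η) {i j : ℕ} (hij : i ≤ j)
    (hj : j ≤ i + N) (a : ι) (z : ℂ) :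
    dt (S.e a) ((⇑F)^[j] z - (⇑F)^[i] z - ((j : ℂ) - i) * S.A a) ≤ η * N ∧
    ‖(⇑F)^[j] z - (⇑F)^[i] z - ((j : ℂ) - i) * S.A a‖ ^ 2 ≤
      S.L * N * (-dt (S.e a) ((⇑F)^[j] z - (⇑F)^[i] z - ((j : ℂ) - i) * S.A a) + η * N) := by
  obtain ⟨k, rfl⟩ := Nat.exists_eq_add_of_le hij
  have := h k (by omega) a ((⇑F)^[i] z)
  have e1 : (⇑F)^[i + k] z - (⇑F)^[i] z - (((i + k : ℕ) : ℂ) - i) * S.A a =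
    -(k * S.A a - ((⇑F)^[k] ((⇑F)^[i] z) - (⇑F)^[i] z)) := by
    rw [add_comm i k, Function.iterate_add_apply]; push_cast; ring
  rw [e1, dt_neg, norm_neg, neg_neg]
  exact ⟨by linarith [this.1], this.2⟩

theorem Sys.exists_W1 (S : Sys F ι) {η : ℝ} (hη : 0 < η) : ∃ N0 : ℕ, ∀ N ≥ N0, S.W1 N η :=
  S.E1 η hη

theorem Sys.static (S : Sys F ι) {ε : ℝ} (hε : 0 < ε) : ∃ η : ℝ, 0 < η ∧ ∃ N0 : ℕ, ∀ N ≥ N0,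
    ∀ a z, N * dt (S.e a) (S.A a) - η * N ≤ dt (S.e a) ((⇑F)^[N] z - z) →
    ∀ i j, i ≤ j → j ≤ N → ‖(⇑F)^[j] z - (⇑F)^[i] z - ((j : ℂ) - i) * S.A a‖ ≤ ε * N := by
  have hL := S.hL
  refine ⟨ε ^ 2 / (4 * S.L), by positivity, ?_⟩
  set η := ε ^ 2 / (4 * S.L) with hη
  obtain ⟨N0, h⟩ := S.exists_W1 (show 0 < η by positivity)
  refine ⟨N0, fun N hN a z hz i j hij hj => ?_⟩
  have hW := h N hN
  have h1 := (hW.drop (Nat.zero_le i) (by omega) a z).1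
  have h2 := (hW.drop hij (by omega) a z).2
  have h3 := (hW.drop hj (by omega) a z).1
  have hsum : dt (S.e a) ((⇑F)^[N] z - z) - N * dt (S.e a) (S.A a) =
      dt (S.e a) ((⇑F)^[i] z - (⇑F)^[0] z - ((i : ℂ) - (0:ℕ)) * S.A a) +
      dt (S.e a) ((⇑F)^[j] z - (⇑F)^[i] z - ((j : ℂ) - i) * S.A a) +
      dt (S.e a) ((⇑F)^[N] z - (⇑F)^[j] z - ((N : ℂ) - j) * S.A a) := by
    rw [← dt_nat, ← dt_sub, ← dt_add, ← dt_add]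
    congr 1
    simp; ring
  have h4 : S.L * η = ε ^ 2 / 4 := by rw [hη]; field_simp
  have hN0 : (0:ℝ) ≤ N := Nat.cast_nonneg N
  have h5 : -dt (S.e a) ((⇑F)^[j] z - (⇑F)^[i] z - ((j : ℂ) - i) * S.A a) + η * N ≤ 4 * (η * N) := by
    linarith
  have h6 : ‖(⇑F)^[j] z - (⇑F)^[i] z - ((j : ℂ) - i) * S.A a‖ ^ 2 ≤ (ε * N) ^ 2 := by
    refine h2.trans ((mul_le_mul_of_nonneg_left h5 (by positivity)).trans (le_of_eq ?_))
    linear_combination 4 * N ^ 2 * h4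
  exact (sq_le_sq₀ (norm_nonneg _) (by positivity)).1 h6

theorem div_im_eq {e u : ℂ} (he : ‖e‖ = 1) : (u / (-Complex.I * e)).im = dt e u := by
  have h0 : (-Complex.I * e) ≠ 0 := by
    have : e ≠ 0 := by rintro rfl; simp at he
    simp [this]
  rw [← dt_mul_I e _ he, mul_div_cancel₀ _ h0]

theorem div_re_eq {f u : ℂ} (hf : ‖f‖ = 1) : (u / f).re = dt f u := by
  have h2 : Complex.normSq f = 1 := by
    rw [← Complex.sq_norm, hf]; norm_num
  rw [Complex.div_re, h2, dt]; ring

/-- Position of a moving point relative to a static one. -/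
theorem Sys.side {S : Sys F ι} {N : ℕ} {c θ : ℝ} (hc0 : 0 < c) (hc1 : c ≤ θ / 1000)
    (hc2 : c * (1000000 * S.L) ≤ θ ^ 2) (hNc : 4 * S.C0 + 2 ≤ c * N) (hW : S.W1 N c) {a : ι}
    {x z : ℂ} {i : ℕ} (hi : i ≤ N) {τ : ℝ} (hτ : τ ^ 2 = 1) {f : ℂ} (hf : f = -Complex.I * S.e a)
    (hz : ‖(⇑F)^[i] z - ((⇑F)^[i] x + τ * (θ * N / 100 : ℝ) * f)‖ ≤ 1)
    (hst : ∀ j ≤ N, ‖(⇑F)^[j] z - (⇑F)^[i] z - ((j : ℂ) - i) * S.A a‖ ≤ c * N)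
    (h0 : θ * N ≤ ‖x - ((⇑F)^[i] x - i * S.A a)‖)
    (hN : θ * N ≤ ‖(⇑F)^[N] x - ((⇑F)^[i] x + ((N : ℂ) - i) * S.A a)‖) :
    (∀ j ≤ N, |dt (S.e a) ((⇑F)^[j] x - (⇑F)^[j] z)| ≤ 4 * S.C0 →
      τ * dt f ((⇑F)^[j] x - (⇑F)^[j] z) < -(4 * S.C0)) ∧
    0 < dt (S.e a) (x - z) ∧ dt (S.e a) ((⇑F)^[N] x - (⇑F)^[N] z) < 0 := by
  have he := S.he a
  have hL := S.hL
  have hC0 := S.hC0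
  have hfn : ‖f‖ = 1 := by rw [hf]; simp [he]
  have hef : dt (S.e a) f = 0 := by rw [hf]; simp [dt]; ring
  have hff : dt f f = 1 := by
    have := Complex.sq_norm f
    rw [hfn, Complex.normSq_apply] at this; rw [dt]; linarith
  have hN0 : (0:ℝ) < N := by
    by_contra h
    have : (N:ℝ) = 0 := le_antisymm (not_lt.1 h) (Nat.cast_nonneg N)
    rw [this] at hNc; linarith
  have hθ : 0 < θ := by linarith
  set Y : ℕ → ℂ := fun j => (⇑F)^[j] x - (⇑F)^[i] x - ((j : ℂ) - i) * S.A a with hY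
  set st : ℕ → ℂ := fun j => (⇑F)^[j] z - (⇑F)^[i] z - ((j : ℂ) - i) * S.A a with hstd
  set ρ : ℂ := (⇑F)^[i] z - ((⇑F)^[i] x + τ * (θ * N / 100 : ℝ) * f) with hρ
  have hu : ∀ j, (⇑F)^[j] x - (⇑F)^[j] z = Y j - ((τ * (θ * N / 100) : ℝ) : ℂ) * f - ρ - st j := by
    intro j; simp only [hY, hstd, hρ]; push_cast; ring
  have hdu : ∀ j, dt (S.e a) ((⇑F)^[j] x - (⇑F)^[j] z) =
      dt (S.e a) (Y j) - dt (S.e a) ρ - dt (S.e a) (st j) := by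
    intro j; rw [hu, dt_sub, dt_sub, dt_sub, dt_real, hef]; ring
  have hρe := abs_le.1 ((abs_dt_le (w := ρ) he).trans hz)
  have hste : ∀ j ≤ N, |dt (S.e a) (st j)| ≤ c * N := fun j hj => (abs_dt_le he).trans (hst j hj)
  have hcN : c * N ≤ θ * N / 1000 := by nlinarith
  refine ⟨?_, ?_, ?_⟩
  · intro j hj hh
    have hYa : |dt (S.e a) (Y j)| ≤ 2 * (c * N) := by
      rw [hdu] at hh
      have h1 := abs_le.1 hh
      have h2 := abs_le.1 (hste j hj)
      rw [abs_le]; constructor <;> linarith [h1.1, h1.2, h2.1, h2.2, hρe.1, hρe.2]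
    have hY2 : ‖Y j‖ ^ 2 ≤ S.L * N * (3 * (c * N)) := by
      rcases le_total i j with hij | hij
      · have := (hW.drop hij (by omega) a x).2
        refine this.trans (mul_le_mul_of_nonneg_left ?_ (by positivity))
        have := (abs_le.1 hYa).1
        simp only [hY] at this; linarith
      · have := (hW.drop hij (by omega) a x).2
        have e1 : (⇑F)^[i] x - (⇑F)^[j] x - ((i : ℂ) - j) * S.A a = - Y j := by
          simp only [hY]; ring
        rw [e1, norm_neg, dt_neg] at this
        refine this.trans (mul_le_mul_of_nonneg_left ?_ (by positivity))
        have := (abs_le.1 hYa).2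
        linarith
    have hY3 : ‖Y j‖ ≤ θ * N / 400 := by
      have : ‖Y j‖ ^ 2 ≤ (θ * N / 400) ^ 2 := by
        refine hY2.trans ?_
        have := mul_le_mul_of_nonneg_right hc2 (sq_nonneg (N:ℝ))
        nlinarith
      exact (sq_le_sq₀ (norm_nonneg _) (by positivity)).1 this
    have h1 : dt f ((⇑F)^[j] x - (⇑F)^[j] z) =
        dt f (Y j) - τ * (θ * N / 100) - dt f ρ - dt f (st j) := by
      rw [hu, dt_sub, dt_sub, dt_sub, dt_real, hff]; ring
    have hτa : |τ| = 1 := by rw [← sq_abs] at hτ; nlinarith [abs_nonneg τ]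
    have h2 : τ * dt f ((⇑F)^[j] x - (⇑F)^[j] z) =
        τ * dt f (Y j - ρ - st j) - (θ * N / 100) := by
      rw [h1, dt_sub f (Y j - ρ) (st j), dt_sub f (Y j) ρ]; linear_combination (- (θ * N / 100)) * hτ
    have h3 : τ * dt f (Y j - ρ - st j) ≤ ‖Y j - ρ - st j‖ := by
      refine (le_abs_self _).trans ?_
      rw [abs_mul, hτa, one_mul]; exact abs_dt_le hfn
    have h4 : ‖Y j - ρ - st j‖ ≤ ‖Y j‖ + ‖ρ‖ + ‖st j‖ :=
      (norm_sub_le _ _).trans (by gcongr; exact norm_sub_le _ _)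
    have h5 : ‖st j‖ ≤ c * N := hst j hj
    have hp : 0 < θ * N := by positivity
    rw [h2]
    linarith
  · have h1 := (hW.drop (Nat.zero_le i) (by omega) a x).2
    have e1 : (⇑F)^[i] x - (⇑F)^[0] x - ((i : ℂ) - (0 : ℕ)) * S.A a = - Y 0 := by
      simp only [hY]; ring
    rw [e1, norm_neg, dt_neg, neg_neg] at h1
    have e2 : Y 0 = x - ((⇑F)^[i] x - i * S.A a) := by simp [hY]; ring
    have h2 : (θ * N) ^ 2 ≤ ‖Y 0‖ ^ 2 := by
      rw [e2]; gcongr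
    have h3 : 10 * (c * N) ≤ dt (S.e a) (Y 0) := by
      by_contra hcon
      rw [not_le] at hcon
      have : S.L * N * (dt (S.e a) (Y 0) + c * N) ≤ S.L * N * (11 * (c * N)) := by
        apply mul_le_mul_of_nonneg_left _ (by positivity); linarith
      have h4 := mul_le_mul_of_nonneg_right hc2 (sq_nonneg (N:ℝ))
      have h5 : 0 < S.L * c * N ^ 2 := by positivity
      nlinarith
    have h4 := abs_le.1 (hste 0 (Nat.zero_le _))
    have h5 := hdu 0
    simp only [Function.iterate_zero, id] at h5
    rw [h5]
    linarith [h4.2, hρe.2]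
  · have h1 := (hW.drop hi (by omega) a x).2
    have e2 : Y N = (⇑F)^[N] x - ((⇑F)^[i] x + ((N : ℂ) - i) * S.A a) := by simp only [hY]; ring
    change ‖Y N‖ ^ 2 ≤ S.L * N * (- dt (S.e a) (Y N) + c * N) at h1
    have h2 : (θ * N) ^ 2 ≤ ‖Y N‖ ^ 2 := by
      rw [e2]; gcongr
    have h3 : 10 * (c * N) ≤ - dt (S.e a) (Y N) := by
      by_contra hcon
      rw [not_le] at hcon
      have : S.L * N * (- dt (S.e a) (Y N) + c * N) ≤ S.L * N * (11 * (c * N)) := by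
        apply mul_le_mul_of_nonneg_left _ (by positivity); linarith
      have h4 := mul_le_mul_of_nonneg_right hc2 (sq_nonneg (N:ℝ))
      have h5 : 0 < S.L * c * N ^ 2 := by positivity
      nlinarith
    have h4 := abs_le.1 (hste N le_rfl)
    rw [hdu N]
    linarith [h4.1, hρe.1]

/-! ## Part 4 -/
theorem Sys.agree_path (S : Sys F ι) {θ : ℝ} (hθ : 0 < θ) : ∃ N0 : ℕ, ∀ N ≥ N0, ∀ (a : ι)
    (p : ℝ → ℂ), Continuous p → ∀ i ≤ N,
    (∃ s, ‖p s - ((⇑F)^[i] (p 1) - i * S.A a)‖ < θ * N) ∨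
    (∃ s, ‖(⇑F)^[N] (p s) - ((⇑F)^[i] (p 1) + ((N : ℂ) - i) * S.A a)‖ < θ * N) ∨
    (∃ j ≤ N, ‖(⇑F)^[j] (p 0) - (⇑F)^[i] (p 1) - ((j : ℂ) - i) * S.A a‖ < θ * N) := by
  have hL := S.hL
  have hC0 := S.hC0
  set c := min (θ / 1000) (θ ^ 2 / (1000000 * S.L)) with hc
  have hc0 : 0 < c := lt_min (by positivity) (by positivity)
  have hc1 : c ≤ θ / 1000 := min_le_left _ _
  have hc2 : c * (1000000 * S.L) ≤ θ ^ 2 := by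
    have : c ≤ θ ^ 2 / (1000000 * S.L) := min_le_right _ _
    rwa [le_div_iff₀ (by positivity)] at this
  obtain ⟨η, hη, N1, hst⟩ := S.static hc0
  obtain ⟨N2, hW⟩ := S.exists_W1 hc0
  obtain ⟨N3, hN3⟩ := exists_nat_ge ((4 * S.C0 + 2) / c)
  refine ⟨max N1 (max N2 N3), fun N hN a p hp i hi => ?_⟩
  have hN1 : N1 ≤ N := (le_max_left _ _).trans hN
  have hN2 : N2 ≤ N := (le_max_left _ _).trans ((le_max_right _ _).trans hN)
  have hN3' : N3 ≤ N := (le_max_right _ _).trans ((le_max_right _ _).trans hN)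
  have hNc : 4 * S.C0 + 2 ≤ c * N := by
    rw [div_le_iff₀ hc0] at hN3
    have : (N3 : ℝ) ≤ N := by exact_mod_cast hN3'
    nlinarith
  have hcN : c * N ≤ θ * N / 1000 := by
    have : (0:ℝ) ≤ N := Nat.cast_nonneg N
    nlinarith
  by_contra hcon
  push Not at hcon
  obtain ⟨k1, k2, k3⟩ := hcon
  obtain ⟨z0, hz0⟩ := S.E2 N a
  have hz0s := hst N hN1 a z0 (by nlinarith [Nat.cast_nonneg (α := ℝ) N])
  set f : ℂ := -Complex.I * S.e a with hf
  have hfn : ‖f‖ = 1 := by rw [hf]; simp [S.he a]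
  obtain ⟨m, n, hmn⟩ := exists_lat ((⇑F)^[i] z0) ((⇑F)^[i] (p 1) + ((-1 : ℝ) : ℂ) * (θ * N / 100 : ℝ) * f)
  obtain ⟨m', n', hmn'⟩ := exists_lat ((⇑F)^[i] z0) ((⇑F)^[i] (p 1) + ((1 : ℝ) : ℂ) * (θ * N / 100 : ℝ) * f)
  rw [← S.lat_it] at hmn hmn'
  have hz0s' : ∀ (m n : ℤ), ∀ j ≤ N, ‖(⇑F)^[j] (z0 + ⟨m, n⟩) - (⇑F)^[i] (z0 + ⟨m, n⟩) -
      ((j : ℂ) - i) * S.A a‖ ≤ c * N := by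
    intro m n j hj
    rw [S.lat_it, S.lat_it, add_sub_add_right_eq_sub]
    rcases le_total i j with h | h
    · exact hz0s i j h hj
    · have := hz0s j i h hi
      rwa [← norm_neg, show -((⇑F)^[i] z0 - (⇑F)^[j] z0 - ((i : ℂ) - j) * S.A a) =
        (⇑F)^[j] z0 - (⇑F)^[i] z0 - ((j : ℂ) - i) * S.A a by ring] at this
  set z := z0 + ⟨m, n⟩ with hz
  set z' := z0 + ⟨m', n'⟩ with hz'
  have hzz : ∀ j, (⇑F)^[j] z' - (⇑F)^[j] z = z' - z := by
    intro j; rw [hz, hz', S.lat_it, S.lat_it]; ring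
  have hT : ‖((θ * N / 100 : ℝ) : ℂ) * f‖ = θ * N / 100 := by
    rw [norm_mul, hfn, mul_one, Complex.norm_of_nonneg (by positivity)]
  have hzzn : ‖z' - z‖ ≤ θ * N / 50 + 2 := by
    have e1 : z' - z = ((⇑F)^[i] z' - ((⇑F)^[i] (p 1) + ((1 : ℝ) : ℂ) * (θ * N / 100 : ℝ) * f)) -
      ((⇑F)^[i] z - ((⇑F)^[i] (p 1) + ((-1 : ℝ) : ℂ) * (θ * N / 100 : ℝ) * f)) +
      (((θ * N / 100 : ℝ) : ℂ) * f + ((θ * N / 100 : ℝ) : ℂ) * f) := by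
      rw [← hzz i]; push_cast; ring
    rw [e1]
    refine (norm_add_le _ _).trans ?_
    have h1 := norm_sub_le ((⇑F)^[i] z' - ((⇑F)^[i] (p 1) + ((1 : ℝ) : ℂ) * (θ * N / 100 : ℝ) * f))
      ((⇑F)^[i] z - ((⇑F)^[i] (p 1) + ((-1 : ℝ) : ℂ) * (θ * N / 100 : ℝ) * f))
    have h2 := norm_add_le (((θ * N / 100 : ℝ) : ℂ) * f) (((θ * N / 100 : ℝ) : ℂ) * f)
    rw [hT] at h2
    linarith
  -- position of z_j
  have hclose : ∀ j ≤ N, ‖(⇑F)^[j] z - ((⇑F)^[i] (p 1) + ((j : ℂ) - i) * S.A a)‖ ≤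
      θ * N / 100 + 1 + c * N := by
    intro j hj
    have e1 : (⇑F)^[j] z - ((⇑F)^[i] (p 1) + ((j : ℂ) - i) * S.A a) =
      ((⇑F)^[j] z - (⇑F)^[i] z - ((j : ℂ) - i) * S.A a) +
      ((⇑F)^[i] z - ((⇑F)^[i] (p 1) + ((-1 : ℝ) : ℂ) * (θ * N / 100 : ℝ) * f)) -
      (((θ * N / 100 : ℝ) : ℂ) * f) := by push_cast; ring
    rw [e1]
    refine (norm_sub_le _ _).trans ?_
    have h1 := norm_add_le ((⇑F)^[j] z - (⇑F)^[i] z - ((j : ℂ) - i) * S.A a)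
      ((⇑F)^[i] z - ((⇑F)^[i] (p 1) + ((-1 : ℝ) : ℂ) * (θ * N / 100 : ℝ) * f))
    have h2 := hz0s' m n j hj
    rw [hT]
    linarith
  have hfar : ∀ j ≤ N, ∀ y, θ * N ≤ ‖y - ((⇑F)^[i] (p 1) + ((j : ℂ) - i) * S.A a)‖ →
      θ * N * (9 / 10) ≤ ‖y - (⇑F)^[j] z‖ := by
    intro j hj y hy
    have h1 := hclose j hj
    have h2 := norm_sub_le (y - (⇑F)^[j] z) (-((⇑F)^[j] z - ((⇑F)^[i] (p 1) + ((j : ℂ) - i) * S.A a)))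
    rw [norm_neg] at h2
    have e1 : y - (⇑F)^[j] z - -((⇑F)^[j] z - ((⇑F)^[i] (p 1) + ((j : ℂ) - i) * S.A a)) =
      y - ((⇑F)^[i] (p 1) + ((j : ℂ) - i) * S.A a) := by ring
    rw [e1] at h2
    linarith
  have hk1 : ∀ s, θ * N * (9 / 10) ≤ ‖p s - z‖ := by
    intro s
    refine hfar 0 (Nat.zero_le _) (p s) ?_
    have := k1 s
    rwa [show (⇑F)^[i] (p 1) + (((0 : ℕ) : ℂ) - i) * S.A a = (⇑F)^[i] (p 1) - i * S.A a by
      push_cast; ring]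
  have hpos : 0 < θ * N := by linarith
  have hne : ∀ s, p s ≠ z := by
    intro s hs
    have := hk1 s
    rw [hs, sub_self, norm_zero] at this
    linarith
  have side1 := S.side hc0 hc1 hc2 hNc (hW N hN2) (a := a) (x := p 1) (z := z) hi
    (τ := -1) (by norm_num) hf hmn (hz0s' m n) (k1 1) (k2 1)
  have side2 := S.side hc0 hc1 hc2 hNc (hW N hN2) (a := a) (x := p 1) (z := z') hi
    (τ := 1) (by norm_num) hf hmn' (hz0s' m' n') (k1 1) (k2 1)
  have he := S.he a
  refine wind F S.C0 hC0 S.disp p hp N z z' f hfn ?_ ?_ ?_ ?_ ?_ ?_ ?_ ?_ ?_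
  · intro s
    refine ⟨hne s, ?_⟩
    have := hk1 s
    linarith
  · intro s
    rw [hzz]
    have := hfar N le_rfl _ (k2 s)
    linarith
  · intro j hj
    rw [hzz]
    have h1 : θ * N * (9 / 10) ≤ ‖(⇑F)^[j] (p 0) - (⇑F)^[j] z‖ := by
      apply hfar j hj
      have := k3 j hj
      rwa [sub_sub] at this
    have h2 : ‖(⇑F)^[j] (p 0) - (⇑F)^[j] z‖ ≤ ‖(⇑F)^[j] (p 0) - (⇑F)^[j] z'‖ + ‖z' - z‖ := by
      rw [← hzz j]
      exact norm_sub_le_norm_sub_add_norm_sub _ _ _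
    refine ⟨?_, ?_, ?_⟩ <;> linarith
  · intro j hj h
    rw [hf, div_im_eq he] at h
    rw [div_re_eq hfn]
    linarith [side1.1 j hj h]
  · intro j hj h
    rw [hf, div_im_eq he] at h
    rw [div_re_eq hfn]
    linarith [side2.1 j hj h]
  · rw [hf, div_im_eq he]; exact side1.2.1
  · rw [hf, div_im_eq he]; exact side2.2.1
  · rw [hf, div_im_eq he]; exact side1.2.2
  · rw [hf, div_im_eq he]; exact side2.2.2

/-- agreement for path connected sets -/
theorem Sys.agree (S : Sys F ι) {θ : ℝ} (hθ : 0 < θ) : ∃ N0 : ℕ, ∀ N ≥ N0, ∀ (a : ι)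
    (Y : Set ℂ), IsPathConnected Y → ∀ x ∈ Y, ∀ x' ∈ Y, ∀ i ≤ N,
    (∃ y ∈ Y, ‖y - ((⇑F)^[i] x - i * S.A a)‖ < θ * N) ∨
    (∃ y ∈ Y, ‖(⇑F)^[N] y - ((⇑F)^[i] x + ((N : ℂ) - i) * S.A a)‖ < θ * N) ∨
    (∃ j ≤ N, ‖(⇑F)^[j] x' - (⇑F)^[i] x - ((j : ℂ) - i) * S.A a‖ < θ * N) := by
  obtain ⟨N0, h⟩ := S.agree_path hθ
  refine ⟨N0, fun N hN a Y hY x hx x' hx' i hi => ?_⟩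
  have hj := hY.joinedIn x' hx' x hx
  set γ := hj.somePath with hγ
  have hmem : ∀ s, γ.extend s ∈ Y := by
    intro s
    have : γ.extend s ∈ range γ.extend := ⟨s, rfl⟩
    rw [Path.extend_range] at this
    obtain ⟨t, ht⟩ := this
    rw [← ht]; exact hj.somePath_mem t
  have := h N hN a γ.extend γ.continuous_extend i hi
  simp only [Path.extend_zero, Path.extend_one] at this
  rcases this with ⟨s, hs⟩ | ⟨s, hs⟩ | h
  · exact Or.inl ⟨_, hmem s, hs⟩
  · exact Or.inr (Or.inl ⟨_, hmem s, hs⟩)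
  · exact Or.inr (Or.inr h)

/-! ## Part 5 -/
/-- agreement on windows of length `N` at any starting time -/
def Sys.Ag (S : Sys F ι) (N : ℕ) (θ : ℝ) : Prop :=
  ∀ (a : ι) (Y : Set ℂ), IsPathConnected Y → ∀ x ∈ Y, ∀ x' ∈ Y, ∀ t i : ℕ, t ≤ i → i ≤ t + N →
    (∃ y ∈ Y, ‖(⇑F)^[t] y - ((⇑F)^[i] x - ((i : ℂ) - t) * S.A a)‖ < θ * N) ∨
    (∃ y ∈ Y, ‖(⇑F)^[t + N] y - ((⇑F)^[i] x + (((t + N : ℕ) : ℂ) - i) * S.A a)‖ < θ * N) ∨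
    (∃ j, t ≤ j ∧ j ≤ t + N ∧ ‖(⇑F)^[j] x' - (⇑F)^[i] x - ((j : ℂ) - i) * S.A a‖ < θ * N)

theorem Sys.exists_Ag (S : Sys F ι) {θ : ℝ} (hθ : 0 < θ) : ∃ N0 : ℕ, ∀ N ≥ N0, S.Ag N θ := by
  obtain ⟨N0, h⟩ := S.agree hθ
  refine ⟨N0, fun N hN a Y hY x hx x' hx' t i hti hi => ?_⟩
  obtain ⟨k, rfl⟩ := Nat.exists_eq_add_of_le hti
  have hY' : IsPathConnected ((⇑F)^[t] '' Y) := hY.image (F.continuous.iterate t)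
  have := h N hN a _ hY' _ (mem_image_of_mem _ hx) _ (mem_image_of_mem _ hx') k (by omega)
  simp only [← Function.iterate_add_apply] at this
  rw [add_comm k t] at this
  rcases this with ⟨y, ⟨w, hw, rfl⟩, h⟩ | ⟨y, ⟨w, hw, rfl⟩, h⟩ | ⟨j, hj, h⟩
  · refine Or.inl ⟨w, hw, ?_⟩
    rwa [show (((t + k : ℕ) : ℂ) - t) = k by push_cast; ring]
  · refine Or.inr (Or.inl ⟨w, hw, ?_⟩)
    rw [← Function.iterate_add_apply, add_comm N t] at h
    rwa [show (((t + N : ℕ) : ℂ) - (t + k : ℕ)) = N - k by push_cast; ring]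
  · refine Or.inr (Or.inr ⟨t + j, by omega, by omega, ?_⟩)
    rw [add_comm j t] at h
    rwa [show (((t + j : ℕ) : ℂ) - (t + k : ℕ)) = j - k by push_cast; ring]

/-- the kinematic constant -/
def Sys.K (S : Sys F ι) : ℝ := 1 + 4 * S.C0 / S.κ

theorem Sys.one_le_K (S : Sys F ι) : 1 ≤ S.K := by
  have := S.hC0; have := S.hκ
  rw [Sys.K]; have : 0 ≤ 4 * S.C0 / S.κ := by positivity
  linarith

theorem norm_natCast_sub_mul (i j : ℕ) (A : ℂ) : ‖((j : ℂ) - i) * A‖ = |(j : ℝ) - i| * ‖A‖ := by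
  rw [norm_mul, show ((j : ℂ) - i) = (((j : ℝ) - i : ℝ) : ℂ) by push_cast; ring, Complex.norm_real,
    Real.norm_eq_abs]

theorem dt_natCast_sub (e A : ℂ) (i j : ℕ) : dt e (((j : ℂ) - i) * A) = ((j : ℝ) - i) * dt e A := by
  rw [show ((j : ℂ) - i) = (((j : ℝ) - i : ℝ) : ℂ) by push_cast; ring, dt_real]

theorem Sys.near_of_time (S : Sys F ι) {a : ι} {x x' : ℂ} {i j : ℕ} {r : ℝ}
    (h : ‖(⇑F)^[j] x' - (⇑F)^[i] x - ((j : ℂ) - i) * S.A a‖ ≤ r) :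
    ‖(⇑F)^[i] x' - (⇑F)^[i] x‖ ≤ r + 2 * S.C0 * |(j : ℝ) - i| := by
  have e1 : (⇑F)^[i] x' - (⇑F)^[i] x = ((⇑F)^[j] x' - (⇑F)^[i] x - ((j : ℂ) - i) * S.A a) +
    ((j : ℂ) - i) * S.A a - ((⇑F)^[j] x' - (⇑F)^[i] x') := by ring
  have h1 : ‖(⇑F)^[j] x' - (⇑F)^[i] x'‖ ≤ |(j : ℝ) - i| * S.C0 := by
    rcases le_total i j with hij | hij
    · rw [abs_of_nonneg (by rw [sub_nonneg]; exact_mod_cast hij)]; exact S.disp_le x' hij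
    · rw [abs_sub_comm, abs_of_nonneg (by rw [sub_nonneg]; exact_mod_cast hij), norm_sub_rev]
      exact S.disp_le x' hij
  have h2 : ‖((j : ℂ) - i) * S.A a‖ ≤ |(j : ℝ) - i| * S.C0 := by
    rw [norm_natCast_sub_mul]; gcongr; exact S.hA a
  rw [e1]
  refine (norm_sub_le _ _).trans ?_
  have := norm_add_le ((⇑F)^[j] x' - (⇑F)^[i] x - ((j : ℂ) - i) * S.A a) (((j : ℂ) - i) * S.A a)
  linarith

theorem Sys.near_of_kappa (S : Sys F ι) {a : ι} {x x' : ℂ} {i j : ℕ} {r s : ℝ} (hs : 0 ≤ s)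
    (h : ‖(⇑F)^[j] x' - (⇑F)^[i] x - ((j : ℂ) - i) * S.A a‖ ≤ r)
    (ht : |(j : ℝ) - i| * S.κ ≤ 2 * r + s) :
    ‖(⇑F)^[i] x' - (⇑F)^[i] x‖ ≤ S.K * (r + s) := by
  have hκ := S.hκ
  have hC := S.hC0
  refine (S.near_of_time h).trans ?_
  rw [← le_div_iff₀ hκ] at ht
  have : 2 * S.C0 * |(j : ℝ) - i| ≤ 2 * S.C0 * ((2 * r + s) / S.κ) := by gcongr
  have e1 : S.K * (r + s) = r + s + 2 * S.C0 * ((2 * r + 2 * s) / S.κ) := by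
    rw [Sys.K]; field_simp; ring
  rw [e1]
  have : 2 * S.C0 * ((2 * r + s) / S.κ) ≤ 2 * S.C0 * ((2 * r + 2 * s) / S.κ) := by gcongr; linarith
  linarith

theorem Sys.near_fwd {S : Sys F ι} {N : ℕ} {η : ℝ} (hη : 0 ≤ η) (hW : S.W1 N η) {a b : ι}
    (hab : a ≠ b) {x x' : ℂ} {i ja jb : ℕ} {r : ℝ}
    (ha : ‖(⇑F)^[ja] x' - (⇑F)^[i] x - ((ja : ℂ) - i) * S.A a‖ ≤ r)
    (hb : ‖(⇑F)^[jb] x' - (⇑F)^[i] x - ((jb : ℂ) - i) * S.A b‖ ≤ r)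
    (h1 : i ≤ ja) (h2 : ja ≤ jb) (h3 : jb ≤ ja + N) :
    ‖(⇑F)^[i] x' - (⇑F)^[i] x‖ ≤ S.K * (r + η * N) := by
  have hd := (hW.drop h2 h3 b x').1
  have hi : (i : ℝ) ≤ ja := by exact_mod_cast h1
  refine S.near_of_kappa (by positivity) ha ?_
  have e1 : (⇑F)^[jb] x' - (⇑F)^[ja] x' - ((jb : ℂ) - ja) * S.A b =
    ((⇑F)^[jb] x' - (⇑F)^[i] x - ((jb : ℂ) - i) * S.A b) -
    ((⇑F)^[ja] x' - (⇑F)^[i] x - ((ja : ℂ) - i) * S.A a) + ((ja : ℂ) - i) * (S.A b - S.A a) := by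
    ring
  rw [e1, dt_add, dt_sub, dt_natCast_sub] at hd
  have h4 := (neg_le_dt (S.he b)).trans' (neg_le_neg hb)
  have h5 := (dt_le (S.he b)).trans ha
  have h6 : ((ja : ℝ) - i) * S.κ ≤ ((ja : ℝ) - i) * dt (S.e b) (S.A b - S.A a) :=
    mul_le_mul_of_nonneg_left (S.sep a b hab) (by linarith)
  rw [abs_of_nonneg (by linarith)]
  linarith

theorem Sys.near_bwd {S : Sys F ι} {N : ℕ} {η : ℝ} (hη : 0 ≤ η) (hW : S.W1 N η) {a b : ι}
    (hab : a ≠ b) {x x' : ℂ} {i ja jb : ℕ} {r : ℝ}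
    (ha : ‖(⇑F)^[ja] x' - (⇑F)^[i] x - ((ja : ℂ) - i) * S.A a‖ ≤ r)
    (hb : ‖(⇑F)^[jb] x' - (⇑F)^[i] x - ((jb : ℂ) - i) * S.A b‖ ≤ r)
    (h1 : ja ≤ i) (h2 : jb ≤ ja) (h3 : ja ≤ jb + N) :
    ‖(⇑F)^[i] x' - (⇑F)^[i] x‖ ≤ S.K * (r + η * N) := by
  have hd := (hW.drop h2 h3 b x').1
  have hi : (ja : ℝ) ≤ i := by exact_mod_cast h1
  refine S.near_of_kappa (by positivity) ha ?_
  have e1 : (⇑F)^[ja] x' - (⇑F)^[jb] x' - ((ja : ℂ) - jb) * S.A b =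
    ((⇑F)^[ja] x' - (⇑F)^[i] x - ((ja : ℂ) - i) * S.A a) -
    ((⇑F)^[jb] x' - (⇑F)^[i] x - ((jb : ℂ) - i) * S.A b) + ((i : ℂ) - ja) * (S.A b - S.A a) := by
    ring
  rw [e1, dt_add, dt_sub, dt_natCast_sub] at hd
  have h4 := (dt_le (S.he b)).trans hb
  have h5 := (neg_le_dt (S.he b)).trans' (neg_le_neg ha)
  have h6 : ((i : ℝ) - ja) * S.κ ≤ ((i : ℝ) - ja) * dt (S.e b) (S.A b - S.A a) :=
    mul_le_mul_of_nonneg_left (S.sep a b hab) (by linarith)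
  rw [abs_sub_comm, abs_of_nonneg (by linarith)]
  linarith

theorem Sys.near_same {S : Sys F ι} {N : ℕ} {η : ℝ} (hη : 0 ≤ η) (hW : S.W1 N η) {a b : ι}
    (hab : a ≠ b) {x x' : ℂ} {t i ja jb : ℕ} {r : ℝ}
    (ha : ‖(⇑F)^[ja] x' - (⇑F)^[i] x - ((ja : ℂ) - i) * S.A a‖ ≤ r)
    (hb : ‖(⇑F)^[jb] x' - (⇑F)^[i] x - ((jb : ℂ) - i) * S.A b‖ ≤ r)
    (hs : i ≤ ja ∧ i ≤ jb ∨ ja ≤ i ∧ jb ≤ i) (ta : t ≤ ja) (tb : t ≤ jb) (ta' : ja ≤ t + N)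
    (tb' : jb ≤ t + N) :
    ‖(⇑F)^[i] x' - (⇑F)^[i] x‖ ≤ S.K * (r + η * N) := by
  rcases hs with ⟨h1, h2⟩ | ⟨h1, h2⟩ <;> rcases le_total ja jb with h | h
  · exact S.near_fwd hη hW hab ha hb h1 h (by omega)
  · exact S.near_fwd hη hW hab.symm hb ha h2 h (by omega)
  · exact S.near_bwd hη hW hab.symm hb ha h2 h (by omega)
  · exact S.near_bwd hη hW hab ha hb h1 h (by omega)

theorem Sys.near_three {S : Sys F ι} {N : ℕ} {η : ℝ} (hη : 0 ≤ η) (hW : S.W1 N η) {a b c : ι}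
    (hab : a ≠ b) (hac : a ≠ c) (hbc : b ≠ c) {x x' : ℂ} {t i : ℕ} {r : ℝ}
    (ha : ∃ j, t ≤ j ∧ j ≤ t + N ∧ ‖(⇑F)^[j] x' - (⇑F)^[i] x - ((j : ℂ) - i) * S.A a‖ ≤ r)
    (hb : ∃ j, t ≤ j ∧ j ≤ t + N ∧ ‖(⇑F)^[j] x' - (⇑F)^[i] x - ((j : ℂ) - i) * S.A b‖ ≤ r)
    (hc : ∃ j, t ≤ j ∧ j ≤ t + N ∧ ‖(⇑F)^[j] x' - (⇑F)^[i] x - ((j : ℂ) - i) * S.A c‖ ≤ r) :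
    ‖(⇑F)^[i] x' - (⇑F)^[i] x‖ ≤ S.K * (r + η * N) := by
  obtain ⟨ja, a1, a2, a3⟩ := ha
  obtain ⟨jb, b1, b2, b3⟩ := hb
  obtain ⟨jc, c1, c2, c3⟩ := hc
  have : (i ≤ ja ∧ i ≤ jb ∨ ja ≤ i ∧ jb ≤ i) ∨ (i ≤ ja ∧ i ≤ jc ∨ ja ≤ i ∧ jc ≤ i) ∨
      (i ≤ jb ∧ i ≤ jc ∨ jb ≤ i ∧ jc ≤ i) := by omega
  rcases this with h | h | h
  · exact S.near_same hη hW hab a3 b3 h a1 b1 a2 b2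
  · exact S.near_same hη hW hac a3 c3 h a1 c1 a2 c2
  · exact S.near_same hη hW hbc b3 c3 h b1 c1 b2 c2

/-- diameter bound at time `i` -/
def DD (F : ℂ ≃ₜ ℂ) (Y : Set ℂ) (i : ℕ) (m : ℝ) : Prop :=
  ∀ x ∈ Y, ∀ y ∈ Y, ‖(⇑F)^[i] x - (⇑F)^[i] y‖ ≤ m

theorem DD.mono {Y : Set ℂ} {i : ℕ} {m m' : ℝ} (h : DD F Y i m) (hm : m ≤ m') : DD F Y i m' :=
  fun x hx y hy => (h x hx y hy).trans hm

theorem DD.of_center {Y : Set ℂ} {i : ℕ} {m : ℝ} {x0 : ℂ}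
    (h : ∀ x ∈ Y, ‖(⇑F)^[i] x0 - (⇑F)^[i] x‖ ≤ m / 2) : DD F Y i m := by
  intro x hx y hy
  have h1 := h x hx
  have h2 := h y hy
  rw [show (⇑F)^[i] x - (⇑F)^[i] y = ((⇑F)^[i] x0 - (⇑F)^[i] y) - ((⇑F)^[i] x0 - (⇑F)^[i] x) by ring]
  exact (norm_sub_le _ _).trans (by linarith)

theorem Sys.DD_shift (S : Sys F ι) {Y : Set ℂ} {i j : ℕ} {m : ℝ} (h : DD F Y i m) (hij : i ≤ j) :
    DD F Y j (m + 2 * S.C0 * ((j : ℝ) - i)) := by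
  intro x hx y hy
  rw [show (⇑F)^[j] x - (⇑F)^[j] y = ((⇑F)^[i] x - (⇑F)^[i] y) + ((⇑F)^[j] x - (⇑F)^[i] x) -
    ((⇑F)^[j] y - (⇑F)^[i] y) by ring]
  refine (norm_sub_le _ _).trans ?_
  have := norm_add_le ((⇑F)^[i] x - (⇑F)^[i] y) ((⇑F)^[j] x - (⇑F)^[i] x)
  have := h x hx y hy
  have := S.disp_le x hij
  have := S.disp_le y hij
  linarith

theorem Sys.clean (S : Sys F ι) (hne : Nonempty ι) {θ : ℝ} (hθ : 0 < θ) : ∃ M : ℝ, 0 ≤ M ∧ ∀ (N t : ℕ) (Y : Set ℂ),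
    IsPathConnected Y → ∀ m : ℝ, 0 ≤ m → DD F Y t m → DD F Y (t + N) m →
    ∀ i, t ≤ i → i ≤ t + N → DD F Y i (S.K * (θ * N + m) + M) := by
  obtain ⟨N1, hAg⟩ := S.exists_Ag (half_pos hθ)
  obtain ⟨N2, hW⟩ := S.exists_W1 (half_pos hθ)
  have hC := S.hC0
  have hK := S.one_le_K
  refine ⟨2 * S.C0 * (N1 + N2 : ℕ), by positivity, fun N t Y hY m hm h0 hN i ti iN => ?_⟩
  by_cases hNN : N1 + N2 ≤ N
  · have hag := hAg N (by omega)
    have hw := hW N (by omega)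
    intro x' hx' x hx
    obtain ⟨a⟩ := hne
    obtain ⟨b, c, hab, hac, hbc⟩ := S.three a
    have key : ∀ a, ∃ j, t ≤ j ∧ j ≤ t + N ∧
        ‖(⇑F)^[j] x' - (⇑F)^[i] x - ((j : ℂ) - i) * S.A a‖ ≤ θ / 2 * N + m := by
      intro a
      rcases hag a Y hY x hx x' hx' t i ti iN with ⟨y, hy, h⟩ | ⟨y, hy, h⟩ | ⟨j, j1, j2, h⟩
      · refine ⟨t, le_rfl, by omega, ?_⟩
        have := h0 x' hx' y hy
        rw [show (⇑F)^[t] x' - (⇑F)^[i] x - ((t : ℂ) - i) * S.A a = ((⇑F)^[t] x' - (⇑F)^[t] y) +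
          ((⇑F)^[t] y - ((⇑F)^[i] x - ((i : ℂ) - t) * S.A a)) by ring]
        exact (norm_add_le _ _).trans (by linarith)
      · refine ⟨t + N, by omega, by omega, ?_⟩
        have := hN x' hx' y hy
        rw [show (⇑F)^[t + N] x' - (⇑F)^[i] x - (((t + N : ℕ) : ℂ) - i) * S.A a =
          ((⇑F)^[t + N] x' - (⇑F)^[t + N] y) +
          ((⇑F)^[t + N] y - ((⇑F)^[i] x + (((t + N : ℕ) : ℂ) - i) * S.A a)) by ring]
        exact (norm_add_le _ _).trans (by linarith)
      · exact ⟨j, j1, j2, by linarith⟩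
    have := S.near_three (by positivity) hw hab hac hbc (key a) (key b) (key c)
    refine this.trans ?_
    have e1 : θ / 2 * N + m + θ / 2 * N = θ * N + m := by ring
    rw [e1]
    have : (0:ℝ) ≤ 2 * S.C0 * (N1 + N2 : ℕ) := by positivity
    linarith
  · refine (S.DD_shift h0 ti).mono ?_
    have h1 : (i : ℝ) - t ≤ (N1 + N2 : ℕ) := by
      have : i ≤ t + (N1 + N2) := by omega
      have : (i : ℝ) ≤ t + (N1 + N2 : ℕ) := by exact_mod_cast this
      linarith
    have h2 : 2 * S.C0 * ((i : ℝ) - t) ≤ 2 * S.C0 * (N1 + N2 : ℕ) := by gcongr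
    have h3 : m ≤ S.K * (θ * N + m) := by
      have : 0 ≤ θ * N := by positivity
      nlinarith
    linarith

/-! ## Part 6 -/
theorem Sys.sub1 {S : Sys F ι} {N : ℕ} {θ : ℝ} (hAg : S.Ag N θ) {Y : Set ℂ}
    (hY : IsPathConnected Y) {z : ℂ} (hz : z ∈ Y) {t i : ℕ} (ti : t ≤ i) (it : i ≤ t + N) {m : ℝ}
    (h1 : DD F Y t m) (h2 : DD F Y i m) (h3 : DD F Y (t + N) m) (a : ι) :
    ‖(⇑F)^[i] z - (⇑F)^[t] z - ((i : ℂ) - t) * S.A a‖ ≤ θ * N + 2 * m ∨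
    ‖(⇑F)^[t + N] z - (⇑F)^[i] z - (((t + N : ℕ) : ℂ) - i) * S.A a‖ ≤ θ * N + 2 * m ∨
    ∀ x ∈ Y, ∃ j, t ≤ j ∧ j ≤ t + N ∧ ‖(⇑F)^[j] z - (⇑F)^[i] x - ((j : ℂ) - i) * S.A a‖ ≤ θ * N := by
  by_contra hcon
  push Not at hcon
  obtain ⟨c1, c2, x, hx, c3⟩ := hcon
  rcases hAg a Y hY x hx z hz t i ti it with ⟨y, hy, h⟩ | ⟨y, hy, h⟩ | ⟨j, j1, j2, h⟩
  · have e1 : (⇑F)^[i] z - (⇑F)^[t] z - ((i : ℂ) - t) * S.A a =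
      ((⇑F)^[i] z - (⇑F)^[i] x) + (((⇑F)^[t] y - (⇑F)^[t] z) -
        ((⇑F)^[t] y - ((⇑F)^[i] x - ((i : ℂ) - t) * S.A a))) := by ring
    rw [e1] at c1
    have n1 := norm_add_le ((⇑F)^[i] z - (⇑F)^[i] x) (((⇑F)^[t] y - (⇑F)^[t] z) -
        ((⇑F)^[t] y - ((⇑F)^[i] x - ((i : ℂ) - t) * S.A a)))
    have n2 := norm_sub_le ((⇑F)^[t] y - (⇑F)^[t] z) ((⇑F)^[t] y - ((⇑F)^[i] x - ((i : ℂ) - t) * S.A a))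
    have := h1 y hy z hz
    have := h2 z hz x hx
    linarith
  · have e1 : (⇑F)^[t + N] z - (⇑F)^[i] z - (((t + N : ℕ) : ℂ) - i) * S.A a =
      ((⇑F)^[i] x - (⇑F)^[i] z) + (((⇑F)^[t + N] z - (⇑F)^[t + N] y) +
        ((⇑F)^[t + N] y - ((⇑F)^[i] x + (((t + N : ℕ) : ℂ) - i) * S.A a))) := by ring
    rw [e1] at c2
    have n1 := norm_add_le ((⇑F)^[i] x - (⇑F)^[i] z) (((⇑F)^[t + N] z - (⇑F)^[t + N] y) +
        ((⇑F)^[t + N] y - ((⇑F)^[i] x + (((t + N : ℕ) : ℂ) - i) * S.A a)))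
    have n2 := norm_add_le ((⇑F)^[t + N] z - (⇑F)^[t + N] y)
        ((⇑F)^[t + N] y - ((⇑F)^[i] x + (((t + N : ℕ) : ℂ) - i) * S.A a))
    have := h3 z hz y hy
    have := h2 x hx z hz
    linarith
  · exact absurd h (not_lt.2 (c3 j j1 j2).le)

/-- A sub-displacement of a nearly extremal displacement is nearly extremal. -/
theorem Sys.subdrop {S : Sys F ι} {N : ℕ} {η : ℝ} (hW : S.W1 N η) {a : ι} {z : ℂ} {t i j : ℕ} {D : ℝ}
    (hD : -D ≤ dt (S.e a) ((⇑F)^[t + N] z - (⇑F)^[t] z - (((t + N : ℕ) : ℂ) - t) * S.A a))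
    (ti : t ≤ i) (ij : i ≤ j) (jt : j ≤ t + N) :
    -D - 2 * (η * N) ≤ dt (S.e a) ((⇑F)^[j] z - (⇑F)^[i] z - ((j : ℂ) - i) * S.A a) := by
  have h1 := (hW.drop ti (by omega) a z).1
  have h2 := (hW.drop jt (by omega) a z).1
  have e1 : (⇑F)^[t + N] z - (⇑F)^[t] z - (((t + N : ℕ) : ℂ) - t) * S.A a =
    ((⇑F)^[j] z - (⇑F)^[i] z - ((j : ℂ) - i) * S.A a) +
    ((⇑F)^[i] z - (⇑F)^[t] z - ((i : ℂ) - t) * S.A a) +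
    ((⇑F)^[t + N] z - (⇑F)^[j] z - (((t + N : ℕ) : ℂ) - j) * S.A a) := by ring
  rw [e1, dt_add, dt_add] at hD
  linarith

theorem Sys.kap {S : Sys F ι} {a b : ι} (hab : b ≠ a) {z : ℂ} {i j : ℕ} (hij : i ≤ j) {D r : ℝ}
    (hD : -D ≤ dt (S.e a) ((⇑F)^[j] z - (⇑F)^[i] z - ((j : ℂ) - i) * S.A a))
    (hr : ‖(⇑F)^[j] z - (⇑F)^[i] z - ((j : ℂ) - i) * S.A b‖ ≤ r) :
    S.κ * ((j : ℝ) - i) ≤ D + r := by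
  have h1 := (dt_le (S.he a)).trans hr
  have e1 : (⇑F)^[j] z - (⇑F)^[i] z - ((j : ℂ) - i) * S.A b =
    ((⇑F)^[j] z - (⇑F)^[i] z - ((j : ℂ) - i) * S.A a) + ((j : ℂ) - i) * (S.A a - S.A b) := by ring
  rw [e1, dt_add, dt_natCast_sub] at h1
  have hi : (i : ℝ) ≤ j := by exact_mod_cast hij
  have h2 : ((j : ℝ) - i) * S.κ ≤ ((j : ℝ) - i) * dt (S.e a) (S.A a - S.A b) :=
    mul_le_mul_of_nonneg_left (S.sep b a hab) (by linarith)
  linarith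

theorem Sys.opp {S : Sys F ι} {N : ℕ} {η : ℝ} (hη : 0 ≤ η) (hW : S.W1 N η) {a b c : ι}
    (hab : b ≠ a) (hac : c ≠ a) {x z : ℂ} {t i jb jc : ℕ} {D r : ℝ} (hD0 : 0 ≤ D)
    (hD : -D ≤ dt (S.e a) ((⇑F)^[t + N] z - (⇑F)^[t] z - (((t + N : ℕ) : ℂ) - t) * S.A a))
    (hb : ‖(⇑F)^[jb] z - (⇑F)^[i] x - ((jb : ℂ) - i) * S.A b‖ ≤ r)
    (hc : ‖(⇑F)^[jc] z - (⇑F)^[i] x - ((jc : ℂ) - i) * S.A c‖ ≤ r)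
    (tc : t ≤ jc) (ci : jc ≤ i) (ib : i ≤ jb) (bt : jb ≤ t + N) :
    ‖(⇑F)^[i] z - (⇑F)^[i] x‖ ≤ S.K * (r + (D + 2 * (η * N))) := by
  have h1 := S.subdrop hW hD tc (ci.trans ib) bt
  have hi1 : (jc : ℝ) ≤ i := by exact_mod_cast ci
  have hi2 : (i : ℝ) ≤ jb := by exact_mod_cast ib
  have e1 : (⇑F)^[jb] z - (⇑F)^[jc] z - ((jb : ℂ) - jc) * S.A a =
    ((⇑F)^[jb] z - (⇑F)^[i] x - ((jb : ℂ) - i) * S.A b) -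
    ((⇑F)^[jc] z - (⇑F)^[i] x - ((jc : ℂ) - i) * S.A c) -
    ((jb : ℂ) - i) * (S.A a - S.A b) - ((i : ℂ) - jc) * (S.A a - S.A c) := by ring
  rw [e1, dt_sub, dt_sub, dt_sub, dt_natCast_sub, dt_natCast_sub] at h1
  have h2 : ((jb : ℝ) - i) * S.κ ≤ ((jb : ℝ) - i) * dt (S.e a) (S.A a - S.A b) :=
    mul_le_mul_of_nonneg_left (S.sep b a hab) (by linarith)
  have h3 : ((i : ℝ) - jc) * S.κ ≤ ((i : ℝ) - jc) * dt (S.e a) (S.A a - S.A c) :=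
    mul_le_mul_of_nonneg_left (S.sep c a hac) (by linarith)
  have h4 := (dt_le (S.he a)).trans hb
  have h5 := (neg_le_dt (S.he a)).trans' (neg_le_neg hc)
  have h6 : 0 ≤ ((i : ℝ) - jc) * S.κ := mul_nonneg (by linarith) S.hκ.le
  refine S.near_of_kappa (by positivity) hb ?_
  rw [abs_of_nonneg (by linarith)]
  linarith

theorem Sys.K2 {S : Sys F ι} {N : ℕ} {θ : ℝ} (hθ : 0 ≤ θ) (hW : S.W1 N θ) (hAg : S.Ag N θ)
    {Y : Set ℂ} (hY : IsPathConnected Y) {z : ℂ} (hz : z ∈ Y) {t : ℕ} {m D : ℝ} (hD0 : 0 ≤ D)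
    (h1 : DD F Y t m) (h2 : DD F Y (t + N / 2) m) (h3 : DD F Y (t + N) m) (a : ι)
    (hD : -D ≤ dt (S.e a) ((⇑F)^[t + N] z - (⇑F)^[t] z - (((t + N : ℕ) : ℂ) - t) * S.A a))
    (hbig : 3 * (θ * N) + 2 * m + D < S.κ * (((N : ℝ) - 1) / 2)) :
    DD F Y (t + N / 2) (2 * (S.K * (3 * (θ * N) + D))) := by
  obtain ⟨b, c, hab, hac, hbc⟩ := S.three a
  set i := t + N / 2 with hi
  have hi1 : ((N : ℝ) - 1) / 2 ≤ (i : ℝ) - t := by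
    have : (N : ℝ) ≤ 2 * (N / 2 : ℕ) + 1 := by exact_mod_cast (by omega : N ≤ 2 * (N / 2) + 1)
    rw [hi]; push_cast at this ⊢; linarith
  have hi2 : ((N : ℝ) - 1) / 2 ≤ ((t + N : ℕ) : ℝ) - i := by
    have : (2 * (N / 2 : ℕ) : ℝ) ≤ N := by exact_mod_cast (by omega : 2 * (N / 2) ≤ N)
    rw [hi]; push_cast at this ⊢; linarith
  have hκ := S.hκ
  have hti : t ≤ i := by omega
  have hit : i ≤ t + N := by omega
  have key : ∀ b, a ≠ b → ∀ x ∈ Y, ∃ j, t ≤ j ∧ j ≤ t + N ∧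
      ‖(⇑F)^[j] z - (⇑F)^[i] x - ((j : ℂ) - i) * S.A b‖ ≤ θ * N := by
    intro b hab
    rcases S.sub1 hAg hY hz hti hit h1 h2 h3 b with h | h | h
    · have := S.kap hab.symm hti (D := D + 2 * (θ * N)) (by linarith [S.subdrop hW hD le_rfl hti hit]) h
      have := mul_le_mul_of_nonneg_left hi1 hκ.le
      linarith
    · have := S.kap hab.symm hit (D := D + 2 * (θ * N)) (by linarith [S.subdrop hW hD hti hit le_rfl]) h
      have := mul_le_mul_of_nonneg_left hi2 hκ.le
      linarith
    · exact h
  refine DD.of_center (x0 := z) fun x hx => ?_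
  rw [mul_div_cancel_left₀ _ (two_ne_zero)]
  obtain ⟨jb, b1, b2, b3⟩ := key b hab x hx
  obtain ⟨jc, c1, c2, c3⟩ := key c hac x hx
  have hN : 0 ≤ θ * N := by positivity
  have hK := S.one_le_K
  rcases le_total i jb with ib | ib <;> rcases le_total i jc with ic | ic
  · refine (S.near_same hθ hW hbc b3 c3 (Or.inl ⟨ib, ic⟩) b1 c1 b2 c2).trans ?_
    exact mul_le_mul_of_nonneg_left (by linarith) (by linarith)
  · refine (S.opp hθ hW hab.symm hac.symm hD0 hD b3 c3 c1 ic ib b2).trans ?_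
    exact mul_le_mul_of_nonneg_left (by linarith) (by linarith)
  · refine (S.opp hθ hW hac.symm hab.symm hD0 hD c3 b3 b1 ib ic c2).trans ?_
    exact mul_le_mul_of_nonneg_left (by linarith) (by linarith)
  · refine (S.near_same hθ hW hbc b3 c3 (Or.inr ⟨ib, ic⟩) b1 c1 b2 c2).trans ?_
    exact mul_le_mul_of_nonneg_left (by linarith) (by linarith)

theorem pigeon (g : ℕ → ℝ) (P : ℕ) (hP : 0 < P) (D : ℝ) (h : -(P * D) ≤ g P - g 0) :
    ∃ p < P, -D ≤ g (p + 1) - g p := by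
  by_contra hcon
  push Not at hcon
  have h1 : ∑ p ∈ Finset.range P, (g (p + 1) - g p) < ∑ p ∈ Finset.range P, (-D) :=
    Finset.sum_lt_sum_of_nonempty (by simpa using hP.ne') fun p hp => hcon p (Finset.mem_range.1 hp)
  rw [Finset.sum_range_sub] at h1
  simp at h1
  linarith

theorem Sys.K3 {S : Sys F ι} {N P : ℕ} (hP : 0 < P) {θ : ℝ} (hθ : 0 ≤ θ) (hW : S.W1 N θ) (hAg : S.Ag N θ)
    {Y : Set ℂ} (hY : IsPathConnected Y) {z : ℂ} (hz : z ∈ Y) {t : ℕ} {m D : ℝ} (hD0 : 0 ≤ D)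
    (h1 : ∀ i, t ≤ i → i ≤ t + P * N → DD F Y i m) (a : ι)
    (hD : -(P * D) ≤ dt (S.e a) ((⇑F)^[t + P * N] z - (⇑F)^[t] z - (((t + P * N : ℕ) : ℂ) - t) * S.A a))
    (hbig : 3 * (θ * N) + 2 * m + D < S.κ * (((N : ℝ) - 1) / 2)) :
    ∃ i, t ≤ i ∧ i ≤ t + P * N ∧ DD F Y i (2 * (S.K * (3 * (θ * N) + D))) := by
  obtain ⟨p, hp, h⟩ := pigeon (fun p => dt (S.e a) ((⇑F)^[t + p * N] z - ((t + p * N : ℕ) : ℂ) * S.A a))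
    P hP D (by
      rw [← dt_sub]; refine hD.trans (le_of_eq ?_); congr 1; simp; ring)
  rw [← dt_sub] at h
  have hb : (p + 1) * N ≤ P * N := Nat.mul_le_mul_right N hp
  have hb' : (p + 1) * N = p * N + N := by ring
  refine ⟨t + p * N + N / 2, by omega, by omega, ?_⟩
  refine S.K2 hθ hW hAg hY hz hD0 (h1 _ (by omega) (by omega)) (h1 _ (by omega) (by omega))
    (h1 _ (by omega) (by omega)) a ?_ hbig
  refine h.trans (le_of_eq ?_)
  rw [show t + (p + 1) * N = t + p * N + N by omega]
  congr 1; ring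

theorem Sys.lemmaK (S : Sys F ι) (hne : Nonempty ι) {γ : ℝ} (hγ : 0 < γ) : ∃ K' m0 : ℝ, 0 < K' ∧ 1 ≤ m0 ∧
    ∀ (Y : Set ℂ), IsPathConnected Y → ∀ m ≥ m0, ∀ t T : ℕ, K' * m ≤ T →
    (∀ i, t ≤ i → i ≤ t + T → DD F Y i m) → ∃ i, t ≤ i ∧ i ≤ t + T ∧ DD F Y i (γ * m) := by
  have hκ := S.hκ
  have hK := S.one_le_K
  obtain ⟨δ, hδ, hδ1, hδ2⟩ : ∃ δ : ℝ, 0 < δ ∧ δ ≤ 1 ∧ 4 * S.K * δ ≤ γ :=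
    ⟨min 1 (γ / (4 * S.K)), by positivity, min_le_left _ _, by
      have := min_le_right 1 (γ / (4 * S.K))
      rwa [le_div_iff₀' (by positivity)] at this⟩
  obtain ⟨P, hP⟩ := exists_nat_ge (3 / δ)
  have hP0 : (0:ℝ) < P := lt_of_lt_of_le (by positivity) hP
  have hP1 : 0 < P := by exact_mod_cast hP0
  rw [div_le_iff₀ hδ] at hP
  set Λ : ℝ := 16 / S.κ with hΛ
  have hΛ0 : 0 < Λ := by positivity
  set K' : ℝ := 4 * P * Λ with hK'
  have hK0 : 0 < K' := by positivity
  set θ : ℝ := δ / 4 / K' with hθ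
  have hθ0 : 0 < θ := by positivity
  obtain ⟨N1, hAg⟩ := S.exists_Ag hθ0
  obtain ⟨N2, hW⟩ := S.exists_W1 hθ0
  refine ⟨K', 1 + S.κ + 1 / Λ + (N1 + N2 : ℕ) / Λ, hK0, ?_, ?_⟩
  · have : 0 ≤ 1 / Λ := by positivity
    have : 0 ≤ (N1 + N2 : ℕ) / Λ := by positivity
    linarith
  intro Y hY m hm t T hT hDD
  have i1 : 0 ≤ 1 / Λ := by positivity
  have i2 : 0 ≤ (N1 + N2 : ℕ) / Λ := by positivity
  have m1 : 1 ≤ m := by linarith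
  have m2 : S.κ ≤ m := by linarith
  have m3 : 1 ≤ Λ * m := by
    rw [← div_le_iff₀' hΛ0]; linarith
  have m4 : ((N1 + N2 : ℕ) : ℝ) ≤ Λ * m := by
    rw [← div_le_iff₀' hΛ0]; linarith
  set ℓ : ℕ := ⌈Λ * m⌉₊ with hℓ
  have l1 : Λ * m ≤ ℓ := Nat.le_ceil _
  have l2 : (ℓ : ℝ) ≤ 2 * (Λ * m) := by
    have := (Nat.ceil_lt_add_one (show 0 ≤ Λ * m by positivity)).le
    linarith
  have l3 : N1 + N2 ≤ ℓ := by exact_mod_cast m4.trans l1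
  have hTT : ((2 * (P * ℓ) : ℕ) : ℝ) ≤ K' * m := by
    push_cast
    have := mul_le_mul_of_nonneg_left l2 hP0.le
    rw [hK']; linarith
  have hT2 : 2 * (P * ℓ) ≤ T := by exact_mod_cast hTT.trans hT
  have lP : ℓ ≤ P * ℓ := Nat.le_mul_of_pos_left _ hP1
  have q1 : θ * ((2 * (P * ℓ) : ℕ) : ℝ) ≤ δ / 4 * m := by
    refine (mul_le_mul_of_nonneg_left hTT hθ0.le).trans (le_of_eq ?_)
    rw [hθ]; field_simp
  have q2 : θ * (ℓ : ℝ) ≤ δ / 4 * m := by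
    refine le_trans (mul_le_mul_of_nonneg_left ?_ hθ0.le) q1
    exact_mod_cast (by omega : ℓ ≤ 2 * (P * ℓ))
  have hδm : 0 < δ * m := by positivity
  have hδm1 : δ * m ≤ m := by nlinarith
  have hbig : 3 * (θ * ℓ) + 2 * m + δ * m < S.κ * (((ℓ : ℝ) - 1) / 2) := by
    have : 16 * m ≤ S.κ * ℓ := by
      have := mul_le_mul_of_nonneg_left l1 hκ.le
      rw [hΛ] at this
      refine le_trans (le_of_eq ?_) this; field_simp
    linarith
  have hfin : 2 * (S.K * (3 * (θ * ℓ) + δ * m)) ≤ γ * m := by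
    have : S.K * (3 * (θ * ℓ) + δ * m) ≤ S.K * (2 * (δ * m)) := by gcongr; linarith
    nlinarith
  obtain ⟨z, hz⟩ := hY.nonempty
  obtain ⟨a⟩ := hne
  obtain ⟨b, c, hab, hac, hbc⟩ := S.three a
  have hAgT := hAg (2 * (P * ℓ)) (by omega)
  have hWT := hW (2 * (P * ℓ)) (by omega)
  have hAgl := hAg ℓ (by omega)
  have hWl := hW ℓ (by omega)
  by_contra hcon
  push Not at hcon
  have key : ∀ d, ∀ x ∈ Y, ∃ j, t ≤ j ∧ j ≤ t + 2 * (P * ℓ) ∧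
      ‖(⇑F)^[j] z - (⇑F)^[t + P * ℓ] x - ((j : ℂ) - (t + P * ℓ : ℕ)) * S.A d‖ ≤
        θ * ((2 * (P * ℓ) : ℕ) : ℝ) := by
    intro d
    rcases S.sub1 hAgT hY hz (t := t) (i := t + P * ℓ) (by omega) (by omega) (hDD _ (by omega) (by omega))
      (hDD _ (by omega) (by omega)) (hDD _ (by omega) (by omega)) d with h | h | h
    · exfalso
      obtain ⟨i, i1, i2, h⟩ := S.K3 hP1 hθ0.le hWl hAgl hY hz (t := t) (D := δ * m) hδm.le
        (fun i h1 h2 => hDD i h1 (by omega)) d (by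
          have := (neg_le_dt (S.he d)).trans' (neg_le_neg h)
          refine le_trans ?_ this
          nlinarith) hbig
      exact hcon i i1 (by omega) (h.mono hfin)
    · exfalso
      have e1 : t + 2 * (P * ℓ) = (t + P * ℓ) + P * ℓ := by ring
      rw [e1] at h
      obtain ⟨i, i1, i2, h⟩ := S.K3 hP1 hθ0.le hWl hAgl hY hz (t := t + P * ℓ) (D := δ * m) hδm.le
        (fun i h1 h2 => hDD i (by omega) (by omega)) d (by
          have := (neg_le_dt (S.he d)).trans' (neg_le_neg h)
          refine le_trans ?_ this
          nlinarith) hbig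
      exact hcon i (by omega) (by omega) (h.mono hfin)
    · exact h
  refine hcon (t + P * ℓ) (by omega) (by omega) (DD.of_center (x0 := z) fun x hx => ?_)
  refine (S.near_three hθ0.le hWT hab hac hbc (key a x hx) (key b x hx) (key c x hx)).trans ?_
  have : S.K * (θ * ((2 * (P * ℓ) : ℕ) : ℝ) + θ * ((2 * (P * ℓ) : ℕ) : ℝ)) ≤ S.K * (δ / 2 * m) := by
    gcongr; linarith
  nlinarith

theorem Sys.halving (S : Sys F ι) (hne : Nonempty ι) : ∃ K' m0 : ℝ, 0 < K' ∧ 1 ≤ m0 ∧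
    ∀ (Y : Set ℂ), IsPathConnected Y → ∀ m ≥ m0, ∀ a b : ℝ, 0 ≤ a →
    (∀ i : ℕ, a ≤ i → i ≤ b → DD F Y i m) →
    ∀ i : ℕ, a + K' * m ≤ i → i + K' * m ≤ b → DD F Y i (m / 2) := by
  have hK := S.one_le_K
  have hγ : 0 < 1 / (8 * S.K) := by positivity
  obtain ⟨K', m0, hK', hm0, h⟩ := S.lemmaK hne hγ
  obtain ⟨M, hM, hcl⟩ := S.clean hne (θ := 1 / (32 * S.K * K')) (by positivity)
  refine ⟨2 * K', m0 + 4 * M + 1 / K', by positivity, ?_, ?_⟩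
  · have : 0 ≤ 1 / K' := by positivity
    linarith
  intro Y hY m hm a b ha hDD i ai ib
  have i1 : 0 ≤ 1 / K' := by positivity
  have m1 : m0 ≤ m := by linarith
  have m2 : 4 * M ≤ m := by linarith
  have m3 : 1 ≤ K' * m := by
    rw [← div_le_iff₀' hK']; linarith
  set T : ℕ := ⌈K' * m⌉₊ with hT
  have l1 : K' * m ≤ T := Nat.le_ceil _
  have l2 : (T : ℝ) ≤ 2 * (K' * m) := by
    have := (Nat.ceil_lt_add_one (show 0 ≤ K' * m by linarith)).le
    linarith
  have hTi : T ≤ i := by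
    have : (T : ℝ) ≤ i := by linarith
    exact_mod_cast this
  obtain ⟨s, rfl⟩ := Nat.exists_eq_add_of_le' hTi
  have hc : ((s + T : ℕ) : ℝ) = s + T := by push_cast; ring
  rw [hc] at ai ib
  obtain ⟨p, p1, p2, hp⟩ := h Y hY m m1 s T l1 (fun j j1 j2 => by
    have j1' : (s : ℝ) ≤ j := by exact_mod_cast j1
    have j2' : (j : ℝ) ≤ s + T := by exact_mod_cast j2
    exact hDD j (by linarith) (by linarith))
  obtain ⟨q, q1, q2, hq⟩ := h Y hY m m1 (s + T) T l1 (fun j j1 j2 => by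
    have j1' : (s : ℝ) + T ≤ j := by exact_mod_cast j1
    have j2' : (j : ℝ) ≤ s + T + T := by exact_mod_cast j2
    exact hDD j (by linarith) (by linarith))
  obtain ⟨N, rfl⟩ := Nat.exists_eq_add_of_le (p2.trans q1)
  refine (hcl N p Y hY _ (mul_nonneg hγ.le (by linarith)) hp hq (s + T) p2 q1).mono ?_
  have hN : (N : ℝ) ≤ 4 * (K' * m) := by
    have : N ≤ 2 * T := by omega
    have : (N : ℝ) ≤ 2 * T := by exact_mod_cast this
    linarith
  have e1 : 1 / (32 * S.K * K') * (N : ℝ) ≤ 1 / (32 * S.K * K') * (4 * (K' * m)) := by gcongr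
  have e2 : S.K * (1 / (32 * S.K * K') * (4 * (K' * m)) + 1 / (8 * S.K) * m) = m / 4 := by
    field_simp; ring
  have e3 : S.K * (1 / (32 * S.K * K') * (N : ℝ) + 1 / (8 * S.K) * m) ≤
    S.K * (1 / (32 * S.K * K') * (4 * (K' * m)) + 1 / (8 * S.K) * m) := by gcongr
  linarith

theorem Sys.lemmaB (S : Sys F ι) (hne : Nonempty ι) : ∃ K' m0 : ℝ, 0 < K' ∧ 1 ≤ m0 ∧
    ∀ (Y : Set ℂ), IsPathConnected Y → ∀ m ≥ 0, ∀ a b : ℝ, 0 ≤ a →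
    (∀ i : ℕ, a ≤ i → i ≤ b → DD F Y i m) →
    ∀ i : ℕ, a + K' * m ≤ i → i + K' * m ≤ b → DD F Y i m0 := by
  obtain ⟨K', m0, hK', hm0, h⟩ := S.halving hne
  refine ⟨2 * K', m0, by positivity, hm0, fun Y hY => ?_⟩
  have key : ∀ n : ℕ, ∀ m ≥ 0, m ≤ 2 ^ n * m0 → ∀ a b : ℝ, 0 ≤ a →
    (∀ i : ℕ, a ≤ i → i ≤ b → DD F Y i m) →
    ∀ i : ℕ, a + 2 * K' * m ≤ i → i + 2 * K' * m ≤ b → DD F Y i m0 := by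
    intro n
    induction n with
    | zero =>
      intro m hm hle a b ha hDD i ai ib
      have : 0 ≤ 2 * K' * m := by positivity
      exact (hDD i (by linarith) (by linarith)).mono (by simpa using hle)
    | succ n ih =>
      intro m hm hle a b ha hDD i ai ib
      have : 0 ≤ 2 * K' * m := by positivity
      rcases le_total m m0 with hmm | hmm
      · exact (hDD i (by linarith) (by linarith)).mono hmm
      · refine ih (m / 2) (by positivity) (by rw [pow_succ] at hle; linarith) (a + K' * m) (b - K' * m)
          (by positivity) (fun j j1 j2 => h Y hY m hmm a b ha hDD j j1 (by linarith)) i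
          (by linarith) (by linarith)
  intro m hm
  obtain ⟨n, hn⟩ := pow_unbounded_of_one_lt m (one_lt_two)
  exact key n m hm (by have : (0:ℝ) < 2 ^ n := by positivity
                       nlinarith)

/-! ## Part 7 -/
def IsLat (w : ℂ) : Prop := ∃ p q : ℤ, w = ⟨p, q⟩

theorem IsLat.natMul {w : ℂ} (h : IsLat w) (n : ℕ) : IsLat (n * w) := by
  obtain ⟨p, q, rfl⟩ := h
  exact ⟨n * p, n * q, by apply Complex.ext <;> simp⟩

theorem IsLat.neg {w : ℂ} (h : IsLat w) : IsLat (-w) := by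
  obtain ⟨p, q, rfl⟩ := h
  exact ⟨-p, -q, by apply Complex.ext <;> simp⟩

theorem Sys.it_add (S : Sys F ι) {w : ℂ} (h : IsLat w) (z : ℂ) (j : ℕ) :
    (⇑F)^[j] (z + w) = (⇑F)^[j] z + w := by
  obtain ⟨p, q, rfl⟩ := h
  exact S.lat_it z p q j

theorem isOpenMap_it {X : Type*} [TopologicalSpace X] (F : X ≃ₜ X) (n : ℕ) : IsOpenMap ((⇑F)^[n]) := by
  induction n with
  | zero => exact IsOpenMap.id
  | succ n ih => exact ih.comp F.isOpenMap

/-- transitivity modulo the lattice -/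
def TrL (F : ℂ ≃ₜ ℂ) : Prop := ∀ U V : Set ℂ, IsOpen U → IsOpen V → U.Nonempty → V.Nonempty →
  ∃ n ≥ 1, ∃ x ∈ U, ∃ w, IsLat w ∧ (⇑F)^[n] x + w ∈ V

theorem Sys.norm_sep (S : Sys F ι) {a b : ι} (h : a ≠ b) : S.κ ≤ ‖S.A b - S.A a‖ :=
  (S.sep a b h).trans (dt_le (S.he b))

theorem Sys.not_tame (S : Sys F ι) (hne : Nonempty ι) (htr : TrL F) {V : Set ℂ} (hV : IsOpen V)
    (hVc : IsPathConnected V) (M : ℝ) (hM : ∀ n, DD F V n M) : False := by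
  obtain ⟨k, hk, x, hx, w, hw, hxw⟩ := htr V V hV hV hVc.nonempty hVc.nonempty
  have key : ∀ J : ℕ, ∃ Y : Set ℂ, IsPathConnected Y ∧ V ⊆ Y ∧ (∃ M' : ℝ, 0 ≤ M' ∧ ∀ n, DD F Y n M') ∧
      ∀ y ∈ V, (⇑F)^[J * k] y + J * w ∈ Y := by
    intro J
    induction J with
    | zero =>
      refine ⟨V, hVc, le_rfl, ⟨M, ?_, hM⟩, fun y hy => by simpa using hy⟩
      exact (norm_nonneg _).trans (hM 0 x hx x hx)
    | succ J ih =>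
      obtain ⟨Y, hY, hVY, ⟨M', hM'0, hM'⟩, hJ⟩ := ih
      refine ⟨V ∪ (fun y => (⇑F)^[k] y + w) '' Y, ?_, subset_union_left, ⟨M + M', ?_, ?_⟩, ?_⟩
      · refine hVc.union (hY.image ?_) ⟨_, hxw, mem_image_of_mem _ (hVY hx)⟩
        exact (F.continuous.iterate k).add continuous_const
      · have := (norm_nonneg _).trans (hM 0 x hx x hx)
        linarith
      · intro n
        have hG : ∀ y ∈ Y, ∀ y' ∈ Y, ‖(⇑F)^[n] ((⇑F)^[k] y + w) - (⇑F)^[n] ((⇑F)^[k] y' + w)‖ ≤ M' := by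
          intro y hy y' hy'
          rw [S.it_add hw, S.it_add hw, ← Function.iterate_add_apply, ← Function.iterate_add_apply,
            add_sub_add_right_eq_sub]
          exact hM' _ y hy y' hy'
        have hM0 := (norm_nonneg _).trans (hM 0 x hx x hx)
        have hcross : ∀ v ∈ V, ∀ y ∈ Y, ‖(⇑F)^[n] v - (⇑F)^[n] ((⇑F)^[k] y + w)‖ ≤ M + M' := by
          intro v hv y hy
          have h1 := hM n v hv _ hxw
          have h2 := hG x (hVY hx) y hy
          have := norm_sub_le_norm_sub_add_norm_sub ((⇑F)^[n] v) ((⇑F)^[n] ((⇑F)^[k] x + w))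
            ((⇑F)^[n] ((⇑F)^[k] y + w))
          linarith
        rintro u (hu | ⟨y, hy, rfl⟩) u' (hu' | ⟨y', hy', rfl⟩)
        · have := hM n u hu u' hu'; linarith
        · exact hcross u hu y' hy'
        · rw [norm_sub_rev]; exact hcross u' hu' y hy
        · have := hG y hy y' hy'; dsimp only; linarith
      · intro y hy
        refine Or.inr ⟨_, hJ y hy, ?_⟩
        dsimp only
        rw [S.it_add (hw.natMul J), ← Function.iterate_add_apply,
          show (J + 1) * k = k + J * k by ring]
        push_cast; ring
  obtain ⟨K', m0, hK', hm0, hB⟩ := S.lemmaB hne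
  have key2 : ∀ J : ℕ, ∃ n0 : ℕ, ∀ n ≥ n0, ∀ y ∈ V, ‖(⇑F)^[J * k] ((⇑F)^[n] y) + J * w - (⇑F)^[n] y‖ ≤ m0 := by
    intro J
    obtain ⟨Y, hY, hVY, ⟨M', hM'0, hM'⟩, hJ⟩ := key J
    refine ⟨⌈K' * M'⌉₊, fun n hn y hy => ?_⟩
    have hn' : K' * M' ≤ n := (Nat.le_ceil _).trans (by exact_mod_cast hn)
    have := hB Y hY M' hM'0 0 (n + K' * M') le_rfl (fun i _ _ => hM' i) n (by linarith) le_rfl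
      _ (hJ y hy) _ (hVY hy)
    rwa [S.it_add (hw.natMul J), ← Function.iterate_add_apply, add_comm n,
      Function.iterate_add_apply] at this
  have hκ := S.hκ
  obtain ⟨a⟩ := hne
  obtain ⟨b, -, hab, -, -⟩ := S.three a
  obtain ⟨η, hη, N0, hst⟩ := S.static (ε := S.κ / 8) (by positivity)
  obtain ⟨J, hJ⟩ : ∃ J : ℕ, N0 ≤ J * k ∧ 4 * m0 / S.κ < (J * k : ℕ) := by
    obtain ⟨J, hJ⟩ := exists_nat_gt (4 * m0 / S.κ)
    refine ⟨N0 + J, ?_, hJ.trans_le ?_⟩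
    · nlinarith
    · exact_mod_cast (by nlinarith : J ≤ (N0 + J) * k)
  have hz : ∃ z, m0 < ‖(⇑F)^[J * k] z + J * w - z‖ := by
    by_contra hcon
    push Not at hcon
    have hh : ∀ a, ‖((J * k : ℕ) : ℂ) * S.A a + J * w‖ ≤ S.κ / 8 * (J * k : ℕ) + m0 := by
      intro a
      obtain ⟨z, hz⟩ := S.E2 (J * k) a
      have h1 := hst (J * k) hJ.1 a z (by
        have : 0 ≤ η * (J * k : ℕ) := by positivity
        linarith) 0 (J * k) (Nat.zero_le _) le_rfl
      have h2 := hcon z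
      rw [show ((J * k : ℕ) : ℂ) * S.A a + J * w = ((⇑F)^[J * k] z + J * w - z) -
        ((⇑F)^[J * k] z - (⇑F)^[0] z - (((J * k : ℕ) : ℂ) - (0 : ℕ)) * S.A a) by simp; ring]
      exact (norm_sub_le _ _).trans (by linarith)
    have h1 := hh a
    have h2 := hh b
    have h3 : ‖((J * k : ℕ) : ℂ) * (S.A b - S.A a)‖ ≤ 2 * (S.κ / 8 * (J * k : ℕ) + m0) := by
      rw [show ((J * k : ℕ) : ℂ) * (S.A b - S.A a) = (((J * k : ℕ) : ℂ) * S.A b + J * w) -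
        (((J * k : ℕ) : ℂ) * S.A a + J * w) by ring]
      exact (norm_sub_le _ _).trans (by linarith)
    rw [norm_mul, Complex.norm_natCast] at h3
    have h4 := mul_le_mul_of_nonneg_left (S.norm_sep hab) (Nat.cast_nonneg (α := ℝ) (J * k))
    have h5 := hJ.2
    rw [div_lt_iff₀ hκ] at h5
    linarith
  obtain ⟨n0, hn0⟩ := key2 J
  have hO : IsOpen {z : ℂ | m0 < ‖(⇑F)^[J * k] z + J * w - z‖} := by
    apply isOpen_lt continuous_const
    exact (((F.continuous.iterate _).add continuous_const).sub continuous_id).norm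
  have hFV : IsOpen ((⇑F)^[n0] '' V) := by
    have : IsOpenMap ((⇑F)^[n0]) := isOpenMap_it F n0
    exact this V hV
  obtain ⟨n, hn, _, ⟨y, hy, rfl⟩, w', hw', hmem⟩ := htr _ _ hFV hO (hVc.nonempty.image _) hz
  have h1 := hn0 (n + n0) (by omega) y hy
  change m0 < _ at hmem
  rw [S.it_add hw', ← Function.iterate_add_apply (⇑F) n n0] at hmem
  rw [show (⇑F)^[J * k] ((⇑F)^[n + n0] y) + w' + J * w - ((⇑F)^[n + n0] y + w') =
    (⇑F)^[J * k] ((⇑F)^[n + n0] y) + J * w - (⇑F)^[n + n0] y by ring] at hmem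
  linarith

theorem Sys.growth (S : Sys F ι) (hne : Nonempty ι) (htr : TrL F) : ∃ ε : ℝ, 0 < ε ∧
    ∀ V : Set ℂ, IsOpen V → IsPathConnected V → ∀ m1 : ℝ, 0 ≤ m1 → DD F V 0 m1 →
    ∃ n0 : ℕ, ∀ n ≥ n0, ¬ DD F V n (ε * n) := by
  obtain ⟨K', m0, hK', hm0, hB⟩ := S.lemmaB hne
  have hK := S.one_le_K
  set ε : ℝ := 1 / (24 * S.K * K') with hε
  have hε0 : 0 < ε := by positivity
  obtain ⟨M, hM, hcl⟩ := S.clean hne hε0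
  refine ⟨ε, hε0, fun V hV hVc m1 hm1 h0 => ?_⟩
  obtain ⟨n0, hn0⟩ := exists_nat_ge ((M + m1 + m0) / ε + 8)
  have hbig : ∀ n : ℕ, n0 ≤ n → M + m1 + m0 ≤ ε * n := by
    intro n hn
    have : (n0 : ℝ) ≤ n := by exact_mod_cast hn
    rw [← div_le_iff₀' hε0]; linarith
  have hn8 : 8 ≤ n0 := by
    have : 0 ≤ (M + m1 + m0) / ε := by positivity
    have : (8 : ℝ) ≤ n0 := by linarith
    exact_mod_cast this
  have step : ∀ n : ℕ, n0 ≤ n → DD F V n (ε * n) → ∀ i, n ≤ 8 * i → 8 * i ≤ 7 * n → DD F V i m0 := by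
    intro n hn hDD i i1 i2
    have hb := hbig n hn
    have h1 := hcl n 0 V hVc (ε * n) (by positivity) (h0.mono (by linarith)) (by simpa using hDD)
    have e1 : K' * (S.K * (3 * (ε * n))) = n / 8 := by
      rw [hε]; field_simp; ring
    have i1' : (n : ℝ) ≤ 8 * i := by exact_mod_cast i1
    have i2' : (8 * i : ℝ) ≤ 7 * n := by exact_mod_cast i2
    refine hB V hVc (S.K * (3 * (ε * n))) (by positivity) 0 n le_rfl (fun j _ j2 => ?_) i (by linarith)
      (by linarith)
    have j2' : j ≤ 0 + n := by have : j ≤ n := by exact_mod_cast j2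
                               omega
    refine (h1 j (Nat.zero_le _) j2').mono ?_
    have : 1 * M ≤ S.K * (ε * n) := mul_le_mul hK (by linarith) hM (by linarith)
    linarith
  have claim : ∀ n : ℕ, n0 ≤ n → DD F V n (ε * n) → ∀ i, n0 ≤ i → 8 * i ≤ 7 * n → DD F V i m0 := by
    intro n
    induction n using Nat.strong_induction_on with
    | _ n ih =>
      intro hn hDD i i1 i2
      by_cases hi : n ≤ 8 * i
      · exact step n hn hDD i hi i2
      · have hd := step n hn hDD (n / 2) (by omega) (by omega)
        refine ih (n / 2) (by omega) (by omega) (hd.mono ?_) i i1 (by omega)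
        have := hbig (n / 2) (by omega)
        linarith
  by_contra hcon
  push Not at hcon
  refine S.not_tame hne htr hV hVc (m0 + (m1 + 2 * S.C0 * n0)) fun i => ?_
  have hC := S.hC0
  have p1 : 0 ≤ 2 * S.C0 * n0 := by positivity
  by_cases hi : n0 ≤ i
  · obtain ⟨n, hn, hDD⟩ := hcon (n0 + 2 * i)
    exact (claim n (by omega) hDD i hi (by omega)).mono (by linarith)
  · refine (S.DD_shift h0 (Nat.zero_le i)).mono ?_
    have : (i : ℝ) ≤ n0 := by exact_mod_cast (by omega : i ≤ n0)
    have : 2 * S.C0 * (i - (0:ℕ) : ℝ) ≤ 2 * S.C0 * n0 := by gcongr; simpa using this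
    linarith

/-- no point of `V` follows direction `c` -/
def Sys.Fl (S : Sys F ι) (V : Set ℂ) (c : ι) (δ : ℝ) (N : ℕ) : Prop :=
  ∀ x ∈ V, dt (S.e c) ((⇑F)^[N] x - x) < N * dt (S.e c) (S.A c) - δ * N

theorem Sys.Fl.mono {S : Sys F ι} {V : Set ℂ} {c : ι} {δ δ' : ℝ} {N : ℕ} (h : S.Fl V c δ N)
    (hd : δ' ≤ δ) : S.Fl V c δ' N := fun x hx => (h x hx).trans_le (by gcongr)

theorem Sys.fail_agree {S : Sys F ι} {N : ℕ} {θ δ m1 : ℝ} (hAg : S.Ag N θ) {V : Set ℂ}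
    (hV : IsPathConnected V) (h0 : DD F V 0 m1) (hδ : δ ≤ 1) (hθ : θ ≤ δ / 4) (hm : m1 ≤ θ * N)
    {c : ι} (hf : S.Fl V c δ N) {i : ℕ} (hi : 8 * S.C0 * i ≤ δ * N) {x x' : ℂ} (hx : x ∈ V) (hx' : x' ∈ V) :
    ∃ j, 0 ≤ j ∧ j ≤ 0 + N ∧ ‖(⇑F)^[j] x' - (⇑F)^[i] x - ((j : ℂ) - i) * S.A c‖ ≤ 2 * (θ * N) := by
  have hC := S.hC0
  have hm0 : 0 ≤ m1 := (norm_nonneg _).trans (h0 x hx x hx)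
  have hiN : i ≤ N := by
    have h1 : (i : ℝ) * 1 ≤ i * (8 * S.C0) := by gcongr; linarith
    have h2 : δ * (N : ℝ) ≤ 1 * N := by gcongr
    exact_mod_cast (by linarith : (i : ℝ) ≤ N)
  rcases hAg c V hV x hx x' hx' 0 i (Nat.zero_le _) (by omega) with ⟨y, hy, h⟩ | ⟨y, hy, h⟩ | ⟨j, j1, j2, h⟩
  · refine ⟨0, le_rfl, by omega, ?_⟩
    rw [show (⇑F)^[0] x' - (⇑F)^[i] x - (((0:ℕ) : ℂ) - i) * S.A c = ((⇑F)^[0] x' - (⇑F)^[0] y) +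
      ((⇑F)^[0] y - ((⇑F)^[i] x - ((i : ℂ) - (0 : ℕ)) * S.A c)) by ring]
    have := h0 x' hx' y hy
    exact (norm_add_le _ _).trans (by linarith)
  · exfalso
    have h1 := hf y hy
    rw [Nat.zero_add] at h
    have e1 : (⇑F)^[N] y - y = ((⇑F)^[N] y - ((⇑F)^[i] x + ((N : ℂ) - i) * S.A c)) +
      ((⇑F)^[i] x - x) + ((⇑F)^[0] x - (⇑F)^[0] y) + ((N : ℂ) - i) * S.A c := by simp; ring
    rw [e1, dt_add, dt_add, dt_add, dt_natCast_sub] at h1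
    have h2 := (neg_le_dt (S.he c)).trans' (neg_le_neg h.le)
    have h3 := (neg_le_dt (S.he c)).trans' (neg_le_neg (S.disp_it x i))
    have h4 := (neg_le_dt (S.he c)).trans' (neg_le_neg (h0 x hx y hy))
    have h5 := (dt_le (w := S.A c) (S.he c)).trans (S.hA c)
    have h6 : (i : ℝ) * dt (S.e c) (S.A c) ≤ i * S.C0 := by gcongr
    have h7 : θ * (N : ℝ) ≤ δ / 4 * N := by gcongr
    have h8 : 0 ≤ S.C0 * i := by positivity
    linarith
  · exact ⟨j, j1, j2, by linarith⟩

/-! ## Part 8 -/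
theorem exists_time {C δ : ℝ} (hC : 1 ≤ C) (hδ : 0 < δ) (n0 : ℕ) : ∃ N0 : ℕ, ∀ N ≥ N0, ∃ i : ℕ,
    n0 ≤ i ∧ 8 * C * i ≤ δ * N ∧ δ * N ≤ 16 * C * i := by
  obtain ⟨N0, hN0⟩ := exists_nat_ge (16 * C * (n0 + 1) / δ)
  refine ⟨N0, fun N hN => ⟨⌊δ * N / (8 * C)⌋₊, ?_, ?_, ?_⟩⟩
  all_goals
    have hN' : (N0 : ℝ) ≤ N := by exact_mod_cast hN
    rw [div_le_iff₀ hδ] at hN0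
    have h0 : 0 ≤ δ * N / (8 * C) := by positivity
    have h1 := Nat.floor_le h0
    have h2 := Nat.lt_floor_add_one (δ * N / (8 * C))
    rw [le_div_iff₀ (by positivity)] at h1
    rw [div_lt_iff₀ (by positivity)] at h2
    have h3 : (N0 : ℝ) * δ ≤ N * δ := by gcongr
    have h4 : 0 ≤ C * n0 := by positivity
  · apply Nat.le_floor
    rw [le_div_iff₀ (by positivity)]
    linarith
  · linarith
  · linarith

theorem Sys.follow_a (S : Sys F ι) {δ : ℝ} (hδ : 0 < δ) (hδ1 : δ ≤ 1) {V : Set ℂ} (hV : IsPathConnected V)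
    {m1 : ℝ} (h0 : DD F V 0 m1) : ∃ δ2 : ℝ, 0 < δ2 ∧ ∃ N0 : ℕ, ∀ N ≥ N0, ∀ a b c : ι,
    a ≠ b → a ≠ c → b ≠ c → S.Fl V c δ N → ¬ S.Fl V a δ2 N → ¬ S.Fl V b δ2 N → False := by
  have hκ := S.hκ
  have hC := S.hC0
  set β : ℝ := S.κ * δ / (128 * S.C0) with hβ
  have hβ0 : 0 < β := by positivity
  have hθ0 : 0 < min (δ / 4) β := by positivity
  obtain ⟨N1, hAg⟩ := S.exists_Ag hθ0
  obtain ⟨η, hη, N2, hst⟩ := S.static hβ0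
  obtain ⟨N3, hti⟩ := exists_time hC hδ 1
  obtain ⟨N4, hN4⟩ := exists_nat_ge (m1 / min (δ / 4) β)
  refine ⟨η, hη, N1 + N2 + N3 + N4 + 1, fun N hN a b c hab hac hbc hc ha hb => ?_⟩
  simp only [Sys.Fl] at ha hb
  push Not at ha hb
  obtain ⟨x, hx, hx2⟩ := ha
  obtain ⟨y, hy, hy2⟩ := hb
  obtain ⟨i, i0, i1, i2⟩ := hti N (by omega)
  have hm : m1 ≤ min (δ / 4) β * N := by
    rw [div_le_iff₀' hθ0] at hN4
    refine hN4.trans (mul_le_mul_of_nonneg_left ?_ hθ0.le)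
    exact_mod_cast (by omega : N4 ≤ N)
  obtain ⟨j, -, j2, hj⟩ := S.fail_agree (hAg N (by omega)) hV h0 hδ1 (min_le_left _ _) hm hc i1 hx hy
  have hiN : i ≤ N := by
    have h1 : (i : ℝ) * 1 ≤ i * (8 * S.C0) := by gcongr; linarith
    have h2 : δ * (N : ℝ) ≤ 1 * N := by gcongr
    exact_mod_cast (by linarith : (i : ℝ) ≤ N)
  have sx := hst N (by omega) a x hx2 0 i (Nat.zero_le _) hiN
  have sy := hst N (by omega) b y hy2 0 j (Nat.zero_le _) (by omega)
  have hxy := h0 x hx y hy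
  have hβN : min (δ / 4) β * N ≤ β * N := by gcongr; exact min_le_right _ _
  have hN0 : (0:ℝ) < N := by exact_mod_cast (by omega : 0 < N)
  have herr : ‖(j : ℂ) * S.A b - i * S.A a - ((j : ℂ) - i) * S.A c‖ ≤ 5 * (β * N) := by
    rw [show (j : ℂ) * S.A b - i * S.A a - ((j : ℂ) - i) * S.A c =
      ((⇑F)^[j] y - (⇑F)^[i] x - ((j : ℂ) - i) * S.A c) +
      (((⇑F)^[i] x - (⇑F)^[0] x - ((i : ℂ) - (0:ℕ)) * S.A a) -
      ((⇑F)^[j] y - (⇑F)^[0] y - ((j : ℂ) - (0:ℕ)) * S.A b)) + ((⇑F)^[0] x - (⇑F)^[0] y) by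
        simp; ring]
    have n1 := norm_sub_le ((⇑F)^[i] x - (⇑F)^[0] x - ((i : ℂ) - (0:ℕ)) * S.A a)
      ((⇑F)^[j] y - (⇑F)^[0] y - ((j : ℂ) - (0:ℕ)) * S.A b)
    refine (norm_add₃_le).trans ?_
    linarith
  have hfin : S.κ * i ≤ 5 * (β * N) := by
    rcases le_total i j with hij | hij
    · have h1 := (dt_le (S.he b)).trans herr
      have hij' : (i : ℝ) ≤ j := by exact_mod_cast hij
      rw [show (j : ℂ) * S.A b - i * S.A a - ((j : ℂ) - i) * S.A c = i * (S.A b - S.A a) +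
        ((j : ℂ) - i) * (S.A b - S.A c) by ring, dt_add, dt_nat, dt_natCast_sub] at h1
      have h2 := mul_le_mul_of_nonneg_left (S.sep a b hab) (Nat.cast_nonneg (α := ℝ) i)
      have h3 := mul_le_mul_of_nonneg_left (S.sep c b hbc.symm) (sub_nonneg.2 hij')
      have h4 : 0 ≤ ((j : ℝ) - i) * S.κ := mul_nonneg (by linarith) hκ.le
      linarith
    · have h1 := (neg_le_dt (S.he a)).trans' (neg_le_neg herr)
      have hij' : (j : ℝ) ≤ i := by exact_mod_cast hij
      rw [show (j : ℂ) * S.A b - i * S.A a - ((j : ℂ) - i) * S.A c = - (j * (S.A a - S.A b) +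
        ((i : ℂ) - j) * (S.A a - S.A c)) by ring, dt_neg, dt_add, dt_nat, dt_natCast_sub] at h1
      have h2 := mul_le_mul_of_nonneg_left (S.sep b a hab.symm) (Nat.cast_nonneg (α := ℝ) j)
      have h3 := mul_le_mul_of_nonneg_left (S.sep c a hac.symm) (sub_nonneg.2 hij')
      linarith
  have e1 : 8 * (β * N) ≤ S.κ * i := by
    rw [hβ, show 8 * (S.κ * δ / (128 * S.C0) * N) = S.κ * ((δ * N) / (16 * S.C0)) by field_simp; ring]
    gcongr
    rw [div_le_iff₀ (by positivity)]; linarith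
  have : 0 < β * N := by positivity
  linarith

theorem Sys.follow_b (S : Sys F ι) {δ ε : ℝ} (hδ : 0 < δ) (hδ1 : δ ≤ 1) (hε : 0 < ε) {V : Set ℂ}
    (hV : IsPathConnected V) {m1 : ℝ} (h0 : DD F V 0 m1) {n0 : ℕ}
    (hg : ∀ n ≥ n0, ¬ DD F V n (ε * n)) : ∃ δ2 : ℝ, 0 < δ2 ∧ ∃ N0 : ℕ, ∀ N ≥ N0, ∀ a b c : ι,
    a ≠ b → a ≠ c → b ≠ c → S.Fl V c δ N → S.Fl V b δ N → (S.Fl V a δ N ∨ ¬ S.Fl V a δ2 N) → False := by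
  have hκ := S.hκ
  have hC := S.hC0
  have hK := S.one_le_K
  set β : ℝ := ε * δ / (160 * S.C0 * S.K) with hβ
  have hβ0 : 0 < β := by positivity
  have hθ0 : 0 < min (δ / 4) β := by positivity
  obtain ⟨N1, hAg⟩ := S.exists_Ag hθ0
  obtain ⟨N2, hW⟩ := S.exists_W1 hθ0
  obtain ⟨N3, hti⟩ := exists_time hC hδ n0
  obtain ⟨N4, hN4⟩ := exists_nat_ge (m1 / min (δ / 4) β)
  refine ⟨β, hβ0, N1 + N2 + N3 + N4 + 1, fun N hN a b c hab hac hbc hc hb ha => ?_⟩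
  obtain ⟨i, i0, i1, i2⟩ := hti N (by omega)
  have hm : m1 ≤ min (δ / 4) β * N := by
    rw [div_le_iff₀' hθ0] at hN4
    refine hN4.trans (mul_le_mul_of_nonneg_left ?_ hθ0.le)
    exact_mod_cast (by omega : N4 ≤ N)
  have hiN : i ≤ N := by
    have h1 : (i : ℝ) * 1 ≤ i * (8 * S.C0) := by gcongr; linarith
    have h2 : δ * (N : ℝ) ≤ 1 * N := by gcongr
    exact_mod_cast (by linarith : (i : ℝ) ≤ N)
  have hβN : min (δ / 4) β * N ≤ β * N := by gcongr; exact min_le_right _ _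
  have hβN0 : 0 ≤ min (δ / 4) β * N := by positivity
  have e1 : 2 * (S.K * (5 * (β * N))) ≤ ε * i := by
    rw [hβ, show 2 * (S.K * (5 * (ε * δ / (160 * S.C0 * S.K) * N))) = ε * ((δ * N) / (16 * S.C0)) by
      field_simp; ring]
    gcongr
    rw [div_le_iff₀ (by positivity)]; linarith
  have ag : ∀ {c : ι}, S.Fl V c δ N → 8 * S.C0 * i ≤ δ * N → ∀ {x x' : ℂ}, x ∈ V → x' ∈ V →
      ∃ j, 0 ≤ j ∧ j ≤ 0 + N ∧ ‖(⇑F)^[j] x' - (⇑F)^[i] x - ((j : ℂ) - i) * S.A c‖ ≤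
        2 * (min (δ / 4) β * N) := fun hf hi _ _ hx hx' =>
    S.fail_agree (hAg N (by omega)) hV h0 hδ1 (min_le_left _ _) hm hf hi hx hx'
  refine hg i i0 (DD.mono ?_ e1)
  have hw := hW N (by omega)
  have hKm : ∀ {u v : ℝ}, u ≤ v → S.K * u ≤ S.K * v := fun h => mul_le_mul_of_nonneg_left h (by linarith)
  rcases ha with ha | ha
  · intro x' hx' x hx
    refine (S.near_three hθ0.le hw hab hac hbc (ag ha i1 hx hx') (ag hb i1 hx hx') (ag hc i1 hx hx')).trans ?_
    have := hKm (show 2 * (min (δ / 4) β * N) + min (δ / 4) β * N ≤ 5 * (β * N) by linarith)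
    have : 0 ≤ S.K * (5 * (β * N)) := by positivity
    linarith
  · simp only [Sys.Fl] at ha
    push Not at ha
    obtain ⟨z, hz, hz2⟩ := ha
    refine DD.of_center (x0 := z) fun x hx => ?_
    rw [mul_div_cancel_left₀ _ (two_ne_zero)]
    obtain ⟨jb, b1, b2, b3⟩ := ag hb i1 hx hz
    obtain ⟨jc, c1, c2, c3⟩ := ag hc i1 hx hz
    have hD : -(β * N) ≤ dt (S.e a) ((⇑F)^[0 + N] z - (⇑F)^[0] z - (((0 + N : ℕ) : ℂ) - (0:ℕ)) * S.A a) := by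
      have : dt (S.e a) ((⇑F)^[0 + N] z - (⇑F)^[0] z - (((0 + N : ℕ) : ℂ) - (0:ℕ)) * S.A a) =
        dt (S.e a) ((⇑F)^[N] z - z) - N * dt (S.e a) (S.A a) := by
        rw [dt_sub, dt_natCast_sub]; simp
      linarith
    have hβN1 : 0 ≤ β * N := by positivity
    rcases le_total i jb with ib | ib <;> rcases le_total i jc with ic | ic
    · exact (S.near_same hθ0.le hw hbc b3 c3 (Or.inl ⟨ib, ic⟩) b1 c1 b2 c2).trans (hKm (by linarith))
    · exact (S.opp hθ0.le hw hab.symm hac.symm hβN1 hD b3 c3 c1 ic ib b2).trans (hKm (by linarith))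
    · exact (S.opp hθ0.le hw hac.symm hab.symm hβN1 hD c3 b3 b1 ib ic c2).trans (hKm (by linarith))
    · exact (S.near_same hθ0.le hw hbc b3 c3 (Or.inr ⟨ib, ic⟩) b1 c1 b2 c2).trans (hKm (by linarith))

theorem Sys.followers (S : Sys F ι) (htr : TrL F) {V : Set ℂ} (hVo : IsOpen V)
    (hV : IsPathConnected V) {m1 : ℝ} (h0 : DD F V 0 m1) {δ : ℝ} (hδ : 0 < δ) :
    ∃ N0 : ℕ, ∀ N ≥ N0, ∀ c : ι, ¬ S.Fl V c δ N := by
  by_cases hne : Nonempty ι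
  swap
  · exact ⟨0, fun N _ c => (hne ⟨c⟩).elim⟩
  obtain ⟨ε, hε, hgr⟩ := S.growth hne htr
  have hm1 : 0 ≤ m1 := by
    obtain ⟨x, hx⟩ := hV.nonempty
    exact (norm_nonneg _).trans (h0 x hx x hx)
  obtain ⟨n0, hg⟩ := hgr V hVo hV m1 hm1 h0
  set δ1 := min δ 1 with hδ1
  have p1 : 0 < δ1 := by positivity
  obtain ⟨δ2', q2, N1, h1⟩ := S.follow_a p1 (min_le_right _ _) hV h0
  set δ2 := min δ2' δ1 with hδ2
  have p2 : 0 < δ2 := by positivity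
  have p21 : δ2 ≤ 1 := (min_le_right _ _).trans (min_le_right _ _)
  obtain ⟨δ3', q3, N2, h2⟩ := S.follow_b p2 p21 hε hV h0 hg
  set δ3 := min δ3' δ2 with hδ3
  have p3 : 0 < δ3 := by positivity
  obtain ⟨_, _, N3, h3⟩ := S.follow_b p3 ((min_le_right _ _).trans p21) hε hV h0 hg
  have m32 : δ3 ≤ δ2 := min_le_right _ _
  have m21 : δ2 ≤ δ1 := min_le_right _ _
  refine ⟨N1 + N2 + N3, fun N hN c hc => ?_⟩
  have hc := hc.mono (min_le_left δ 1)
  obtain ⟨a, b, hca, hcb, hab⟩ := S.three c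
  have main : ∀ a b, c ≠ a → c ≠ b → a ≠ b → S.Fl V b δ2 N → False := by
    intro a b hca hcb hab hb
    by_cases ha : S.Fl V a δ3 N
    · exact h3 N (by omega) a b c hab hca.symm hcb.symm (hc.mono (m32.trans m21)) (hb.mono m32) (Or.inl ha)
    · exact h2 N (by omega) a b c hab hca.symm hcb.symm (hc.mono m21) hb
        (Or.inr fun h => ha (h.mono (min_le_left _ _)))
  by_cases hb : S.Fl V b δ2 N
  · exact main a b hca hcb hab hb
  by_cases ha : S.Fl V a δ2 N
  · exact main b a hcb hca hab.symm ha
  exact h1 N (by omega) a b c hab hca.symm hcb.symm hc (fun h => ha (h.mono (min_le_left _ _)))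
    (fun h => hb (h.mono (min_le_left _ _)))

/-- static followers -/
theorem Sys.static_followers (S : Sys F ι) (htr : TrL F) {V : Set ℂ} (hVo : IsOpen V)
    (hV : IsPathConnected V) {m1 : ℝ} (h0 : DD F V 0 m1) {ε : ℝ} (hε : 0 < ε) :
    ∃ N0 : ℕ, ∀ N ≥ N0, ∀ c : ι, ∃ x ∈ V, ∀ j ≤ N, ‖(⇑F)^[j] x - x - j * S.A c‖ ≤ ε * N := by
  obtain ⟨η, hη, N1, h1⟩ := S.static hε
  obtain ⟨N2, h2⟩ := S.followers htr hVo hV h0 hη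
  refine ⟨N1 + N2, fun N hN c => ?_⟩
  have := h2 N (by omega) c
  simp only [Sys.Fl] at this
  push Not at this
  obtain ⟨x, hx, hx2⟩ := this
  refine ⟨x, hx, fun j hj => ?_⟩
  simpa using h1 N (by omega) c x hx2 0 j (Nat.zero_le _) hj

theorem symm_it (F : ℂ ≃ₜ ℂ) (n : ℕ) (z : ℂ) : (⇑F.symm)^[n] ((⇑F)^[n] z) = z :=
  (Function.LeftInverse.iterate F.symm_apply_apply n) z

theorem it_symm (F : ℂ ≃ₜ ℂ) (n : ℕ) (z : ℂ) : (⇑F)^[n] ((⇑F.symm)^[n] z) = z :=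
  (Function.LeftInverse.iterate F.apply_symm_apply n) z

/-- the system of the inverse -/
def Sys.inv (S : Sys F ι) : Sys F.symm ι where
  A := fun a => - S.A a
  e := fun a => - S.e a
  C0 := S.C0
  L := S.L
  κ := S.κ
  hC0 := S.hC0
  disp := fun z => by
    have := S.disp (F.symm z)
    rwa [F.apply_symm_apply, norm_sub_rev] at this
  hA := fun a => by rw [norm_neg]; exact S.hA a
  he := fun a => by rw [norm_neg]; exact S.he a
  lat := fun z m n => by
    rw [F.symm_apply_eq, S.lat, F.apply_symm_apply]
  hL := S.hL
  E1 := fun η hη => by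
    obtain ⟨N0, h⟩ := S.E1 η hη
    refine ⟨N0, fun N hN n hn a z => ?_⟩
    have := h N hN n hn a ((⇑F.symm)^[n] z)
    rw [it_symm] at this
    rw [dt_neg_left, ← dt_neg, show -(n * -S.A a - ((⇑F.symm)^[n] z - z)) =
      n * S.A a - (z - (⇑F.symm)^[n] z) by ring, show (n * -S.A a - ((⇑F.symm)^[n] z - z)) =
      -(n * S.A a - (z - (⇑F.symm)^[n] z)) by ring, norm_neg]
    exact this
  E2 := fun N a => by
    obtain ⟨z, hz⟩ := S.E2 N a
    refine ⟨(⇑F)^[N] z, ?_⟩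
    rw [symm_it, dt_neg_left, dt_neg_left, dt_neg, neg_neg, ← dt_neg, neg_sub]
    exact hz
  hκ := S.hκ
  sep := fun a b hab => by
    rw [dt_neg_left, ← dt_neg, show -(-S.A b - -S.A a) = S.A b - S.A a by ring]
    exact S.sep a b hab
  three := S.three

theorem Sys.trL_inv (S : Sys F ι) (h : TrL F) : TrL F.symm := by
  intro U V hU hV hUn hVn
  obtain ⟨n, hn, x, hx, w, hw, hxw⟩ := h V U hV hU hVn hUn
  refine ⟨n, hn, _, hxw, -w, hw.neg, ?_⟩
  rw [S.inv.it_add hw, symm_it, add_neg_cancel_right]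
  exact hx

/-! ## Part 9 -/
theorem log_near {z : ℂ} {l : ℝ} (h : ‖z - 1‖ ≤ l) (hl : l ≤ 1/2) : ‖Complex.log z‖ ≤ 3/2 * l := by
  have := Complex.norm_log_one_add_half_le_self (z := z - 1) (h.trans hl)
  rw [add_sub_cancel] at this
  linarith

theorem pl_cont {X : Type*} [TopologicalSpace X] {s : Set X} (hs : IsPreconnected s)
    {φ g : X → ℂ} (hφ : ContinuousOn φ s) (hg : ∀ x ∈ s, Complex.exp (φ x) = g x) {p : ℂ}
    {l : ℝ} (hp : p ≠ 0) (hl : l ≤ 1/2) (h : ∀ x ∈ s, ‖g x - p‖ ≤ l * ‖p‖) {x y : X}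
    (hx : x ∈ s) (hy : y ∈ s) : ‖φ x - φ y‖ ≤ 3 * l := by
  have hn : ∀ z ∈ s, ‖g z / p - 1‖ ≤ l := by
    intro z hz
    have : g z / p - 1 = (g z - p) / p := by field_simp
    rw [this, norm_div, div_le_iff₀ (norm_pos_iff.2 hp)]; exact h z hz
  have hg0 : ∀ z ∈ s, g z / p ∈ Complex.slitPlane := fun z hz =>
    Or.inl (re_pos_of_near ((hn z hz).trans hl))
  have hgc : ContinuousOn g s := (Complex.continuous_exp.comp_continuousOn hφ).congr
    fun z hz => (hg z hz).symm
  have hk := const_of_exp_one hs (D := fun z => φ z - Complex.log (g z / p) - Complex.log p)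
    ((hφ.sub ((hgc.div_const p).clog hg0)).sub continuousOn_const) (by
      intro z hz
      rw [Complex.exp_sub, Complex.exp_sub, Complex.exp_log (Complex.slitPlane_ne_zero (hg0 z hz)),
        Complex.exp_log hp, hg z hz]
      have : g z ≠ 0 := by rw [← hg z hz]; exact Complex.exp_ne_zero _
      field_simp) hx hy
  have : φ x - φ y = Complex.log (g x / p) - Complex.log (g y / p) := by
    linear_combination hk
  rw [this]
  have h1 := log_near (hn x hx) hl
  have h2 := log_near (hn y hy) hl
  exact (norm_sub_le _ _).trans (by linarith)

theorem seq_log {n : ℕ} {u ζ : ℕ → ℂ} {q : ℂ} (hr : ∀ j ≤ n, 0 < (u j / q).re)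
    (hζ : ∀ j < n, ζ (j+1) = ζ j + Complex.log (u (j+1) / u j)) :
    ζ n = ζ 0 + (Complex.log (u n / q) - Complex.log (u 0 / q)) := by
  have hpos : ∀ j ≤ n, u j / q ≠ 0 := fun j hj h => by
    have := hr j hj; rw [h] at this; simp at this
  have key : ∀ j < n, Complex.log (u (j+1) / u j) = Complex.log (u (j+1) / q) - Complex.log (u j / q) := by
    intro j hj
    rw [← log_div_of (hpos j hj.le) (hpos (j+1) hj)]
    · have h0 : q ≠ 0 := fun h => hpos j hj.le (by simp [h])
      rw [div_div_div_cancel_right₀ h0]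
    · have h1 := abs_lt.1 (abs_arg_lt (hr j hj.le))
      have h2 := abs_lt.1 (abs_arg_lt (hr (j+1) hj))
      rw [abs_lt]; constructor <;> linarith [h1.1, h1.2, h2.1, h2.2]
  have : ∀ j ≤ n, ζ j = ζ 0 + (Complex.log (u j / q) - Complex.log (u 0 / q)) := by
    intro j
    induction j with
    | zero => intro _; simp
    | succ j ih =>
      intro hj
      rw [hζ j hj, ih (by omega), key j hj]; ring
  exact this n le_rfl

/-- Uniform angle estimate for a direction strictly counter-clockwise. -/
def TauP (τ : ℂ) (l : ℝ) : Prop :=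
  ∃ r : ℂ, ‖r‖ = 1 ∧
    (∀ s ∈ Icc (0:ℝ) 1, ∀ w : ℂ, ‖w - ((1 - s) + s * τ)‖ ≤ l → l ≤ (w / r).re) ∧
    ∀ a b : ℂ, ‖a - τ‖ ≤ l → ‖b - 1‖ ≤ l → l ≤ (a / b).arg

theorem TauP.mono {τ : ℂ} {l l' : ℝ} (h : TauP τ l) (hl : l' ≤ l) : TauP τ l' := by
  obtain ⟨r, hr, h1, h2⟩ := h
  exact ⟨r, hr, fun s hs w hw => hl.trans (h1 s hs w (hw.trans hl)),
    fun a b ha hb => hl.trans (h2 a b (ha.trans hl) (hb.trans hl))⟩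

theorem exists_tauP {τ : ℂ} (h : 0 < τ.im) : ∃ l > 0, TauP τ l := by
  have hτ : τ ≠ 0 := fun h0 => by rw [h0] at h; simp at h
  have hτp := norm_pos_iff.2 hτ
  set r0 : ℂ := ‖τ‖ + τ with hr0
  have hr0' : r0 ≠ 0 := fun h0 => by
    have := congrArg Complex.im h0
    simp [hr0] at this; linarith
  have hr0p := norm_pos_iff.2 hr0'
  set r : ℂ := r0 / ‖r0‖ with hr
  have hr1 : ‖r‖ = 1 := by
    rw [hr, norm_div]; simp [hr0p.ne']
  have hre : |τ.re| < ‖τ‖ := by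
    rw [Complex.abs_re_lt_norm]; exact h.ne'
  have hd : ∀ w, (w / r).re = (w.re * r0.re + w.im * r0.im) / ‖r0‖ := by
    intro w
    have e1 : w / r = w * (starRingEnd ℂ) r0 / ‖r0‖ := by
      rw [hr, div_div_eq_mul_div]
      have : r0 * (starRingEnd ℂ) r0 = (‖r0‖:ℂ)^2 := Complex.mul_conj' r0
      have h3 : (‖r0‖:ℂ) ≠ 0 := by exact_mod_cast hr0p.ne'
      rw [div_eq_div_iff hr0' h3]
      linear_combination w * (-this)
    rw [e1, Complex.div_ofReal_re]
    simp
  have d1 : 0 < ((1:ℂ) / r).re := by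
    rw [hd]; apply div_pos _ hr0p
    simp [hr0]; linarith [(abs_lt.1 hre).1]
  have d2 : 0 < (τ / r).re := by
    rw [hd]; apply div_pos _ hr0p
    simp [hr0]
    have : ‖τ‖ ^ 2 = τ.re * τ.re + τ.im * τ.im := by
      rw [Complex.sq_norm, Complex.normSq_apply]
    nlinarith [(abs_lt.1 hre).1]
  set d := min ((1:ℂ) / r).re (τ / r).re with hdd
  have hd0 : 0 < d := lt_min d1 d2
  have harg : 0 < τ.arg := by
    rcases lt_or_eq_of_le (Complex.arg_nonneg_iff.2 h.le) with h1 | h1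
    · exact h1
    · have := Complex.arg_eq_zero_iff.1 h1.symm; linarith [this.2]
  have hc : ContinuousAt (fun p : ℂ × ℂ => (p.1 / p.2).arg) (τ, 1) := by
    have h1 : ContinuousAt (fun p : ℂ × ℂ => p.1 / p.2) (τ, 1) :=
      continuousAt_fst.div continuousAt_snd one_ne_zero
    have h2 : ContinuousAt Complex.arg ((fun p : ℂ × ℂ => p.1 / p.2) (τ, 1)) := by
      apply Complex.continuousAt_arg
      simp only [div_one]
      exact Or.inr h.ne'
    exact ContinuousAt.comp (f := fun p : ℂ × ℂ => p.1 / p.2) h2 h1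
  have hev : ∀ᶠ p : ℂ × ℂ in 𝓝 (τ, 1), τ.arg / 2 < (p.1 / p.2).arg := by
    apply hc.eventually_const_lt
    simp; exact harg
  obtain ⟨δ, hδ, hδ2⟩ := Metric.eventually_nhds_iff.1 hev
  refine ⟨min (d/2) (min (δ/2) (τ.arg/2)), by positivity, r, hr1, ?_, ?_⟩
  · intro s hs w hw
    have hw' : ‖w - ((1 - s) + s * τ)‖ ≤ d/2 := hw.trans (min_le_left _ _)
    refine (min_le_left _ _).trans ?_
    have e : w / r = (1 - s : ℝ) * (1 / r) + (s:ℝ) * (τ / r) + (w - ((1 - s) + s * τ)) / r := by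
      push_cast; ring
    have h3 := (Complex.abs_re_le_norm ((w - ((1 - s) + s * τ)) / r))
    rw [norm_div, hr1, div_one] at h3
    have h4 := abs_le.1 (h3.trans hw')
    rw [e, Complex.add_re, Complex.add_re, Complex.re_ofReal_mul, Complex.re_ofReal_mul]
    have h5 : d ≤ ((1:ℂ) / r).re := min_le_left _ _
    have h6 : d ≤ (τ / r).re := min_le_right _ _
    have := mul_le_mul_of_nonneg_left h5 (by linarith [hs.2] : 0 ≤ 1 - s)
    have := mul_le_mul_of_nonneg_left h6 hs.1
    linarith [h4.1]
  · intro a b ha hb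
    refine (min_le_right _ _).trans ((min_le_right _ _).trans ?_)
    have hl : min (d/2) (min (δ/2) (τ.arg/2)) ≤ δ / 2 :=
      (min_le_right _ _).trans (min_le_left _ _)
    refine (hδ2 (y := (a, b)) ?_).le
    rw [Prod.dist_eq, dist_eq_norm, dist_eq_norm]
    exact max_lt (by linarith) (by linarith)

theorem exists_log_prod {U V : Set ℂ} (hU : Convex ℝ U) (hV : Convex ℝ V) (hUo : IsOpen U)
    (hVo : IsOpen V) (hUn : U.Nonempty) (hVn : V.Nonempty) {g : ℂ × ℂ → ℂ} (hg : Continuous g)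
    (h0 : ∀ p ∈ U ×ˢ V, g p ≠ 0) : ∃ φ : ℂ × ℂ → ℂ, ContinuousOn φ (U ×ˢ V) ∧
      ∀ p ∈ U ×ˢ V, Complex.exp (φ p) = g p := by
  have hc : Convex ℝ (U ×ˢ V) := hU.prod hV
  have := hc.contractibleSpace (hUn.prod hVn)
  have := (hUo.prod hVo).locallyPathConnectedSpace
  obtain ⟨φ, h1, h2⟩ := exists_log (X := (U ×ˢ V : Set (ℂ × ℂ))) (g := fun p => g p)
    (by fun_prop) (fun p => h0 p p.2)
  classical
  refine ⟨fun p => if h : p ∈ U ×ˢ V then φ ⟨p, h⟩ else 0, ?_, ?_⟩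
  · rw [continuousOn_iff_continuous_restrict]
    convert h1 using 1
    ext p
    simp only [Set.restrict_apply, p.2, dif_pos, Subtype.coe_eta]
  · intro p hp
    simp only [hp, dif_pos]
    exact h2 ⟨p, hp⟩

/-! ## Part 10 -/
theorem Sys.final_core (S : Sys F ι) [Finite ι] [Nonempty ι] (v : ℂ) {l0 l c : ℝ} (hl0 : 0 < l0)
    (hl0' : l0 ≤ 1/2) (hl : l = l0 / 20) (htau : ∀ X, ∃ A, TauP ((v - S.A A) / (v - S.A X)) l0)
    (hc0 : 0 < c) (hc : ∀ X, c ≤ ‖v - S.A X‖) {n : ℕ} (hn1 : 1 ≤ n) (hn : 4 * S.C0 ≤ l0 * c * n)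
    {U W : Set ℂ} (hU : Convex ℝ U) (hW : Convex ℝ W) (hUo : IsOpen U) (hWo : IsOpen W)
    (hne : ∀ x ∈ U, ∀ y ∈ W, y ≠ (⇑F)^[n] x)
    (hd : ∀ x ∈ U, ∀ y ∈ W, ‖y - x - n * v‖ ≤ l * c / 3 * n)
    {X Y : ι → ℂ} (hX : ∀ A, X A ∈ U) (hY : ∀ A, Y A ∈ W)
    (hXf : ∀ A, ∀ j ≤ n, ‖(⇑F)^[j] (X A) - X A - j * S.A A‖ ≤ l * c / 3 * n)
    (hYf : ∀ A, ∀ j ≤ n, ‖(⇑F.symm)^[j] (Y A) - Y A + j * S.A A‖ ≤ l * c / 3 * n) : False := by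
  have hnp : (0:ℝ) < n := by exact_mod_cast hn1
  have hl2 : 0 < l := by rw [hl]; positivity
  have hlh : l ≤ 1/2 := by rw [hl]; linarith
  have hcn : 0 < l * c * n := by positivity
  obtain ⟨Φ, hΦc, hΦ, hΦ'⟩ := exists_lift F S.C0 S.hC0 S.disp
  obtain ⟨A0⟩ := (inferInstance : Nonempty ι)
  have hgc : Continuous fun p : ℂ × ℂ => (⇑F.symm)^[n] p.2 - p.1 :=
    ((F.symm.continuous.iterate n).comp continuous_snd).sub continuous_fst
  obtain ⟨φ, hφc, hφ⟩ := exists_log_prod hU hW hUo hWo ⟨_, hX A0⟩ ⟨_, hY A0⟩ hgc (by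
    rintro ⟨x, y⟩ ⟨hx, hy⟩ h
    refine hne x hx y hy ?_
    have : (⇑F.symm)^[n] y = x := sub_eq_zero.1 h
    rw [← this, it_symm])
  have hφ2 : ∀ x ∈ U, ∀ y ∈ W, x + Complex.exp (φ (x, y)) = (⇑F.symm)^[n] y := by
    intro x hx y hy
    rw [hφ (x, y) ⟨hx, hy⟩]; ring
  set Z : ι → ι → ℕ → ℂ := fun A B j => zt F Φ (X A) (φ (X A, Y B)) j with hZ
  set u : ι → ι → ℕ → ℂ := fun A B j => (⇑F)^[j] ((⇑F.symm)^[n] (Y B)) - (⇑F)^[j] (X A) with hu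
  have hue : ∀ A B, ∀ j ≤ n, ‖u A B j - ((n - j) * (v - S.A B) + j * (v - S.A A))‖ ≤ l * c * n := by
    intro A B j hj
    have e1 : (⇑F)^[j] ((⇑F.symm)^[n] (Y B)) = (⇑F.symm)^[n-j] (Y B) := by
      conv_lhs => rw [show n = j + (n - j) by omega, Function.iterate_add_apply, it_symm]
    have h1 := hXf A j hj
    have h2 := hYf B (n - j) (Nat.sub_le _ _)
    have h3 := hd _ (hX A) _ (hY B)
    rw [Nat.cast_sub hj] at h2
    have e2 : u A B j - ((n - j) * (v - S.A B) + j * (v - S.A A)) =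
      (((⇑F.symm)^[n-j] (Y B) - Y B + ((n:ℂ) - j) * S.A B) + (Y B - X A - n * v))
       - ((⇑F)^[j] (X A) - X A - j * S.A A) := by
      simp only [hu]; rw [e1]; ring
    rw [e2]
    have h4 := norm_sub_le (((⇑F.symm)^[n-j] (Y B) - Y B + ((n:ℂ) - j) * S.A B) + (Y B - X A - n * v))
      ((⇑F)^[j] (X A) - X A - j * S.A A)
    have h5 := norm_add_le ((⇑F.symm)^[n-j] (Y B) - Y B + ((n:ℂ) - j) * S.A B) (Y B - X A - n * v)
    linarith
  have hstep : ∀ A B j, 4 * S.C0 ≤ ‖u A B j‖ →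
      Z A B (j+1) = Z A B j + Complex.log (u A B (j+1) / u A B j) := by
    intro A B j h
    exact zt_far hΦ hΦ' (hφ2 _ (hX A) _ (hY B)).symm h
  have hv0 : ∀ A, v - S.A A ≠ 0 := fun A h => by
    have := hc A; rw [h, norm_zero] at this; linarith
  have hn0 : (n:ℂ) ≠ 0 := by exact_mod_cast (by omega : n ≠ 0)
  have hp0 : ∀ A, (n:ℂ) * (v - S.A A) ≠ 0 := fun A => mul_ne_zero hn0 (hv0 A)
  have hpn : ∀ A, c * n ≤ ‖(n:ℂ) * (v - S.A A)‖ := by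
    intro A
    rw [norm_mul, Complex.norm_natCast, mul_comm]
    exact mul_le_mul_of_nonneg_left (hc A) hnp.le
  -- Claim 1
  have c1 : ∀ A B B', ‖Z A B n - Z A B' n‖ ≤ 3 * l := by
    intro A B B'
    refine pl_cont (s := W) hW.isPreconnected (φ := fun y => zt F Φ (X A) (φ (X A, y)) n)
      (g := fun y => y - (⇑F)^[n] (X A)) (p := n * (v - S.A A)) ?_ ?_ (hp0 A) hlh ?_ (hY B) (hY B')
    · have h1 : ContinuousOn (fun y => ((X A, φ (X A, y)) : ℂ × ℂ)) W := by
        refine continuousOn_const.prodMk (hφc.comp (by fun_prop) ?_)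
        intro y hy; exact ⟨hX A, hy⟩
      exact (continuous_zt (F := F) hΦc n).comp_continuousOn h1
    · intro y hy
      rw [exp_zt hΦ, hφ2 _ (hX A) _ hy, it_symm]
    · intro y hy
      have h1 := hXf A n le_rfl
      have h2 := hd _ (hX A) _ hy
      rw [show y - (⇑F)^[n] (X A) - n * (v - S.A A) = (y - X A - n * v) -
        ((⇑F)^[n] (X A) - X A - n * S.A A) by ring]
      have h3 := mul_le_mul_of_nonneg_left (hpn A) hl2.le
      refine (norm_sub_le _ _).trans ?_
      linarith
  have c2 : ∀ A A' B, ‖Z A B 0 - Z A' B 0‖ ≤ 3 * l := by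
    intro A A' B
    refine pl_cont (s := U) hU.isPreconnected (φ := fun x => φ (x, Y B))
      (g := fun x => (⇑F.symm)^[n] (Y B) - x) (p := n * (v - S.A B)) ?_ ?_ (hp0 B) hlh ?_ (hX A) (hX A')
    · refine hφc.comp (by fun_prop) ?_
      intro x hx; exact ⟨hx, hY B⟩
    · intro x hx
      exact hφ (x, Y B) ⟨hx, hY B⟩
    · intro x hx
      have h1 := hYf B n le_rfl
      have h2 := hd _ hx _ (hY B)
      rw [show (⇑F.symm)^[n] (Y B) - x - n * (v - S.A B) = (Y B - x - n * v) +
        ((⇑F.symm)^[n] (Y B) - Y B + n * S.A B) by ring]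
      have h3 := mul_le_mul_of_nonneg_left (hpn B) hl2.le
      refine (norm_add_le _ _).trans ?_
      linarith
  -- normalized estimate
  have hnorm : ∀ A B, ∀ j ≤ n, ‖u A B j / (n * (v - S.A B)) -
      ((1 - ((j / n : ℝ) : ℂ)) + ((j / n : ℝ) : ℂ) * ((v - S.A A) / (v - S.A B)))‖ ≤ l := by
    intro A B j hj
    have e : u A B j / (n * (v - S.A B)) -
      ((1 - ((j / n : ℝ) : ℂ)) + ((j / n : ℝ) : ℂ) * ((v - S.A A) / (v - S.A B)))
      = (u A B j - ((n - j) * (v - S.A B) + j * (v - S.A A))) / (n * (v - S.A B)) := by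
      have := hv0 B
      push_cast
      field_simp
    rw [e, norm_div, div_le_iff₀ (norm_pos_iff.2 (hp0 B))]
    have h3 := mul_le_mul_of_nonneg_left (hpn B) hl2.le
    have := hue A B j hj
    linarith
  have hs : ∀ j ≤ n, (j / n : ℝ) ∈ Icc (0:ℝ) 1 := by
    intro j hj
    refine ⟨by positivity, ?_⟩
    rw [div_le_one hnp]; exact_mod_cast hj
  have hbig : ∀ A B j, l0 ≤ ‖u A B j / (n * (v - S.A B))‖ → 4 * S.C0 ≤ ‖u A B j‖ := by
    intro A B j h
    rw [norm_div, le_div_iff₀ (norm_pos_iff.2 (hp0 B))] at h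
    have := mul_le_mul_of_nonneg_left (hpn B) hl0.le
    linarith
  have c3 : ∀ A, ‖Z A A n - Z A A 0‖ ≤ 3 * l := by
    intro A
    have hk : ∀ j ≤ n, ‖u A A j / (n * (v - S.A A)) - 1‖ ≤ l := by
      intro j hj
      have := hnorm A A j hj
      rwa [div_self (hv0 A), mul_one, sub_add_cancel] at this
    have := seq_log (u := u A A) (ζ := Z A A) (q := n * (v - S.A A)) (n := n)
      (fun j hj => re_pos_of_near ((hk j hj).trans hlh)) (by
        intro j hj
        apply hstep
        apply hbig
        have h1 := hk j hj.le
        have h2 := norm_sub_norm_le (1:ℂ) (u A A j / (n * (v - S.A A)))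
        rw [norm_one, norm_sub_rev] at h2
        linarith)
    rw [this, add_sub_cancel_left]
    have h1 := log_near (hk n le_rfl) hlh
    have h2 := log_near (hk 0 (Nat.zero_le _)) hlh
    exact (norm_sub_le _ _).trans (by linarith)
  have c4 : ∀ B, ∃ A, l0 ≤ (Z A B n).im - (Z A B 0).im := by
    intro B
    obtain ⟨A, r, hr, ht1, ht2⟩ := htau B
    refine ⟨A, ?_⟩
    have hll : l ≤ l0 := by rw [hl]; linarith
    have hk : ∀ j ≤ n, l0 ≤ ((u A B j / (n * (v - S.A B))) / r).re := fun j hj =>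
      ht1 _ (hs j hj) _ ((hnorm A B j hj).trans hll)
    have hk' : ∀ j ≤ n, 0 < (u A B j / (n * (v - S.A B) * r)).re := by
      intro j hj
      rw [← div_div]; exact hl0.trans_le (hk j hj)
    have hne0 : ∀ j ≤ n, u A B j / (n * (v - S.A B) * r) ≠ 0 := fun j hj h => by
      have := hk' j hj; rw [h] at this; simp at this
    have := seq_log (u := u A B) (ζ := Z A B) (q := n * (v - S.A B) * r) (n := n) hk' (by
        intro j hj
        apply hstep
        apply hbig
        have h1 := hk j hj.le
        have h2 := Complex.re_le_norm ((u A B j / (n * (v - S.A B))) / r)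
        rw [norm_div _ r, hr, div_one] at h2
        linarith)
    rw [← log_div_of (hne0 0 (Nat.zero_le _)) (hne0 n le_rfl)] at this
    · have h2 : (Z A B n).im - (Z A B 0).im = (u A B n / (n * (v - S.A B) * r) / (u A B 0 / (n * (v - S.A B) * r))).arg := by
        rw [this, Complex.add_im, Complex.log_im]; ring
      rw [h2]
      have hr0 : r ≠ 0 := by rw [← norm_pos_iff, hr]; exact one_pos
      rw [← div_div _ _ r, ← div_div (u A B 0) _ r, div_div_div_cancel_right₀ hr0]
      have h3 := hnorm A B n le_rfl
      have h4 := hnorm A B 0 (Nat.zero_le _)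
      rw [div_self hnp.ne'] at h3
      apply ht2
      · refine le_trans (le_of_eq ?_) (h3.trans hll)
        push_cast; ring_nf
      · refine le_trans (le_of_eq ?_) (h4.trans hll)
        simp
    · have h1 := abs_lt.1 (abs_arg_lt (hk' n le_rfl))
      have h2 := abs_lt.1 (abs_arg_lt (hk' 0 (Nat.zero_le _)))
      rw [abs_lt]; constructor <;> linarith [h1.1, h1.2, h2.1, h2.2]
  obtain ⟨B, hB⟩ := Finite.exists_max fun B => (Z B B n).im
  obtain ⟨A, hA⟩ := c4 B
  have k1 := hB A
  have k2 := abs_le.1 ((Complex.abs_im_le_norm _).trans (c1 A A B))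
  have k3 := abs_le.1 ((Complex.abs_im_le_norm _).trans (c2 A B B))
  have k4 := abs_le.1 ((Complex.abs_im_le_norm _).trans (c3 B))
  rw [Complex.sub_im] at k2 k3 k4
  rw [hl] at k2 k3 k4
  linarith [k2.1, k2.2, k3.1, k3.2, k4.1, k4.2]

theorem Sys.final (S : Sys F ι) [Finite ι] [Nonempty ι] (htr : TrL F) (v : ℂ)
    (hv : ∀ X, ∃ A, 0 < ((v - S.A A) / (v - S.A X)).im) (x0 y0 : ℂ) {r : ℝ} (hr : 0 < r) :
    ∃ n0 : ℕ, ∀ n ≥ n0, ∀ a, IsLat a → ‖a - n * v‖ ≤ 2 →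
      ∃ x ∈ ball x0 r, (⇑F)^[n] x - a ∈ ball y0 r := by
  choose τ hτ using hv
  have h1 : ∀ X, ∃ l > 0, TauP ((v - S.A (τ X)) / (v - S.A X)) l := fun X => exists_tauP (hτ X)
  choose L hL hL2 using h1
  obtain ⟨X1, hX1⟩ := Finite.exists_min L
  obtain ⟨X2, hX2⟩ := Finite.exists_min fun X => ‖v - S.A X‖
  set c := ‖v - S.A X2‖ with hc
  have hc0 : 0 < c := by
    rw [hc, norm_pos_iff]; intro h
    have := hτ X2; rw [h] at this; simp at this
  set l0 := min (L X1) (1/2) with hl0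
  have hl0p : 0 < l0 := lt_min (hL X1) (by norm_num)
  set l := l0 / 20 with hl
  have hε : 0 < l * c / 3 := by positivity
  have hDD : ∀ (G : ℂ ≃ₜ ℂ) (z : ℂ), DD G (ball z r) 0 (2 * r) := by
    intro G z x hx y hy
    simp only [Function.iterate_zero, id_eq]
    rw [← dist_eq_norm]
    have h1 := mem_ball.1 hx
    have h2 := mem_ball.1 hy
    have := dist_triangle_right x y z
    linarith
  have hpc : ∀ z : ℂ, IsPathConnected (ball z r) := fun z =>
    (convex_ball z r).isPathConnected ⟨z, mem_ball_self hr⟩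
  obtain ⟨N1, hN1⟩ := S.static_followers htr isOpen_ball (hpc x0) (hDD F x0) hε
  obtain ⟨N2, hN2⟩ := S.inv.static_followers (S.trL_inv htr) isOpen_ball (hpc y0) (hDD F.symm y0) hε
  obtain ⟨N3, hN3⟩ := exists_nat_ge (4 * S.C0 / (l0 * c))
  obtain ⟨N4, hN4⟩ := exists_nat_ge ((2 + 2 * r + ‖y0 - x0‖) / (l * c / 3))
  refine ⟨N1 + N2 + N3 + N4 + 1, fun n hn a ha hav => ?_⟩
  by_contra hcon
  push Not at hcon
  have q3 : 4 * S.C0 ≤ l0 * c * n := by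
    rw [div_le_iff₀ (by positivity)] at hN3
    have : (N3:ℝ) ≤ n := by exact_mod_cast (by omega)
    have := mul_le_mul_of_nonneg_right this (by positivity : 0 ≤ l0 * c)
    linarith
  have q4 : 2 + 2 * r + ‖y0 - x0‖ ≤ l * c / 3 * n := by
    rw [div_le_iff₀ (by positivity)] at hN4
    have : (N4:ℝ) ≤ n := by exact_mod_cast (by omega)
    have := mul_le_mul_of_nonneg_right this hε.le
    linarith
  choose X hX hXf using hN1 n (by omega)
  choose Y hY hYf using hN2 n (by omega)
  have hba : ∀ y, y ∈ ball (y0 + a) r ↔ y - a ∈ ball y0 r := by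
    intro y
    rw [mem_ball, mem_ball, dist_eq_norm, dist_eq_norm, show y - (y0 + a) = y - a - y0 by ring]
  refine S.final_core v hl0p (min_le_right _ _) hl
    (fun X => ⟨τ X, (hL2 X).mono ((min_le_left _ _).trans (hX1 X))⟩) hc0 hX2 (n := n) (by omega) q3
    (convex_ball x0 r) (convex_ball (y0 + a) r) isOpen_ball isOpen_ball ?_ ?_ hX
    (Y := fun A => Y A + a) ?_ hXf ?_
  · rintro x hx y hy rfl
    exact hcon x hx ((hba _).1 hy)
  · intro x hx y hy
    have h1 := mem_ball.1 hx
    have h2 := mem_ball.1 hy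
    rw [dist_eq_norm] at h1 h2
    rw [show y - x - n * v = (y - (y0 + a)) - (x - x0) + ((y0 - x0) + (a - n * v)) by ring]
    have h3 := norm_add_le ((y - (y0 + a)) - (x - x0)) ((y0 - x0) + (a - n * v))
    have h4 := norm_sub_le (y - (y0 + a)) (x - x0)
    have h5 := norm_add_le (y0 - x0) (a - n * v)
    linarith
  · intro A
    rw [hba, add_sub_cancel_right]; exact hY A
  · intro A j hj
    rw [S.inv.it_add ha]
    have h1 := hYf A j hj
    have e : S.inv.A A = - S.A A := rfl
    rw [e] at h1
    rwa [show (⇑F.symm)^[j] (Y A) + a - (Y A + a) + j * S.A A = (⇑F.symm)^[j] (Y A) - Y A - j * - S.A A by ring]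

/-! ## Part 11 -/
/-- Commutation with the integer translations. -/
def LatC (F : ℂ ≃ₜ ℂ) : Prop := ∀ (z : ℂ) (m n : ℤ), F (z + ⟨m, n⟩) = F z + ⟨m, n⟩

/-- The rotation set, in complex coordinates. -/
def rotC (F : ℂ ≃ₜ ℂ) : Set ℂ := {v | ∃ (z : ℕ → ℂ) (n : ℕ → ℕ), Tendsto n atTop atTop ∧
    Tendsto (fun k => ((⇑F)^[n k] (z k) - z k) / (n k : ℂ)) atTop (𝓝 v)}

theorem LatC.it (h : LatC F) (z : ℂ) (m n : ℤ) (j : ℕ) :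
    (⇑F)^[j] (z + ⟨m, n⟩) = (⇑F)^[j] z + ⟨m, n⟩ := by
  induction j with
  | zero => rfl
  | succ j ih => rw [Function.iterate_succ_apply', Function.iterate_succ_apply', ih, h]

theorem max_per {g : ℂ → ℝ} (hg : Continuous g) (hp : ∀ z (m n : ℤ), g (z + ⟨m, n⟩) = g z) :
    ∃ z0, ∀ z, g z ≤ g z0 := by
  obtain ⟨z0, -, h⟩ := (isCompact_closedBall (0:ℂ) 1).exists_isMaxOn ⟨0, by simp⟩ hg.continuousOn
  refine ⟨z0, fun z => ?_⟩
  obtain ⟨m, n, hmn⟩ := exists_lat z 0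
  rw [← hp z m n]
  exact h (by simpa using hmn)

theorem LatC.disp (h : LatC F) : ∃ C0 : ℝ, 1 ≤ C0 ∧ ∀ z, ‖F z - z‖ ≤ C0 := by
  obtain ⟨z0, hz⟩ := max_per (g := fun z => ‖F z - z‖)
    (by have := F.continuous; fun_prop) (fun z m n => by simp only [h z m n]; congr 1; ring)
  exact ⟨max 1 ‖F z0 - z0‖, le_max_left _ _, fun z => (hz z).trans (le_max_right _ _)⟩

theorem disp_it' {C0 : ℝ} (hd : ∀ z, ‖F z - z‖ ≤ C0) (z : ℂ) (j : ℕ) :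
    ‖(⇑F)^[j] z - z‖ ≤ j * C0 := by
  induction j with
  | zero => simp
  | succ j ih =>
    rw [Function.iterate_succ_apply']
    have := hd ((⇑F)^[j] z)
    have h : F ((⇑F)^[j] z) - z = (F ((⇑F)^[j] z) - (⇑F)^[j] z) + ((⇑F)^[j] z - z) := by ring
    rw [h]
    refine (norm_add_le _ _).trans ?_
    push_cast; linarith

theorem norm_rot_le {C0 : ℝ} (h1 : 1 ≤ C0) (hd : ∀ z, ‖F z - z‖ ≤ C0) (z : ℂ) (n : ℕ) :
    ‖((⇑F)^[n] z - z) / (n : ℂ)‖ ≤ C0 := by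
  rw [norm_div, Complex.norm_natCast]
  refine div_le_of_le_mul₀ (by positivity) (by linarith) ?_
  rw [mul_comm]; exact disp_it' hd z n

theorem rotC_norm {C0 : ℝ} (h1 : 1 ≤ C0) (hd : ∀ z, ‖F z - z‖ ≤ C0) {A : ℂ} (hA : A ∈ rotC F) :
    ‖A‖ ≤ C0 := by
  obtain ⟨z, n, -, ht⟩ := hA
  exact le_of_tendsto ht.norm (Eventually.of_forall fun k => norm_rot_le h1 hd _ _)

theorem LatC.exists_far (h : LatC F) {C0 : ℝ} (h1 : 1 ≤ C0) (hd : ∀ z, ‖F z - z‖ ≤ C0) (c : ℂ) :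
    ∃ A ∈ rotC F, (∀ w ∈ rotC F, ‖w - c‖ ≤ ‖A - c‖) ∧ ∀ η : ℝ, 0 < η → ∀ᶠ N : ℕ in atTop,
      ∀ n ≤ N, ∀ z, ‖(⇑F)^[n] z - z - n * c‖ ≤ n * ‖A - c‖ + η * N := by
  have hm : ∀ n : ℕ, ∃ z0, ∀ z, ‖(⇑F)^[n] z - z - n * c‖ ≤ ‖(⇑F)^[n] z0 - z0 - n * c‖ := by
    intro n
    refine max_per (g := fun z => ‖(⇑F)^[n] z - z - n * c‖) ?_ ?_
    · have := F.continuous.iterate n; fun_prop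
    · intro z p q
      simp only [h.it z p q n]; congr 1; ring
  choose z0 hz0 using hm
  set D : ℕ → ℝ := fun n => ‖(⇑F)^[n] (z0 n) - z0 n - n * c‖ with hD
  have hsub : Subadditive D := by
    intro m n
    have e : (⇑F)^[m+n] (z0 (m+n)) - z0 (m+n) - ((m+n : ℕ):ℂ) * c =
      ((⇑F)^[m] ((⇑F)^[n] (z0 (m+n))) - (⇑F)^[n] (z0 (m+n)) - m * c) +
      ((⇑F)^[n] (z0 (m+n)) - z0 (m+n) - n * c) := by
      rw [Function.iterate_add_apply]; push_cast; ring
    simp only [hD]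
    rw [e]
    exact (norm_add_le _ _).trans (add_le_add (hz0 m _) (hz0 n _))
  have hbdd : BddBelow (range fun n : ℕ => D n / n) := ⟨0, by
    rintro _ ⟨n, rfl⟩
    simp only [hD]; positivity⟩
  have hlim := hsub.tendsto_lim hbdd
  set R := hsub.lim with hR
  have hnd : ∀ (n : ℕ) (z : ℂ), 1 ≤ n →
      ‖((⇑F)^[n] z - z) / (n : ℂ) - c‖ = ‖(⇑F)^[n] z - z - n * c‖ / n := by
    intro n z hn
    have : (n:ℂ) ≠ 0 := by exact_mod_cast (by omega : n ≠ 0)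
    rw [← Complex.norm_natCast n, ← norm_div]
    congr 1
    field_simp
  obtain ⟨A, -, φ, hφ, hA⟩ := (isCompact_closedBall (0:ℂ) C0).tendsto_subseq
    (x := fun n => ((⇑F)^[n] (z0 n) - z0 n) / (n : ℂ)) (fun n => by
      rw [mem_closedBall, dist_zero_right]; exact norm_rot_le h1 hd _ _)
  have hAR : ‖A - c‖ = R := by
    refine tendsto_nhds_unique (hA.sub_const c).norm ?_
    refine (hlim.comp hφ.tendsto_atTop).congr' ?_
    filter_upwards [hφ.tendsto_atTop.eventually_ge_atTop 1] with n hn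
    simp only [Function.comp_apply]
    rw [hnd _ _ hn]
  refine ⟨A, ⟨fun k => z0 (φ k), φ, hφ.tendsto_atTop, hA⟩, ?_, ?_⟩
  · rintro w ⟨z, n, hn, ht⟩
    rw [hAR]
    refine le_of_tendsto_of_tendsto (ht.sub_const c).norm (hlim.comp hn) ?_
    filter_upwards [hn.eventually_ge_atTop 1] with k hk
    simp only [Function.comp_apply]
    rw [hnd _ _ hk]
    exact div_le_div_of_nonneg_right (hz0 _ _) (by positivity)
  · intro η hη
    rw [hAR]
    have hev := hlim.eventually_le_const (by linarith : R < R + η)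
    obtain ⟨n1, hn1⟩ := eventually_atTop.1 hev
    obtain ⟨N1, hN1⟩ := exists_nat_ge ((n1 * (C0 + ‖c‖)) / η)
    rw [div_le_iff₀ hη] at hN1
    filter_upwards [eventually_ge_atTop N1] with N hN n hn z
    have hNN : (N1:ℝ) ≤ N := by exact_mod_cast hN
    have hnN : (n:ℝ) ≤ N := by exact_mod_cast hn
    have hR0 : 0 ≤ R := by rw [← hAR]; positivity
    have k1 := mul_le_mul_of_nonneg_right hNN hη.le
    by_cases hc : n1 ≤ n ∧ 1 ≤ n
    · have h2 := hn1 n hc.1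
      have hnp : (0:ℝ) < n := by exact_mod_cast hc.2
      rw [div_le_iff₀ hnp] at h2
      have h3 := hz0 n z
      have := mul_le_mul_of_nonneg_left hnN hη.le
      simp only [hD] at h2
      nlinarith
    · have hnn : (n:ℝ) ≤ n1 := by
        have : n ≤ n1 := by by_contra hh; exact hc ⟨by omega, by omega⟩
        exact_mod_cast this
      have h2 := disp_it' hd z n
      have h3 := norm_sub_le ((⇑F)^[n] z - z) (n * c)
      rw [norm_mul, Complex.norm_natCast] at h3
      have h4 := mul_le_mul_of_nonneg_right hnn (by positivity : 0 ≤ C0 + ‖c‖)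
      have h5 : 0 ≤ n * R := by positivity
      nlinarith

theorem LatC.e2 (h : LatC F) {C0 : ℝ} (h1 : 1 ≤ C0) (hd : ∀ z, ‖F z - z‖ ≤ C0) {A e : ℂ}
    (he : ‖e‖ = 1) (hA : A ∈ rotC F) (N : ℕ) : ∃ z, N * dt e A ≤ dt e ((⇑F)^[N] z - z) := by
  have hdc : Continuous fun w : ℂ => dt e w := by
    unfold dt; fun_prop
  obtain ⟨z0, hz0⟩ := max_per (g := fun z => dt e ((⇑F)^[N] z - z))
    (hdc.comp (by have := F.continuous.iterate N; fun_prop))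
    (fun z m n => by simp only [h.it z m n N]; congr 1; ring)
  refine ⟨z0, ?_⟩
  rcases Nat.eq_zero_or_pos N with rfl | hN
  · simp [dt]
  set M := dt e ((⇑F)^[N] z0 - z0) with hM
  have hNp : (0:ℝ) < N := by exact_mod_cast hN
  have hq : ∀ (q : ℕ) z, dt e ((⇑F)^[q * N] z - z) ≤ q * M := by
    intro q
    induction q with
    | zero => intro z; simp [dt]
    | succ q ih =>
      intro z
      rw [show (q + 1) * N = N + q * N by ring, Function.iterate_add_apply]
      rw [show (⇑F)^[N] ((⇑F)^[q * N] z) - z = ((⇑F)^[N] ((⇑F)^[q * N] z) - (⇑F)^[q * N] z) +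
        ((⇑F)^[q * N] z - z) by ring, dt_add]
      have := hz0 ((⇑F)^[q * N] z)
      have := ih z
      push_cast; linarith
  have hall : ∀ (n : ℕ) z, dt e ((⇑F)^[n] z - z) ≤ n * (M / N) + (|M| + N * C0) := by
    intro n z
    have hn := Nat.div_add_mod' n N
    have hr := Nat.mod_lt n hN
    set q := n / N
    set r := n % N
    have h2 := hq q z
    have h3 := disp_it' hd ((⇑F)^[q * N] z) r
    have h4 := dt_le (w := (⇑F)^[r] ((⇑F)^[q * N] z) - (⇑F)^[q * N] z) he
    have hrN : (r:ℝ) ≤ N := by exact_mod_cast hr.le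
    have e1 : (⇑F)^[n] z - z = ((⇑F)^[r] ((⇑F)^[q * N] z) - (⇑F)^[q * N] z) +
        ((⇑F)^[q * N] z - z) := by
      rw [← hn, add_comm (q * N) r, Function.iterate_add_apply]; ring
    rw [e1, dt_add]
    have e2 : (n:ℝ) * (M / N) = q * M + r * (M / N) := by
      rw [← hn]; push_cast; field_simp
    rw [e2]
    have h5 : |(r:ℝ) * (M / N)| ≤ |M| := by
      rw [abs_mul, abs_div, Nat.abs_cast, Nat.abs_cast, mul_div_assoc', div_le_iff₀ hNp]
      rw [mul_comm]; exact mul_le_mul_of_nonneg_left hrN (abs_nonneg _)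
    have h6 := (abs_le.1 h5).1
    have h7 := mul_le_mul_of_nonneg_right hrN (by linarith : 0 ≤ C0)
    linarith
  obtain ⟨z, n, hn, ht⟩ := hA
  have hlim : dt e A ≤ M / N + 0 := by
    refine le_of_tendsto_of_tendsto ((hdc.tendsto A).comp ht)
      (tendsto_const_nhds.add ((tendsto_const_div_atTop_nhds_zero_nat (|M| + N * C0)).comp hn)) ?_
    filter_upwards [hn.eventually_ge_atTop 1] with k hk
    have hkp : (0:ℝ) < n k := by exact_mod_cast hk
    have h2 := hall (n k) (z k)
    have e1 : ((⇑F)^[n k] (z k) - z k) / (n k : ℂ) = ((n k : ℝ)⁻¹ : ℝ) * ((⇑F)^[n k] (z k) - z k) := by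
      push_cast; rw [div_eq_inv_mul]
    simp only [Function.comp_apply]
    rw [e1, dt_real, inv_mul_le_iff₀ hkp, mul_add, mul_div_cancel₀ _ hkp.ne']
    exact h2
  rw [add_zero, le_div_iff₀ hNp] at hlim
  linarith

/-! ## Part 12 -/
theorem dt_comm (e w : ℂ) : dt e w = dt w e := by simp [dt]; ring

theorem norm_sq_lin (e w : ℂ) (he : ‖e‖ = 1) (s : ℝ) :
    ‖(s:ℂ) * e - w‖ ^ 2 = s ^ 2 - 2 * s * dt e w + ‖w‖ ^ 2 := by
  have h2 : e.re^2 + e.im^2 = 1 := by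
    have := Complex.sq_norm e
    rw [he, Complex.normSq_apply] at this; nlinarith
  rw [Complex.sq_norm, Complex.sq_norm, Complex.normSq_apply, Complex.normSq_apply, dt]
  simp
  linear_combination s^2 * h2

theorem dt_self (e : ℂ) (he : ‖e‖ = 1) : dt e e = 1 := by
  have := Complex.sq_norm e
  rw [he, Complex.normSq_apply] at this; rw [dt]; linarith

theorem e1_alg {e w : ℂ} (he : ‖e‖ = 1) {a b : ℝ} (ha : 0 ≤ a) (hb : 0 ≤ b) (hw : ‖w‖ ≤ a + b) :
    0 ≤ dt e (a * e - w) + b ∧ ‖(a:ℂ) * e - w‖ ^ 2 ≤ 4 * (a + b) * (dt e (a * e - w) + b) + 2 * b ^ 2 := by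
  have h1 := dt_le (w := w) he
  have h2 : dt e (a * e - w) = a - dt e w := by rw [dt_sub, dt_real, dt_self e he, mul_one]
  have h3 := norm_sq_lin e w he a
  have h4 : ‖w‖^2 ≤ (a + b)^2 := pow_le_pow_left₀ (norm_nonneg _) hw 2
  have h5 := norm_sq_lin e w he (a + b)
  have h6 := sq_nonneg ‖((a+b : ℝ):ℂ) * e - w‖
  refine ⟨by rw [h2]; linarith, ?_⟩
  rw [h2, h3]
  nlinarith [mul_nonneg (add_nonneg ha hb) (by linarith : 0 ≤ a + b - dt e w)]

theorem exists_two (p q : ℂ) : ∃ u : ℂ, u ≠ 0 ∧ dt u p ≤ 0 ∧ dt u q ≤ 0 := by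
  by_cases hp : p = 0
  · by_cases hq : q = 0
    · exact ⟨1, one_ne_zero, by simp [hp, dt], by simp [hq, dt]⟩
    · refine ⟨-q, neg_ne_zero.2 hq, by simp [hp, dt], ?_⟩
      simp only [dt, Complex.neg_re, Complex.neg_im]
      nlinarith [sq_nonneg q.re, sq_nonneg q.im]
  · have h0 : dt (Complex.I * p) p = 0 := by simp [dt]; ring
    rcases le_total (dt (Complex.I * p) q) 0 with h | h
    · exact ⟨_, mul_ne_zero Complex.I_ne_zero hp, h0.le, h⟩
    · refine ⟨-(Complex.I * p), neg_ne_zero.2 (mul_ne_zero Complex.I_ne_zero hp), ?_, ?_⟩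
      · rw [dt_neg_left, h0, neg_zero]
      · rw [dt_neg_left]; linarith

theorem LatC.exists_sys (h : LatC F) {v : ℂ} {r : ℝ} (hr : 0 < r) (hb : ball v r ⊆ rotC F) :
    ∃ (ι : Type) (_ : Finite ι) (_ : Nonempty ι) (S : Sys F ι),
      ∀ X, ∃ A, 0 < ((v - S.A A) / (v - S.A X)).im := by
  obtain ⟨C0, hC, hd⟩ := h.disp
  have hvC : ‖v‖ ≤ C0 := rotC_norm hC hd (hb (mem_ball_self hr))
  set t : ℝ := 8 * C0 ^ 2 / r with ht
  have htp : 0 < t := by positivity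
  have htr : t * r = 8 * C0 ^ 2 := by rw [ht]; field_simp
  have hfar := fun u : ℂ => h.exists_far hC hd (v - t * u)
  choose A hAr hAf hAe using hfar
  have hAC : ∀ u, ‖A u‖ ≤ C0 := fun u => rotC_norm hC hd (hAr u)
  have hR : ∀ u : ℂ, ‖u‖ = 1 → t + r / 2 ≤ ‖A u - (v - t * u)‖ := by
    intro u hu
    have h1 := hAf u (v + ((r/2 : ℝ):ℂ) * u) (hb (by
      rw [mem_ball, dist_eq_norm, add_sub_cancel_left, norm_mul, hu, mul_one, Complex.norm_real,
        Real.norm_of_nonneg (by positivity)]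
      linarith))
    rw [show v + ((r/2 : ℝ):ℂ) * u - (v - t * u) = ((t + r/2 : ℝ):ℂ) * u by push_cast; ring, norm_mul,
      hu, mul_one, Complex.norm_real, Real.norm_of_nonneg (by positivity)] at h1
    exact h1
  have hpos1 : ∀ u : ℂ, ‖u‖ = 1 → r / 4 ≤ dt u (A u - v) := by
    intro u hu
    have h1 := hR u hu
    have h2 := pow_le_pow_left₀ (by positivity) h1 2
    have h3 := norm_sq_lin u (-(A u - v)) hu t
    rw [show (t:ℂ) * u - -(A u - v) = A u - (v - t * u) by ring, dt_neg, norm_neg] at h3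
    have h4 : ‖A u - v‖ ≤ 2 * C0 := (norm_sub_le _ _).trans (by linarith [hAC u])
    have h5 := pow_le_pow_left₀ (norm_nonneg _) h4 2
    have h6 : t * (r / 4) ≤ t * dt u (A u - v) := by nlinarith
    exact le_of_mul_le_mul_left h6 htp
  set δ : ℝ := r / (16 * C0) with hδ
  have hδp : 0 < δ := by positivity
  obtain ⟨T, hTs, hTf, hTc⟩ := (isCompact_sphere (0:ℂ) 1).finite_cover_balls hδp
  have hT1 : ∀ u ∈ T, ‖u‖ = 1 := fun u hu => by simpa using hTs hu
  have hpos : ∀ u : ℂ, u ≠ 0 → ∃ u' ∈ T, 0 < dt u (A u' - v) := by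
    intro u hu
    have hup := norm_pos_iff.2 hu
    have hn1 : ‖u / ‖u‖‖ = 1 := by rw [norm_div]; simp [hup.ne']
    have hm : u / ‖u‖ ∈ sphere (0:ℂ) 1 := by simpa using hn1
    have := hTc hm
    simp only [mem_iUnion, exists_prop] at this
    obtain ⟨u', hu', hb'⟩ := this
    refine ⟨u', hu', ?_⟩
    rw [mem_ball, dist_eq_norm] at hb'
    have h1 := hpos1 u' (hT1 u' hu')
    set w := A u' - v with hw
    have h4 : ‖w‖ ≤ 2 * C0 := (norm_sub_le _ _).trans (by linarith [hAC u'])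
    have h2 : |dt (u / ‖u‖ - u') w| ≤ δ * (2 * C0) := by
      have hcs : |dt (u / ‖u‖ - u') w| ≤ ‖u / ‖u‖ - u'‖ * ‖w‖ := by
        generalize u / (‖u‖:ℂ) - u' = q
        apply abs_le_of_sq_le_sq
        · rw [mul_pow, Complex.sq_norm, Complex.sq_norm, Complex.normSq_apply, Complex.normSq_apply, dt]
          nlinarith [sq_nonneg (q.re * w.im - q.im * w.re)]
        · positivity
      exact hcs.trans (mul_le_mul hb'.le h4 (norm_nonneg _) hδp.le)
    have h3 : δ * (2 * C0) = r / 8 := by rw [hδ]; field_simp; norm_num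
    rw [h3] at h2
    have h5 : dt (u / ‖u‖ - u') w = dt u w / ‖u‖ - dt u' w := by
      simp only [dt, Complex.sub_re, Complex.sub_im, Complex.div_ofReal_re, Complex.div_ofReal_im]
      ring
    rw [h5] at h2
    have h6 := (abs_le.1 h2).1
    have h7 : 0 < dt u w / ‖u‖ := by linarith
    exact (div_pos_iff_of_pos_right hup).1 h7
  -- index type
  set Q : Set ℂ := A '' T with hQ
  have hQf : Q.Finite := hTf.image A
  have : Finite Q := hQf
  have hu : ∀ a : Q, ∃ u ∈ T, A u = a := fun a => a.2
  choose U hUT hUA using hu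
  have hposQ : ∀ u : ℂ, u ≠ 0 → ∃ a : Q, 0 < dt u (a - v) := by
    intro u hu
    obtain ⟨u', hu', hp⟩ := hpos u hu
    exact ⟨⟨A u', u', hu', rfl⟩, hp⟩
  have hne : Nonempty Q := (hposQ 1 one_ne_zero).nonempty
  set R : Q → ℝ := fun a => ‖(a:ℂ) - (v - t * U a)‖ with hRdef
  have hRp : ∀ a, 0 < R a := by
    intro a
    have := hR (U a) (hT1 _ (hUT a))
    rw [hUA] at this
    simp only [hRdef]
    linarith
  set e : Q → ℂ := fun a => ((a:ℂ) - (v - t * U a)) / R a with hedef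
  have he : ∀ a, ‖e a‖ = 1 := by
    intro a
    simp only [hedef]
    rw [norm_div, Complex.norm_real, Real.norm_of_nonneg (hRp a).le]
    exact div_self (hRp a).ne'
  have heA : ∀ a : Q, (a:ℂ) = (v - t * U a) + R a * e a := by
    intro a
    have : (R a : ℂ) ≠ 0 := by exact_mod_cast (hRp a).ne'
    simp only [hedef]
    field_simp; ring
  have hRb : ∀ a, R a ≤ 2 * C0 + t := by
    intro a
    have h1 := norm_sub_le (a:ℂ) (v - t * U a)
    have h2 := norm_sub_le v (t * U a)
    rw [norm_mul, hT1 _ (hUT a), mul_one, Complex.norm_real, Real.norm_of_nonneg htp.le] at h2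
    have h3 : ‖(a:ℂ)‖ ≤ C0 := by rw [← hUA]; exact hAC _
    simp only [hRdef]
    linarith
  have hsep : ∀ a b : Q, a ≠ b → 0 < dt (e b) ((b:ℂ) - a) := by
    intro a b hab
    have h1 : ‖(a:ℂ) - (v - t * U b)‖ ≤ R b := by
      have := hAf (U b) a (by rw [← hUA a]; exact hAr _)
      rwa [hUA b] at this
    have h2 := norm_sq_lin (e b) ((a:ℂ) - (v - t * U b)) (he b) (R b)
    have e1 : (R b : ℂ) * e b - ((a:ℂ) - (v - t * U b)) = (b:ℂ) - a := by
      rw [heA b]; ring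
    have h3 : dt (e b) ((b:ℂ) - a) = R b - dt (e b) ((a:ℂ) - (v - t * U b)) := by
      rw [← e1, dt_sub, dt_real, dt_self _ (he b), mul_one]
    rw [e1] at h2
    have h4 : 0 < ‖(b:ℂ) - a‖ := by
      rw [norm_pos_iff, sub_ne_zero]; exact fun hh => hab (Subtype.ext hh.symm)
    have h5 := pow_le_pow_left₀ (norm_nonneg _) h1 2
    rw [h3]
    have h6 : 0 < 2 * R b * (R b - dt (e b) ((a:ℂ) - (v - t * U b))) := by nlinarith [sq_pos_of_pos h4]
    exact (mul_pos_iff_of_pos_left (by linarith [hRp b])).1 h6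
  have hκ : ∃ κ > 0, ∀ a b : Q, a ≠ b → κ ≤ dt (e b) ((b:ℂ) - a) := by
    classical
    obtain ⟨⟨a0, b0⟩, hm⟩ := Finite.exists_min fun p : Q × Q =>
      if p.1 = p.2 then (1:ℝ) else dt (e p.2) ((p.2:ℂ) - p.1)
    refine ⟨_, ?_, fun a b hab => (hm (a, b)).trans (by simp [hab])⟩
    simp only
    split_ifs with hh
    · exact one_pos
    · exact hsep _ _ hh
  obtain ⟨κ, hκ0, hκ⟩ := hκ
  have hthree : ∀ a : Q, ∃ b c : Q, a ≠ b ∧ a ≠ c ∧ b ≠ c := by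
    intro a
    obtain ⟨u, hu0, hu1, -⟩ := exists_two ((a:ℂ) - v) ((a:ℂ) - v)
    obtain ⟨b, hb⟩ := hposQ u hu0
    obtain ⟨w, hw0, hw1, hw2⟩ := exists_two ((a:ℂ) - v) ((b:ℂ) - v)
    obtain ⟨c, hc⟩ := hposQ w hw0
    refine ⟨b, c, ?_, ?_, ?_⟩
    · rintro rfl; linarith
    · rintro rfl; linarith
    · rintro rfl; linarith
  set L : ℝ := 4 * (2 * C0 + t + 1) with hL
  have hE1 : ∀ η : ℝ, 0 < η → ∃ N0 : ℕ, ∀ N ≥ N0, ∀ n ≤ N, ∀ (a : Q) (z : ℂ),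
    0 ≤ dt (e a) (n * (a:ℂ) - ((⇑F)^[n] z - z)) + η * N ∧
    ‖(n * (a:ℂ) - ((⇑F)^[n] z - z) : ℂ)‖ ^ 2 ≤
      L * N * (dt (e a) (n * (a:ℂ) - ((⇑F)^[n] z - z)) + η * N) := by
    intro η' hη'
    set η := min (η' / 2) 1 with hη
    have hηp : 0 < η := lt_min (by linarith) one_pos
    have hη1 : η ≤ 1 := min_le_right _ _
    have hη2 : 2 * η ≤ η' := by have := min_le_left (η'/2) 1; linarith
    have hev : ∀ᶠ N : ℕ in atTop, ∀ a : Q, ∀ n ≤ N, ∀ z,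
        ‖(⇑F)^[n] z - z - n * (v - t * U a)‖ ≤ n * R a + η * N := by
      rw [eventually_all]
      intro a
      have := hAe (U a) η hηp
      rwa [hUA a] at this
    obtain ⟨N0, hN0⟩ := eventually_atTop.1 hev
    refine ⟨N0, fun N hN n hn a z => ?_⟩
    have hnN : (n:ℝ) ≤ N := by exact_mod_cast hn
    have hN0' : (0:ℝ) ≤ N := by positivity
    have h1 := hN0 N hN a n hn z
    have hRa := (hRp a).le
    obtain ⟨k1, k2⟩ := e1_alg (he a) (a := n * R a) (b := η * N) (by positivity) (by positivity) h1
    have e1 : (((n * R a : ℝ) : ℂ) * e a - ((⇑F)^[n] z - z - n * (v - t * U a))) =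
        n * (a:ℂ) - ((⇑F)^[n] z - z) := by
      conv_rhs => rw [heA a]
      push_cast; ring
    rw [e1] at k1 k2
    set d := dt (e a) (n * (a:ℂ) - ((⇑F)^[n] z - z)) with hdd
    have q1 : η * N ≤ η' * N := mul_le_mul_of_nonneg_right (by linarith) hN0'
    refine ⟨by linarith, k2.trans ?_⟩
    have q2 : 4 * (n * R a + η * N) ≤ L * N := by
      have w1 : n * R a ≤ N * (2 * C0 + t) := mul_le_mul hnN (hRb a) hRa hN0'
      have w2 := mul_le_mul_of_nonneg_right hη1 hN0'
      rw [hL]; linarith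
    have q3 := mul_le_mul_of_nonneg_right q2 k1
    have q4 : 2 * (η * N) ^ 2 ≤ L * N * (η * N) := by
      have w1 : 2 * (η * N) ≤ L * N := by
        have := mul_le_mul_of_nonneg_right (by rw [hL]; linarith : 2 * η ≤ L) hN0'
        linarith
      have := mul_le_mul_of_nonneg_right w1 (by positivity : 0 ≤ η * N)
      linarith
    have q5 : L * N * (d + η * N + η * N) ≤ L * N * (d + η' * N) := by
      refine mul_le_mul_of_nonneg_left ?_ (by rw [hL]; positivity)
      have := mul_le_mul_of_nonneg_right hη2 hN0'
      linarith
    linarith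
  refine ⟨Q, inferInstance, hne,
    { A := fun a => a
      e := e
      C0 := C0
      L := L
      κ := κ
      hC0 := hC
      disp := hd
      hA := fun a => by rw [← hUA]; exact hAC _
      he := he
      lat := h
      hL := by rw [hL]; linarith
      E1 := hE1
      E2 := fun N a => h.e2 hC hd (he a) (by rw [← hUA]; exact hAr _) N
      hκ := hκ0
      sep := hκ
      three := hthree }, ?_⟩
  intro X
  have hXv : (X:ℂ) - v ≠ 0 := by
    intro h0
    have := hpos1 (U X) (hT1 _ (hUT X))
    rw [hUA, h0, dt_zero] at this
    linarith
  obtain ⟨B, hB⟩ := hposQ (Complex.I * ((X:ℂ) - v)) (mul_ne_zero Complex.I_ne_zero hXv)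
  refine ⟨B, ?_⟩
  show 0 < ((v - (B:ℂ)) / (v - (X:ℂ))).im
  rw [← neg_sub (B:ℂ) v, ← neg_sub (X:ℂ) v, neg_div_neg_eq, Complex.div_im, ← sub_div]
  apply div_pos
  · have : dt (Complex.I * ((X:ℂ) - v)) (B - v) = ((B:ℂ) - v).im * ((X:ℂ) - v).re - ((B:ℂ) - v).re * ((X:ℂ) - v).im := by
      simp [dt]; ring
    linarith
  · exact Complex.normSq_pos.2 hXv

/-! ## Part 13 -/

theorem continuous_proj : Continuous proj := by
  unfold proj
  exact ((AddCircle.continuous_mk' 1).comp continuous_fst).prodMk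
    ((AddCircle.continuous_mk' 1).comp continuous_snd)

theorem isOpenMap_proj : IsOpenMap proj := by
  have h : IsOpenMap (fun x : ℝ => (x : AddCircle (1:ℝ))) := QuotientAddGroup.isOpenMap_coe
  exact h.prodMap h

theorem proj_surj (q : Torus) : ∃ p, proj p = q := by
  obtain ⟨a, ha⟩ := QuotientAddGroup.mk_surjective q.1
  obtain ⟨b, hb⟩ := QuotientAddGroup.mk_surjective q.2
  exact ⟨(a, b), Prod.ext ha hb⟩

theorem proj_eq {p q : R2} (h : proj p = proj q) : ∃ m n : ℤ, q = p + ((m:ℝ), (n:ℝ)) := by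
  have h1 : ((p.1 : AddCircle (1:ℝ))) = q.1 := congrArg Prod.fst h
  have h2 : ((p.2 : AddCircle (1:ℝ))) = q.2 := congrArg Prod.snd h
  have key : ∀ {a b : ℝ}, (a : AddCircle (1:ℝ)) = b → ∃ m : ℤ, b = a + m := by
    intro a b hab
    have h3 : ((b - a : ℝ) : AddCircle (1:ℝ)) = 0 := by
      rw [AddCircle.coe_sub, hab, sub_self]
    obtain ⟨m, hm⟩ := (AddCircle.coe_eq_zero_iff (1:ℝ)).1 h3
    refine ⟨m, ?_⟩
    simp at hm; linarith
  obtain ⟨m, hm⟩ := key h1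
  obtain ⟨n, hn⟩ := key h2
  exact ⟨m, n, Prod.ext hm hn⟩

theorem proj_add (p : R2) (m n : ℤ) : proj (p + ((m:ℝ), (n:ℝ))) = proj p := by
  have key : ∀ (a : ℝ) (m : ℤ), ((a + m : ℝ) : AddCircle (1:ℝ)) = a := by
    intro a m
    rw [AddCircle.coe_add]
    have : ((m:ℝ) : AddCircle (1:ℝ)) = 0 := (AddCircle.coe_eq_zero_iff (1:ℝ)).2 ⟨m, by simp⟩
    rw [this, add_zero]
  exact Prod.ext (key _ _) (key _ _)

/-- The lift in complex coordinates. -/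
def cplx (F : R2 ≃ₜ R2) : ℂ ≃ₜ ℂ :=
  Complex.equivRealProdCLM.toHomeomorph.trans
    (F.trans Complex.equivRealProdCLM.toHomeomorph.symm)

theorem cplx_apply (F : R2 ≃ₜ R2) (z : ℂ) :
    cplx F z = Complex.equivRealProdCLM.symm (F (Complex.equivRealProdCLM z)) := rfl

theorem cplx_it (F : R2 ≃ₜ R2) (n : ℕ) (z : ℂ) :
    (⇑(cplx F))^[n] z = Complex.equivRealProdCLM.symm ((⇑F)^[n] (Complex.equivRealProdCLM z)) := by
  induction n with
  | zero => exact (Complex.equivRealProdCLM.symm_apply_apply z).symm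
  | succ n ih =>
    rw [Function.iterate_succ_apply', ih, cplx_apply, Function.iterate_succ_apply',
      ContinuousLinearEquiv.apply_symm_apply]

theorem cplx_it' (F : R2 ≃ₜ R2) (n : ℕ) (z : ℂ) :
    Complex.equivRealProdCLM ((⇑(cplx F))^[n] z) = (⇑F)^[n] (Complex.equivRealProdCLM z) := by
  rw [cplx_it, ContinuousLinearEquiv.apply_symm_apply]

theorem cplx_lat {f : Torus ≃ₜ Torus} {F : R2 ≃ₜ R2} (hF : IsLiftFun ⇑f ⇑F) : LatC (cplx F) := by
  intro z m n
  have h := hF.2 (Complex.equivRealProdCLM z) (m, n)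
  rw [cplx_apply, cplx_apply]
  have e1 : Complex.equivRealProdCLM (⟨m, n⟩ : ℂ) = ((m:ℝ), (n:ℝ)) := rfl
  rw [map_add, e1]
  rw [h, map_add, ← e1, ContinuousLinearEquiv.symm_apply_apply]

theorem cplx_rot {F : R2 ≃ₜ R2} {z : ℂ} (h : Complex.equivRealProdCLM z ∈ rotSet F) :
    z ∈ rotC (cplx F) := by
  obtain ⟨x, n, hn, ht⟩ := h
  refine ⟨fun k => Complex.equivRealProdCLM.symm (x k), n, hn, ?_⟩
  have := (Complex.equivRealProdCLM.symm.continuous.tendsto _).comp ht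
  rw [ContinuousLinearEquiv.symm_apply_apply] at this
  refine this.congr fun k => ?_
  simp only [Function.comp_apply]
  rw [map_smul, map_sub, cplx_it, ContinuousLinearEquiv.apply_symm_apply, div_eq_inv_mul,
    Complex.real_smul]
  push_cast; rfl

theorem proj_it {f : Torus ≃ₜ Torus} {F : R2 ≃ₜ R2} (hF : IsLiftFun ⇑f ⇑F) (n : ℕ) (x : R2) :
    proj ((⇑F)^[n] x) = (⇑f)^[n] (proj x) := by
  induction n with
  | zero => rfl
  | succ n ih => rw [Function.iterate_succ_apply', Function.iterate_succ_apply', hF.1, ih]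

theorem cplx_trL {f : Torus ≃ₜ Torus} {F : R2 ≃ₜ R2} (hF : IsLiftFun ⇑f ⇑F)
    (htrans : ∀ U V : Set Torus, IsOpen U → IsOpen V → U.Nonempty → V.Nonempty →
      ∃ n ≥ 1, ((⇑f)^[n] '' U ∩ V).Nonempty) : TrL (cplx F) := by
  intro U V hU hV hUn hVn
  have hop : IsOpenMap (fun z : ℂ => proj (Complex.equivRealProdCLM z)) :=
    isOpenMap_proj.comp Complex.equivRealProdCLM.toHomeomorph.isOpenMap
  obtain ⟨n, hn, q, ⟨_, ⟨x, hx, rfl⟩, rfl⟩, y, hy, hxy⟩ := htrans _ _ (hop U hU) (hop V hV)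
    (hUn.image _) (hVn.image _)
  refine ⟨n, hn, x, hx, ?_⟩
  simp only at hxy
  rw [← proj_it hF] at hxy
  obtain ⟨p, q, hpq⟩ := proj_eq hxy.symm
  refine ⟨⟨p, q⟩, ⟨p, q, rfl⟩, ?_⟩
  have : (⇑(cplx F))^[n] x + ⟨p, q⟩ = y := by
    apply Complex.equivRealProdCLM.injective
    rw [map_add, cplx_it', hpq]; rfl
  rw [this]; exact hy

theorem main_ball {f : Torus ≃ₜ Torus} {F : R2 ≃ₜ R2} (hF : IsLiftFun ⇑f ⇑F)
    (htrans : ∀ U V : Set Torus, IsOpen U → IsOpen V → U.Nonempty → V.Nonempty →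
      ∃ n ≥ 1, ((⇑f)^[n] '' U ∩ V).Nonempty) {v : ℂ}
    (hv : Complex.equivRealProdCLM v ∈ interior (rotSet F)) {U V : Set ℂ} (hU : IsOpen U)
    (hV : IsOpen V) (hUn : U.Nonempty) (hVn : V.Nonempty) :
    ∃ n0 : ℕ, ∀ n ≥ n0, ∀ a, IsLat a → ‖a - n * v‖ ≤ 2 →
      ∃ x ∈ U, (⇑(cplx F))^[n] x - a ∈ V := by
  have ho : IsOpen (Complex.equivRealProdCLM ⁻¹' interior (rotSet F)) :=
    isOpen_interior.preimage Complex.equivRealProdCLM.continuous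
  obtain ⟨r, hr, hb⟩ := Metric.isOpen_iff.1 ho v hv
  obtain ⟨ι, hfin, hne, S, hS⟩ := (cplx_lat hF).exists_sys hr
    (fun z hz => cplx_rot (interior_subset (hb hz)))
  obtain ⟨x0, hx0⟩ := hUn
  obtain ⟨y0, hy0⟩ := hVn
  obtain ⟨r1, hr1, hb1⟩ := Metric.isOpen_iff.1 hU x0 hx0
  obtain ⟨r2, hr2, hb2⟩ := Metric.isOpen_iff.1 hV y0 hy0
  obtain ⟨n0, h0⟩ := S.final (cplx_trL hF htrans) v hS x0 y0 (lt_min hr1 hr2)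
  refine ⟨n0, fun n hn a ha hav => ?_⟩
  obtain ⟨x, hx, hx2⟩ := h0 n hn a ha hav
  exact ⟨x, hb1 (ball_subset_ball (min_le_left _ _) hx), hb2 (ball_subset_ball (min_le_right _ _) hx2)⟩

/-- **Theorem D.** A transitive homotopic-to-the-identity torus homeomorphism whose rotation
set has nonempty interior is topologically mixing; if moreover a lift has `(0,0)` in the
interior of its rotation set, that lift is topologically mixing on the plane. -/
theorem transitive_implies_mixing
    (f : Torus ≃ₜ Torus) (F : R2 ≃ₜ R2) (hF : IsLiftFun ⇑f ⇑F)
    (htrans : ∀ U V : Set Torus, IsOpen U → IsOpen V → U.Nonempty → V.Nonempty →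
      ∃ n ≥ 1, ((⇑f)^[n] '' U ∩ V).Nonempty) :
    ((interior (rotSet F)).Nonempty → TopologicallyMixing ⇑f) ∧
    ((((0:ℝ), (0:ℝ)) ∈ interior (rotSet F)) → TopologicallyMixing ⇑F) := by
  constructor
  · rintro ⟨p, hp⟩ U V hU hV ⟨u, hu⟩ ⟨w, hw⟩
    obtain ⟨v, rfl⟩ := Complex.equivRealProdCLM.surjective p
    have hcont : Continuous fun z : ℂ => proj (Complex.equivRealProdCLM z) :=
      continuous_proj.comp Complex.equivRealProdCLM.continuous
    have hne : ∀ {W : Set Torus} {q : Torus}, q ∈ W →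
        ((fun z : ℂ => proj (Complex.equivRealProdCLM z)) ⁻¹' W).Nonempty := by
      intro W q hq
      obtain ⟨p, rfl⟩ := proj_surj q
      obtain ⟨z, rfl⟩ := Complex.equivRealProdCLM.surjective p
      exact ⟨z, hq⟩
    obtain ⟨n0, h0⟩ := main_ball hF htrans hp (hU.preimage hcont) (hV.preimage hcont)
      (hne hu) (hne hw)
    refine ⟨n0, fun n hn => ?_⟩
    obtain ⟨m, k, hmk⟩ := exists_lat 0 (n * v)
    rw [zero_add] at hmk
    obtain ⟨x, hx, hx2⟩ := h0 n hn ⟨m, k⟩ ⟨m, k, rfl⟩ (hmk.trans (by norm_num))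
    refine ⟨_, ⟨_, hx, rfl⟩, ?_⟩
    rw [mem_preimage] at hx2
    have e1 : proj (Complex.equivRealProdCLM ((⇑(cplx F))^[n] x - ⟨m, k⟩)) =
        (⇑f)^[n] (proj (Complex.equivRealProdCLM x)) := by
      rw [← proj_it hF, ← cplx_it', map_sub,
        ← proj_add (Complex.equivRealProdCLM ((⇑(cplx F))^[n] x) - _) m k]
      congr 1
      exact sub_add_cancel _ _
    rw [← e1]; exact hx2
  · intro hp U V hU hV hUn hVn
    have hp' : Complex.equivRealProdCLM (0:ℂ) ∈ interior (rotSet F) := by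
      rw [map_zero]; exact hp
    have hcont : Continuous fun z : ℂ => Complex.equivRealProdCLM z :=
      Complex.equivRealProdCLM.continuous
    obtain ⟨n0, h0⟩ := main_ball hF htrans hp' (hU.preimage hcont) (hV.preimage hcont)
      (hUn.preimage Complex.equivRealProdCLM.surjective)
      (hVn.preimage Complex.equivRealProdCLM.surjective)
    refine ⟨n0, fun n hn => ?_⟩
    obtain ⟨x, hx, hx2⟩ := h0 n hn 0 ⟨0, 0, by simp [Complex.ext_iff]⟩ (by simp)
    refine ⟨_, ⟨_, hx, rfl⟩, ?_⟩
    rw [sub_zero, mem_preimage, cplx_it'] at hx2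
    exact hx2
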